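/- Let a ≥ 3 be an integer and let Z be a general set of m(a) = (3/2)a(a−1) + a points on a smooth cubic surface X ⊂ ℙ³. Then the graded minimal free resolution of the saturated ideal I_Z over R is 0 → R(−a−3)^{a−1} → R(−a−1)^{3a} → R(−a)^{2a+1} ⊕ R(−3) → I_Z → 0. -/

import Mathlib

/-!
Common definitions for formalizing "The minimal resolution conjecture for points
on the cubic surface" (arXiv:math/0611137).

We work with `R = k[x₀,x₁,x₂,x₃]`, closed points of `ℙ³` modeled by
`Projectivization k (Fin 4 → k)`, saturated ideals of sets of points as vanishing
ideals, genericity expressed by a nonempty basic open subset of the configuration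
space, and graded minimal free resolutions expressed by explicit homogeneous
matrices whose entries have zero constant term (no nonzero scalar entries).
-/

open MvPolynomial

noncomputable section

/-- The polynomial ring `R = k[x₀,x₁,x₂,x₃]` in four variables over `k`. -/
abbrev R4 (k : Type) [Field k] : Type := MvPolynomial (Fin 4) k

/-- The (closed) points of the projective space `ℙ³` over `k`. -/
abbrev P3 (k : Type) [Field k] : Type := Projectivization k (Fin 4 → k)

variable (k : Type) [Field k]

/-- A polynomial vanishes at a projective point if it vanishes at every
representative vector of that point. -/
def VanishesAt (f : R4 k) (p : P3 k) : Prop :=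
  ∀ (v : Fin 4 → k) (hv : v ≠ 0), Projectivization.mk k v hv = p → eval v f = 0

/-- The saturated homogeneous ideal `I_Z ⊆ R` of a set `Z` of (reduced) points of
`ℙ³`: all polynomials vanishing at every point of `Z`. -/
def pointsIdeal (Zs : Set (P3 k)) : Ideal (R4 k) where
  carrier := {f | ∀ p ∈ Zs, VanishesAt k f p}
  zero_mem' := by
    intro p _ v hv _
    simp
  add_mem' := by
    intro a b ha hb p hp v hv hmk
    have h1 := ha p hp v hv hmk
    have h2 := hb p hp v hv hmk
    simp [h1, h2]
  smul_mem' := by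
    intro c a ha p hp v hv hmk
    have h1 := ha p hp v hv hmk
    simp [smul_eq_mul, h1]

/-- An ideal of `R` is homogeneous if it is generated by homogeneous elements. -/
def IsHomogIdeal (I : Ideal (R4 k)) : Prop :=
  ∃ G : Set (R4 k), (∀ g ∈ G, ∃ d : ℕ, g.IsHomogeneous d) ∧ I = Ideal.span G

/-- Saturation of an ideal with respect to the irrelevant maximal ideal
`(x₀,…,x₃)`. -/
def satIdeal (I : Ideal (R4 k)) : Ideal (R4 k) where
  carrier := {g | ∀ i : Fin 4, ∃ N : ℕ, (X i : R4 k) ^ N * g ∈ I}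
  zero_mem' := by
    intro i
    exact ⟨0, by simp⟩
  add_mem' := by
    intro a b ha hb i
    obtain ⟨N, hN⟩ := ha i
    obtain ⟨M, hM⟩ := hb i
    refine ⟨N + M, ?_⟩
    have h1 : (X i : R4 k) ^ (N + M) * (a + b)
        = X i ^ M * (X i ^ N * a) + X i ^ N * (X i ^ M * b) := by ring
    rw [h1]
    exact Ideal.add_mem _ (Ideal.mul_mem_left _ _ hN) (Ideal.mul_mem_left _ _ hM)
  smul_mem' := by
    intro c a ha i
    obtain ⟨N, hN⟩ := ha i
    refine ⟨N, ?_⟩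
    have h1 : (X i : R4 k) ^ N * (c • a) = c * (X i ^ N * a) := by
      rw [smul_eq_mul]; ring
    rw [h1]
    exact Ideal.mul_mem_left _ _ hN

/-- The colon ideal `(I : J) = {r | r·J ⊆ I}`. -/
def icolon (I J : Ideal (R4 k)) : Ideal (R4 k) where
  carrier := {r | ∀ x ∈ J, r * x ∈ I}
  zero_mem' := by
    intro x hx
    rw [zero_mul]; exact I.zero_mem
  add_mem' := by
    intro a b ha hb x hx
    rw [add_mul]
    exact Ideal.add_mem _ (ha x hx) (hb x hx)
  smul_mem' := by
    intro c a ha x hx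
    rw [smul_eq_mul, mul_assoc]
    exact Ideal.mul_mem_left _ _ (ha x hx)

/-- A smooth cubic surface `X ⊂ ℙ³`: an irreducible homogeneous cubic form with
no singular zero (Jacobian criterion). -/
structure SmoothCubicSurface (k : Type) [Field k] : Type where
  f : MvPolynomial (Fin 4) k
  homog : f.IsHomogeneous 3
  irred : Irreducible f
  smooth : ∀ v : Fin 4 → k, v ≠ 0 → eval v f = 0 →
    ∃ i : Fin 4, eval v (pderiv i f) ≠ 0

/-- A configuration of `t` distinct points lying on `X`. -/
def ConfigOn (S : SmoothCubicSurface k) {t : ℕ} (Z : Fin t → P3 k) : Prop :=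
  Function.Injective Z ∧ ∀ i, VanishesAt k S.f (Z i)

/-- A configuration avoids the (closed locus of the) polynomial `g` on the
product of the affine cones: some choice of representatives does not annihilate `g`. -/
def Avoids {t : ℕ} (g : MvPolynomial (Fin t × Fin 4) k) (Z : Fin t → P3 k) : Prop :=
  ∃ v : Fin t → Fin 4 → k,
    (∀ i, ∃ hv : v i ≠ 0, Projectivization.mk k (v i) hv = Z i) ∧
    eval (fun q : Fin t × Fin 4 => v q.1 q.2) g ≠ 0

/-- `P` holds for a *general* set of `t` points on `X`: it holds on a nonempty
(basic) Zariski-open subset of the family of all sets of `t` points of `X`. -/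
def GeneralPointsSatisfy (S : SmoothCubicSurface k) (t : ℕ)
    (P : (Fin t → P3 k) → Prop) : Prop :=
  ∃ g : MvPolynomial (Fin t × Fin 4) k,
    (∃ Z : Fin t → P3 k, ConfigOn k S Z ∧ Avoids k g Z) ∧
    (∀ Z : Fin t → P3 k, ConfigOn k S Z → Avoids k g Z → P Z)

/-- An admissible entry of a matrix in a graded **minimal** free resolution,
mapping a generator of degree `d` into a generator of degree `e`: the entry is
homogeneous of degree `d - e`, and it is not a nonzero scalar (zero constant
coefficient). -/
def EntryOk (d e : ℕ) (q : R4 k) : Prop :=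
  (q = 0 ∨ ∃ c : ℕ, d = e + c ∧ q.IsHomogeneous c) ∧ coeff 0 q = 0

/-- Integer-degree version of `EntryOk` (for modules with generators of
arbitrary integer degrees). -/
def EntryOkZ (d e : ℤ) (q : R4 k) : Prop :=
  (q = 0 ∨ ∃ c : ℕ, d = e + (c : ℤ) ∧ q.IsHomogeneous c) ∧ coeff 0 q = 0

/-- The body of a graded minimal free resolution of length 2 over `R` of the
`R`-module `I/J`:
`0 → ⊕ R(-d2 i) --M2--> ⊕ R(-d1 j) --g--> I/J → 0`.
The generators `g j ∈ I` are homogeneous of degree `d1 j` and generate `I` mod `J`;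
`M2` is a homogeneous matrix with no nonzero scalar entries whose rows generate the
kernel, and which is injective. -/
def Res2Body (J I : Ideal (R4 k)) {n1 n2 : ℕ}
    (d1 : Fin n1 → ℕ) (d2 : Fin n2 → ℕ)
    (g : Fin n1 → R4 k) (M2 : Fin n2 → Fin n1 → R4 k) : Prop :=
  (∀ j, g j ∈ I ∧ (g j).IsHomogeneous (d1 j)) ∧
  (∀ x ∈ I, ∃ w : Fin n1 → R4 k, x - ∑ j, w j * g j ∈ J) ∧
  (∀ i j, EntryOk k (d2 i) (d1 j) (M2 i j)) ∧
  (∀ w : Fin n1 → R4 k,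
    ((∑ j, w j * g j) ∈ J) ↔ ∃ u : Fin n2 → R4 k, ∀ j, w j = ∑ i, u i * M2 i j) ∧
  (∀ u : Fin n2 → R4 k, (∀ j, (∑ i, u i * M2 i j) = 0) → u = 0)

/-- `I/J` has a graded minimal free resolution
`0 → ⊕ R(-d2 i) → ⊕ R(-d1 j) → I/J → 0` over `R`. -/
def HasMinFreeRes2 (J I : Ideal (R4 k)) {n1 n2 : ℕ}
    (d1 : Fin n1 → ℕ) (d2 : Fin n2 → ℕ) : Prop :=
  ∃ (g : Fin n1 → R4 k) (M2 : Fin n2 → Fin n1 → R4 k), Res2Body k J I d1 d2 g M2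

/-- The body of a graded minimal free resolution of length 3 over `R` of the
`R`-module `I/J`:
`0 → ⊕ R(-d3 l) --M3--> ⊕ R(-d2 i) --M2--> ⊕ R(-d1 j) --g--> I/J → 0`. -/
def Res3Body (J I : Ideal (R4 k)) {n1 n2 n3 : ℕ}
    (d1 : Fin n1 → ℕ) (d2 : Fin n2 → ℕ) (d3 : Fin n3 → ℕ)
    (g : Fin n1 → R4 k) (M2 : Fin n2 → Fin n1 → R4 k)
    (M3 : Fin n3 → Fin n2 → R4 k) : Prop :=
  (∀ j, g j ∈ I ∧ (g j).IsHomogeneous (d1 j)) ∧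
  (∀ x ∈ I, ∃ w : Fin n1 → R4 k, x - ∑ j, w j * g j ∈ J) ∧
  (∀ i j, EntryOk k (d2 i) (d1 j) (M2 i j)) ∧
  (∀ i j, EntryOk k (d3 i) (d2 j) (M3 i j)) ∧
  (∀ w : Fin n1 → R4 k,
    ((∑ j, w j * g j) ∈ J) ↔ ∃ u : Fin n2 → R4 k, ∀ j, w j = ∑ i, u i * M2 i j) ∧
  (∀ u : Fin n2 → R4 k,
    (∀ j, (∑ i, u i * M2 i j) = 0) ↔ ∃ t : Fin n3 → R4 k, ∀ i, u i = ∑ l, t l * M3 l i) ∧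
  (∀ t : Fin n3 → R4 k, (∀ i, (∑ l, t l * M3 l i) = 0) → t = 0)

/-- `I/J` has a graded minimal free resolution
`0 → ⊕ R(-d3 l) → ⊕ R(-d2 i) → ⊕ R(-d1 j) → I/J → 0` over `R`.
Taking `J = ⊥` this is a resolution of the ideal `I ⊆ R`; taking `J = (f)` it is a
resolution of `I/(f) ⊆ R_X = R/(f)`; taking `J = I_C` a resolution of `I/I_C`. -/
def HasMinFreeRes3 (J I : Ideal (R4 k)) {n1 n2 n3 : ℕ}
    (d1 : Fin n1 → ℕ) (d2 : Fin n2 → ℕ) (d3 : Fin n3 → ℕ) : Prop :=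
  ∃ (g : Fin n1 → R4 k) (M2 : Fin n2 → Fin n1 → R4 k) (M3 : Fin n3 → Fin n2 → R4 k),
    Res3Body k J I d1 d2 d3 g M2 M3

/-- The Betti numbers read off from a minimal free resolution
`0 → F₃ → F₂ → F₁ → I_Z → 0` of the ideal of `Z` (so that
`F_i = ⊕_j R(-i-j)^{b_{i,j}}` in the resolution of `R/I_Z`, with `F₀ = R`). -/
def bettiCount {n1 n2 n3 : ℕ} (d1 : Fin n1 → ℕ) (d2 : Fin n2 → ℕ) (d3 : Fin n3 → ℕ)
    (i j : ℕ) : ℕ :=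
  if i = 0 then (if j = 0 then 1 else 0)
  else if i = 1 then (Finset.univ.filter fun l => d1 l = 1 + j).card
  else if i = 2 then (Finset.univ.filter fun l => d2 l = 2 + j).card
  else if i = 3 then (Finset.univ.filter fun l => d3 l = 3 + j).card
  else 0

/-- The Hilbert polynomial `P_X(t) = (3/2)t(t+1) + 1` of the cubic surface. -/
def PXcubic (t : ℕ) : ℕ := 3 * (t * (t + 1) / 2) + 1

/-- The saturated homogeneous ideal of an integral curve lying on `X`. -/
def IsCurveIdealOn (S : SmoothCubicSurface k) (I : Ideal (R4 k)) : Prop :=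
  IsHomogIdeal k I ∧ I.IsPrime ∧ S.f ∈ I ∧
    ringKrullDim (R4 k ⧸ I) = ((2 : ℕ∞) : WithBot ℕ∞)

/-- The Jacobian criterion at a point of the cone: some 2×2 minor of the Jacobian
matrix of elements of `I` is nonzero, i.e. the curve is smooth there. -/
def CurveSmoothAt (I : Ideal (R4 k)) (v : Fin 4 → k) : Prop :=
  ∃ g₁ ∈ I, ∃ g₂ ∈ I, ∃ i j : Fin 4,
    eval v (pderiv i g₁) * eval v (pderiv j g₂)
      - eval v (pderiv j g₁) * eval v (pderiv i g₂) ≠ 0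

/-- A smooth (integral) curve on `X`. -/
def IsSmoothCurveIdealOn (S : SmoothCubicSurface k) (I : Ideal (R4 k)) : Prop :=
  IsCurveIdealOn k S I ∧
  ∀ v : Fin 4 → k, v ≠ 0 → (∀ g ∈ I, eval v g = 0) → CurveSmoothAt k I v

/-- The coordinate ring `R/I` of a curve has depth 2 (a regular sequence of two
positive-degree homogeneous elements), i.e. the curve is arithmetically
Cohen–Macaulay. -/
def IsACMIdeal (I : Ideal (R4 k)) : Prop :=
  ∃ r₁ r₂ : R4 k,
    (∃ d₁ : ℕ, 0 < d₁ ∧ r₁.IsHomogeneous d₁) ∧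
    (∃ d₂ : ℕ, 0 < d₂ ∧ r₂.IsHomogeneous d₂) ∧
    (∀ x : R4 k, r₁ * x ∈ I → x ∈ I) ∧
    (∀ x : R4 k, r₂ * x ∈ I ⊔ Ideal.span {r₁} → x ∈ I ⊔ Ideal.span {r₁})

/-- The Hilbert function `t ↦ dim_k (R/I)_t`. -/
def hilbFn (I : Ideal (R4 k)) (t : ℕ) : ℕ :=
  Module.finrank k ↥(homogeneousSubmodule (Fin 4) k t) -
    Module.finrank k ↥(homogeneousSubmodule (Fin 4) k t ⊓
      Submodule.restrictScalars k I)

/-- The subscheme with saturated ideal `I` has degree `d` and (arithmetic) genus `g`,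
read off from the Hilbert polynomial `P(t) = d·t + 1 - g`. -/
def HasDegreeGenus (I : Ideal (R4 k)) (d : ℕ) (g : ℤ) : Prop :=
  ∃ N : ℕ, ∀ t : ℕ, N ≤ t → (hilbFn k I t : ℤ) = d * t + 1 - g

/-- Linear equivalence of divisors on `X`: the divisor with (divisorial) ideal `I`
is linearly equivalent to (divisor of `J`) + `a·H`, where `H` is the hyperplane
class.  Concretely, there are homogeneous forms `q, p` with `deg p = deg q + a`,
nonzero on `X`, with `q·I = p·J` in `R_X = R/(f)`.  (Taking `J = ⊤` expresses
that the divisor of `I` is linearly equivalent to `aH`.) -/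
def LinEquivOnX (S : SmoothCubicSurface k) (I J : Ideal (R4 k)) (a : ℤ) : Prop :=
  ∃ (mq mp : ℕ) (q p : R4 k), (mp : ℤ) = (mq : ℤ) + a ∧
    q.IsHomogeneous mq ∧ p.IsHomogeneous mp ∧
    q ∉ Ideal.span {S.f} ∧ p ∉ Ideal.span {S.f} ∧
    Ideal.span {q} * I ⊔ Ideal.span {S.f} = Ideal.span {p} * J ⊔ Ideal.span {S.f}

/-- Linear equivalence, on the curve `C` with ideal `IC`, of the divisor with
ideal `IG` to `r·H_C` (`H_C` the hyperplane section of `C`): there are homogeneous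
forms `q, p`, nonzero on `C`, with `deg p = deg q + r` and `q·I_{G,C} = (p)` in
`R/I_C`. -/
def DivOnCurveEquivH (IC IG : Ideal (R4 k)) (r : ℤ) : Prop :=
  ∃ (mq mp : ℕ) (q p : R4 k), (mp : ℤ) = (mq : ℤ) + r ∧
    q.IsHomogeneous mq ∧ p.IsHomogeneous mp ∧ q ∉ IC ∧ p ∉ IC ∧
    Ideal.span {q} * IG ⊔ IC = Ideal.span {p} ⊔ IC

/-- The saturated homogeneous ideal of a zero-dimensional subscheme of `ℙ³`. -/
def IsZeroDimIdeal (I : Ideal (R4 k)) : Prop :=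
  IsHomogIdeal k I ∧ satIdeal k I = I ∧
    ringKrullDim (R4 k ⧸ I) = ((1 : ℕ∞) : WithBot ℕ∞)

/-- An arithmetically Gorenstein zero-dimensional subscheme of `ℙ³`: its ideal has a
graded minimal free resolution of length 3 whose last free module has rank one. -/
def IsAGPointsIdeal (I : Ideal (R4 k)) : Prop :=
  IsZeroDimIdeal k I ∧
  ∃ (n1 n2 : ℕ) (d1 : Fin n1 → ℕ) (d2 : Fin n2 → ℕ) (s : ℕ),
    HasMinFreeRes3 k ⊥ I d1 d2 (fun _ : Fin 1 => s)

/-- `V₁` and `V₂` are directly Gorenstein linked by the arithmetically Gorenstein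
scheme with ideal `IG`: `I_G ⊆ I_{V₁} ∩ I_{V₂}`, `I_G : I_{V₁} = I_{V₂}` and
`I_G : I_{V₂} = I_{V₁}`. -/
def IsGLinked (IG I1 I2 : Ideal (R4 k)) : Prop :=
  IG ≤ I1 ⊓ I2 ∧ icolon k IG I1 = I2 ∧ icolon k IG I2 = I1

/-- The divisor `G` (with ideal `IG`) on the curve `C ⊂ X` (with ideal `IC`) is
linearly equivalent to `m·H_C - K_C`.  By adjunction on the cubic surface
(`K_X = -H`) this says `G + C|_C ∼ (m+1)·H_C` on `C`, where `C|_C` is realized as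
the scheme-theoretic intersection `C ∩ C'` with any curve `C' ∼ C`, `C' ≠ C`,
chosen disjoint from `G`. -/
def EquivHminusKC (S : SmoothCubicSurface k) (IC IG : Ideal (R4 k)) (m : ℤ) : Prop :=
  ∃ IC' : Ideal (R4 k), IsCurveIdealOn k S IC' ∧ IC' ≠ IC ∧
    LinEquivOnX k S IC' IC 0 ∧
    satIdeal k (satIdeal k (IC ⊔ IC') ⊔ IG) = ⊤ ∧
    DivOnCurveEquivH k IC (IG ⊓ satIdeal k (IC ⊔ IC')) (m + 1)

/-- A line on `X`: a smooth integral curve of degree 1, genus 0 on `X`. -/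
def IsLineOn (S : SmoothCubicSurface k) (I : Ideal (R4 k)) : Prop :=
  IsSmoothCurveIdealOn k S I ∧ HasDegreeGenus k I 1 0

/-- A smooth conic on `X`: a smooth integral curve of degree 2, genus 0 on `X`. -/
def IsConicOn (S : SmoothCubicSurface k) (I : Ideal (R4 k)) : Prop :=
  IsSmoothCurveIdealOn k S I ∧ HasDegreeGenus k I 2 0

/-- A twisted cubic on `X`: a smooth integral curve of degree 3, genus 0 on `X`. -/
def IsTwistedCubicOn (S : SmoothCubicSurface k) (I : Ideal (R4 k)) : Prop :=
  IsSmoothCurveIdealOn k S I ∧ HasDegreeGenus k I 3 0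

/-- The curve `C ⊂ X` moves in a linear system of (projective) dimension `dim`,
i.e. `h⁰(O_X(C)) = dim + 1`.  Global sections of `O_X(C)` are computed, for any
homogeneous `q ∈ I_C` of degree `s` not divisible by `f`, as the degree-`s` part of
the colon ideal `((q, f) : I_C)` modulo `(f)`. -/
def MovesInLinSysOfDim (S : SmoothCubicSurface k) (IC : Ideal (R4 k)) (dim : ℤ) : Prop :=
  ∀ (s : ℕ) (q : R4 k), q.IsHomogeneous s → q ∈ IC → q ∉ Ideal.span {S.f} →
    (Module.finrank k ↥(homogeneousSubmodule (Fin 4) k s ⊓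
        Submodule.restrictScalars k (icolon k (Ideal.span {q} ⊔ Ideal.span {S.f}) IC)) : ℤ)
      - (Module.finrank k ↥(homogeneousSubmodule (Fin 4) k s ⊓
        Submodule.restrictScalars k (icolon k (Ideal.span {q} ⊔ Ideal.span {S.f}) IC) ⊓
        Submodule.restrictScalars k (Ideal.span {S.f})) : ℤ) = dim + 1

/-- `I/(f₀)` is a maximal Cohen–Macaulay module over `R/(f₀)` (3-dimensional):
it admits a regular sequence of three positive-degree homogeneous elements. -/
def IsMCMQuotient (f0 : R4 k) (I : Ideal (R4 k)) : Prop :=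
  ∃ r₁ r₂ r₃ : R4 k,
    (∃ d : ℕ, 0 < d ∧ r₁.IsHomogeneous d) ∧
    (∃ d : ℕ, 0 < d ∧ r₂.IsHomogeneous d) ∧
    (∃ d : ℕ, 0 < d ∧ r₃.IsHomogeneous d) ∧
    (∀ x ∈ I, r₁ * x ∈ Ideal.span {f0} → x ∈ Ideal.span {f0}) ∧
    (∀ x ∈ I, r₂ * x ∈ Ideal.span {r₁} * I ⊔ Ideal.span {f0} →
      x ∈ Ideal.span {r₁} * I ⊔ Ideal.span {f0}) ∧
    (∀ x ∈ I, r₃ * x ∈ Ideal.span {r₁} * I ⊔ Ideal.span {r₂} * I ⊔ Ideal.span {f0} →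
      x ∈ Ideal.span {r₁} * I ⊔ Ideal.span {r₂} * I ⊔ Ideal.span {f0}) ∧
    (∃ x ∈ I, x ∉ Ideal.span {r₁} * I ⊔ Ideal.span {r₂} * I ⊔ Ideal.span {r₃} * I
      ⊔ Ideal.span {f0})

end

namespace Polynomial

theorem pi_eq_zero_of_forall_coeff {P ι : Type*} [CommRing P] [Fintype ι] (u : ι → P[X])
    (h : ∀ n, (∀ m, n < m → ∀ l, (u l).coeff m = 0) → ∀ j, (u j).coeff n = 0) : u = 0 := by
  classical
  set B := Finset.univ.sup fun j => (u j).natDegree + 1 with hB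
  have key : ∀ m n, B ≤ n + m → ∀ j, (u j).coeff n = 0 := by
    intro m
    induction m with
    | zero =>
      intro n hn j
      apply coeff_eq_zero_of_natDegree_lt
      have := Finset.le_sup (f := fun j => (u j).natDegree + 1) (Finset.mem_univ j)
      omega
    | succ m ih =>
      intro n hn
      refine h n fun m' hm' => ih m' (by omega)
  ext j n
  exact key B n (by omega) j

namespace CompanionRes

open Matrix

variable {P ι κ : Type*} [CommRing P] [Fintype ι] [Fintype κ] [DecidableEq ι] [DecidableEq κ]

/-- Coefficientwise inclusion of vectors over `P` into vectors over `P[X]`. -/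
noncomputable def vC (w : ι → P) : ι → P[X] := fun i => C (w i)

theorem vC_add (v w : ι → P) : vC (v + w) = vC v + vC w := by
  ext1 i; simp [vC]

theorem vC_vecMul (w : ι → P) (σ : Matrix ι κ P) : vC (w ᵥ* σ) = vC w ᵥ* σ.map C := by
  ext1 i; simp [vC, Matrix.vecMul, dotProduct]

theorem exists_eq_linear_add_const (σ : Matrix ι ι P) (w : ι → P[X]) :
    ∃ (u : ι → P[X]) (w₀ : ι → P), w = u ᵥ* ((X : P[X]) • (1 : Matrix ι ι P[X]) - σ.map C) + vC w₀ := by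
  have hadd : ∀ v w : ι → P[X],
      (∃ (u : ι → P[X]) (w₀ : ι → P), v = u ᵥ* ((X : P[X]) • (1 : Matrix ι ι P[X]) - σ.map C) + vC w₀) →
      (∃ (u : ι → P[X]) (w₀ : ι → P), w = u ᵥ* ((X : P[X]) • (1 : Matrix ι ι P[X]) - σ.map C) + vC w₀) →
      ∃ (u : ι → P[X]) (w₀ : ι → P), v + w = u ᵥ* ((X : P[X]) • (1 : Matrix ι ι P[X]) - σ.map C) + vC w₀ := by
    rintro v w ⟨u, w₀, rfl⟩ ⟨u', w₀', rfl⟩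
    refine ⟨u + u', w₀ + w₀', ?_⟩
    rw [add_vecMul, vC_add]; abel
  have hmon : ∀ (i : ι) (p : P) (n : ℕ), ∃ (u : ι → P[X]) (w₀ : ι → P),
      (Pi.single i (C p * X ^ n) : ι → P[X]) =
        u ᵥ* ((X : P[X]) • (1 : Matrix ι ι P[X]) - σ.map C) + vC w₀ := by
    intro i p n
    induction n with
    | zero =>
      refine ⟨0, Pi.single i p, ?_⟩
      ext1 j
      by_cases h : j = i
      · subst h; simp [vC]
      · simp [vC, h]
    | succ n ih =>
      obtain ⟨u, w₀, h⟩ := ih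
      refine ⟨(X : P[X]) • u + vC w₀, w₀ ᵥ* σ, ?_⟩
      have : (Pi.single i (C p * X ^ (n + 1)) : ι → P[X]) = (X : P[X]) • Pi.single i (C p * X ^ n) := by
        rw [← Pi.single_smul]; congr 1; simp only [smul_eq_mul]; ring
      rw [this, h, vC_vecMul, add_vecMul, smul_vecMul, smul_add, add_assoc, vecMul_sub (A := _) (B := σ.map C) (x := vC w₀),
        vecMul_smul, vecMul_one]
      abel
  have hsing : ∀ (i : ι) (p : P[X]), ∃ (u : ι → P[X]) (w₀ : ι → P),
      (Pi.single i p : ι → P[X]) =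
        u ᵥ* ((X : P[X]) • (1 : Matrix ι ι P[X]) - σ.map C) + vC w₀ := by
    intro i p
    induction p using Polynomial.induction_on' with
    | add p q hp hq => rw [Pi.single_add]; exact hadd _ _ hp hq
    | monomial n a => rw [← C_mul_X_pow_eq_monomial]; exact hmon i a n
  rw [← Finset.univ_sum_single w]
  refine Finset.sum_induction _ (fun w => ∃ (u : ι → P[X]) (w₀ : ι → P),
    w = u ᵥ* ((X : P[X]) • (1 : Matrix ι ι P[X]) - σ.map C) + vC w₀) hadd ?_ (fun i _ => hsing i _)
  exact ⟨0, 0, by ext1; simp [vC]⟩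

theorem exists_eq_quadratic_add (p q : Matrix κ κ P) (w : κ → P[X]) :
    ∃ (c : κ → P[X]) (t₀ t₁ : κ → P),
      w = c ᵥ* ((X ^ 2 : P[X]) • (1 : Matrix κ κ P[X]) - (X : P[X]) • q.map C - p.map C)
        + vC t₀ + (X : P[X]) • vC t₁ := by
  set T : Matrix κ κ P[X] := (X ^ 2 : P[X]) • (1 : Matrix κ κ P[X]) - (X : P[X]) • q.map C - p.map C
  have hadd : ∀ v w : κ → P[X],
      (∃ (c : κ → P[X]) (t₀ t₁ : κ → P), v = c ᵥ* T + vC t₀ + (X : P[X]) • vC t₁) →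
      (∃ (c : κ → P[X]) (t₀ t₁ : κ → P), w = c ᵥ* T + vC t₀ + (X : P[X]) • vC t₁) →
      ∃ (c : κ → P[X]) (t₀ t₁ : κ → P), v + w = c ᵥ* T + vC t₀ + (X : P[X]) • vC t₁ := by
    rintro v w ⟨u, a, b, rfl⟩ ⟨u', a', b', rfl⟩
    refine ⟨u + u', a + a', b + b', ?_⟩
    rw [add_vecMul, vC_add, vC_add, smul_add]; abel
  have hmon : ∀ (i : κ) (r : P) (n : ℕ), ∃ (c : κ → P[X]) (t₀ t₁ : κ → P),
      (Pi.single i (C r * X ^ n) : κ → P[X]) = c ᵥ* T + vC t₀ + (X : P[X]) • vC t₁ := by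
    intro i r n
    induction n with
    | zero =>
      refine ⟨0, Pi.single i r, 0, ?_⟩
      ext1 j
      by_cases h : j = i
      · subst h; simp [vC]
      · simp [vC, h]
    | succ n ih =>
      obtain ⟨u, a, b, h⟩ := ih
      refine ⟨(X : P[X]) • u + vC b, b ᵥ* p, a + b ᵥ* q, ?_⟩
      have : (Pi.single i (C r * X ^ (n + 1)) : κ → P[X]) = (X : P[X]) • Pi.single i (C r * X ^ n) := by
        rw [← Pi.single_smul]; congr 1; simp only [smul_eq_mul]; ring
      have hT : vC b ᵥ* T = (X ^ 2 : P[X]) • vC b - (X : P[X]) • vC (b ᵥ* q) - vC (b ᵥ* p) := by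
        simp only [T]
        rw [vecMul_sub, vecMul_sub, vecMul_smul, vecMul_one, vecMul_smul, vC_vecMul, vC_vecMul]
      rw [this, h, add_vecMul, smul_vecMul, hT, vC_add]
      simp only [smul_add, smul_smul, pow_two]
      abel
  have hsing : ∀ (i : κ) (r : P[X]), ∃ (c : κ → P[X]) (t₀ t₁ : κ → P),
      (Pi.single i r : κ → P[X]) = c ᵥ* T + vC t₀ + (X : P[X]) • vC t₁ := by
    intro i r
    induction r using Polynomial.induction_on' with
    | add p q hp hq => rw [Pi.single_add]; exact hadd _ _ hp hq
    | monomial n a => rw [← C_mul_X_pow_eq_monomial]; exact hmon i a n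
  rw [← Finset.univ_sum_single w]
  refine Finset.sum_induction _ (fun w => ∃ (c : κ → P[X]) (t₀ t₁ : κ → P),
    w = c ᵥ* T + vC t₀ + (X : P[X]) • vC t₁) hadd ?_ (fun i _ => hsing i _)
  exact ⟨0, 0, 0, by ext1; simp [vC]⟩

theorem eq_zero_of_vecMul_linear (σ : Matrix ι ι P) (u : ι → P[X]) (w : ι → P)
    (h : u ᵥ* ((X : P[X]) • (1 : Matrix ι ι P[X]) - σ.map C) + vC w = 0) : u = 0 := by
  refine pi_eq_zero_of_forall_coeff u fun n hn j => ?_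
  have := congrArg (fun x => (x j).coeff (n + 1)) h
  simp only [vecMul_sub, vecMul_smul, vecMul_one, Pi.add_apply, Pi.sub_apply, Pi.smul_apply,
    smul_eq_mul, coeff_add, coeff_sub, coeff_X_mul, vecMul, dotProduct, Matrix.map_apply, vC,
    finsetSum_coeff, coeff_mul_C, coeff_C_succ, Pi.zero_apply, coeff_zero] at this
  simpa [hn (n + 1) (by omega)] using this

theorem eq_zero_of_vecMul_quadratic (p q : Matrix κ κ P) (c : κ → P[X])
    (h : c ᵥ* ((X ^ 2 : P[X]) • (1 : Matrix κ κ P[X]) - (X : P[X]) • q.map C - p.map C) = 0) :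
    c = 0 := by
  refine pi_eq_zero_of_forall_coeff c fun n hn j => ?_
  rw [vecMul_sub, vecMul_sub] at h
  have := congrArg (fun x => (x j).coeff (n + 2)) h
  simp only [vecMul_smul, vecMul_one, Pi.sub_apply, Pi.smul_apply,
    smul_eq_mul, coeff_sub, coeff_X_mul, coeff_X_pow_mul, vecMul, dotProduct, Matrix.map_apply,
    finsetSum_coeff, coeff_mul_C, Pi.zero_apply, coeff_zero] at this
  simpa [hn (n + 1) (by omega), hn (n + 2) (by omega)] using this

/-- The data of a module of rank at most `3` over `P`, embedded in `P[X]/(f)`. -/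
structure Data (g : ι → P[X]) (f : P[X]) (σ : Matrix ι ι P) (φ : ι → P)
    (α : Matrix κ ι P) (p q : Matrix κ κ P) : Prop where
  monic : f.Monic
  deg : f.natDegree = 3
  degg : ∀ j, (g j).degree < 3
  mulX : ∀ j, X * g j = (∑ l, C (σ j l) * g l) + C (φ j) * f
  rel : ∀ i, ∑ j, C (α i j) * g j = 0
  span : ∀ w : ι → P, ∑ j, C (w j) * g j = 0 → ∃ u v : κ → P, w = u ᵥ* α + v ᵥ* (α * σ)
  indep : ∀ u v : κ → P, u ᵥ* α + v ᵥ* (α * σ) = 0 → u = 0 ∧ v = 0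
  sq : α * σ * σ = p * α + q * (α * σ)

variable [IsDomain P] {g : ι → P[X]} {f : P[X]} {σ : Matrix ι ι P} {φ : ι → P}
    {α : Matrix κ ι P} {p q : Matrix κ κ P}

namespace Data

theorem linear_dot (D : Data g f σ φ α p q) (u : ι → P[X]) :
    (u ᵥ* ((X : P[X]) • (1 : Matrix ι ι P[X]) - σ.map C)) ⬝ᵥ g = (u ⬝ᵥ vC φ) * f := by
  rw [← dotProduct_mulVec, sub_mulVec, smul_mulVec, one_mulVec]
  have : (X : P[X]) • g - σ.map C *ᵥ g = f • vC φ := by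
    ext1 j
    simp only [Pi.sub_apply, Pi.smul_apply, smul_eq_mul, D.mulX j, mulVec, dotProduct, map_apply, vC]
    ring
  rw [this, dotProduct_smul, smul_eq_mul, mul_comm]

theorem rel_dot (D : Data g f σ φ α p q) (t : κ → P[X]) : (t ᵥ* α.map C) ⬝ᵥ g = 0 := by
  rw [← dotProduct_mulVec]
  have : α.map C *ᵥ g = 0 := by
    ext1 i
    simpa [mulVec, dotProduct] using D.rel i
  simp [this]

/-- Exactness at the generators. -/
theorem ker_gens (D : Data g f σ φ α p q) (w : ι → P[X]) (w₀ : P[X]) :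
    w ⬝ᵥ g + w₀ * f = 0 ↔ ∃ (u : ι → P[X]) (t : κ → P[X]),
      w = u ᵥ* ((X : P[X]) • (1 : Matrix ι ι P[X]) - σ.map C) + t ᵥ* α.map C ∧
        w₀ = - (u ⬝ᵥ vC φ) := by
  have hf : f ≠ 0 := D.monic.ne_zero
  constructor
  · intro h
    obtain ⟨u, w', hw⟩ := exists_eq_linear_add_const σ w
    have h1 : vC w' ⬝ᵥ g + (w₀ + u ⬝ᵥ vC φ) * f = 0 := by
      rw [hw, add_dotProduct, D.linear_dot] at h
      linear_combination h
    have hdeg : (vC w' ⬝ᵥ g).degree < 3 := by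
      refine lt_of_le_of_lt (degree_sum_le _ _) ?_
      rw [Finset.sup_lt_iff (by exact WithBot.bot_lt_coe _)]
      intro j _
      refine lt_of_le_of_lt ?_ (D.degg j)
      simp only [vC]
      rw [degree_mul]
      calc _ ≤ 0 + (g j).degree := by gcongr; exact degree_C_le
        _ = _ := by simp
    have h2 : w₀ + u ⬝ᵥ vC φ = 0 := by
      by_contra h2
      have h3 : (w₀ + u ⬝ᵥ vC φ) * f = - (vC w' ⬝ᵥ g) := by linear_combination h1
      have h4 := congrArg degree h3
      rw [degree_neg, degree_mul, degree_eq_natDegree h2, degree_eq_natDegree hf, D.deg] at h4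
      rw [← h4] at hdeg
      norm_cast at hdeg
    have h5 : vC w' ⬝ᵥ g = 0 := by rw [h2] at h1; simpa using h1
    obtain ⟨a, b, hab⟩ := D.span w' h5
    -- `b α σ = X b α - (b α) (X - σ)`
    refine ⟨u - vC (b ᵥ* α), vC a + (X : P[X]) • vC b, ?_, ?_⟩
    · rw [hw, hab, vC_add, sub_vecMul, add_vecMul, vecMul_sub, ← vecMul_vecMul, vC_vecMul, vC_vecMul (b ᵥ* α),
        vC_vecMul, smul_vecMul]
      rw [vecMul_sub, vecMul_smul (vC b ᵥ* α.map C), vecMul_one]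
      abel
    · have h6 : vC (b ᵥ* α) ⬝ᵥ vC φ = 0 := by
        have e1 := D.linear_dot (vC (b ᵥ* α))
        have e2 : vC (b ᵥ* α) ᵥ* ((X : P[X]) • (1 : Matrix ι ι P[X]) - σ.map C)
            = (X : P[X]) • vC (b ᵥ* α) - vC (b ᵥ* (α * σ)) := by
          rw [vecMul_sub, vecMul_smul, vecMul_one, ← vecMul_vecMul b, vC_vecMul (b ᵥ* α)]
        have e3 : vC (b ᵥ* α) ⬝ᵥ g = 0 := by rw [vC_vecMul]; exact D.rel_dot _
        have e4 : vC (b ᵥ* (α * σ)) ⬝ᵥ g = 0 := by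
          have : vC (b ᵥ* (α * σ)) = vC w' - vC a ᵥ* α.map C := by
            rw [hab, vC_add, vC_vecMul a]; abel
          rw [this, sub_dotProduct, h5, D.rel_dot, sub_zero]
        rw [e2, sub_dotProduct, smul_dotProduct, e3, e4] at e1
        simp only [smul_zero, sub_zero] at e1
        exact (mul_eq_zero.mp e1.symm).resolve_right hf
      rw [sub_dotProduct, h6, sub_zero]
      linear_combination h2
  · rintro ⟨u, t, rfl, rfl⟩
    rw [add_dotProduct, D.linear_dot, D.rel_dot]; ring

/-- The relation expressing that the columns of the last matrix are syzygies. -/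
theorem syz (D : Data g f σ φ α p q) (c : κ → P[X]) :
    (-(c ᵥ* ((X : P[X]) • α.map C + (α * σ).map C - (q * α).map C)))
        ᵥ* ((X : P[X]) • (1 : Matrix ι ι P[X]) - σ.map C)
      + (c ᵥ* ((X ^ 2 : P[X]) • (1 : Matrix κ κ P[X]) - (X : P[X]) • q.map C - p.map C))
        ᵥ* α.map C = 0 := by
  have hsq := congrArg (fun M : Matrix κ ι P => M.map (C : P →+* P[X])) D.sq
  simp only [Matrix.map_mul, Matrix.map_add _ (map_add (C : P →+* P[X]))] at hsq
  rw [neg_vecMul, vecMul_vecMul, vecMul_vecMul, neg_add_eq_sub, ← vecMul_sub]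
  convert vecMul_zero c
  simp only [Matrix.map_mul, Matrix.sub_mul, Matrix.mul_sub, Matrix.add_mul, Matrix.smul_mul,
    Matrix.mul_smul, Matrix.mul_one, Matrix.one_mul, smul_sub, smul_add, smul_smul, pow_two,
    Matrix.mul_assoc]
  rw [← Matrix.mul_assoc (α.map C)]
  simp only [hsq]
  abel

/-- Exactness at the first syzygies. -/
theorem ker_syz (D : Data g f σ φ α p q) (u : ι → P[X]) (t : κ → P[X]) :
    (u ᵥ* ((X : P[X]) • (1 : Matrix ι ι P[X]) - σ.map C) + t ᵥ* α.map C = 0 ∧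
        -(u ⬝ᵥ vC φ) = 0) ↔
      ∃ c : κ → P[X],
        u = -(c ᵥ* ((X : P[X]) • α.map C + (α * σ).map C - (q * α).map C)) ∧
        t = c ᵥ* ((X ^ 2 : P[X]) • (1 : Matrix κ κ P[X]) - (X : P[X]) • q.map C - p.map C) := by
  have hf : f ≠ 0 := D.monic.ne_zero
  constructor
  · rintro ⟨h, -⟩
    obtain ⟨c, t₀, t₁, ht⟩ := exists_eq_quadratic_add p q t
    have hs := D.syz c
    set T := c ᵥ* ((X ^ 2 : P[X]) • (1 : Matrix κ κ P[X]) - (X : P[X]) • q.map C - p.map C)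
    set U := c ᵥ* ((X : P[X]) • α.map C + (α * σ).map C - (q * α).map C)
    have h1 : (u + U + vC (t₁ ᵥ* α)) ᵥ* ((X : P[X]) • (1 : Matrix ι ι P[X]) - σ.map C)
        + vC (t₀ ᵥ* α + t₁ ᵥ* (α * σ)) = 0 := by
      have e2 : vC (t₁ ᵥ* α) ᵥ* ((X : P[X]) • (1 : Matrix ι ι P[X]) - σ.map C)
            = (X : P[X]) • vC (t₁ ᵥ* α) - vC (t₁ ᵥ* (α * σ)) := by
          rw [vecMul_sub, vecMul_smul, vecMul_one, ← vecMul_vecMul t₁, vC_vecMul (t₁ ᵥ* α)]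
      rw [add_vecMul, add_vecMul, e2, vC_add, vC_vecMul t₀, vC_vecMul t₁ α]
      rw [ht, add_vecMul, add_vecMul, smul_vecMul] at h
      rw [neg_vecMul] at hs
      have e3 : T ᵥ* α.map C = U ᵥ* ((X : P[X]) • (1 : Matrix ι ι P[X]) - σ.map C) := by
        rw [← sub_eq_zero, ← hs]; abel
      rw [e3] at h
      rw [← h]; abel
    have h2 := eq_zero_of_vecMul_linear σ _ _ h1
    rw [h2, zero_vecMul, zero_add] at h1
    have h3 : t₀ ᵥ* α + t₁ ᵥ* (α * σ) = 0 := by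
      ext1 j
      exact C_injective (by simpa [vC] using congrFun h1 j)
    obtain ⟨rfl, rfl⟩ := D.indep _ _ h3
    have hv0 : vC (0 : κ → P) = 0 := by ext1; simp [vC]
    have hv1 : vC (0 : ι → P) = 0 := by ext1; simp [vC]
    refine ⟨c, ?_, ?_⟩
    · rw [zero_vecMul, hv1, add_zero] at h2
      exact eq_neg_of_add_eq_zero_left h2
    · rw [ht, hv0]; simp [T]
  · rintro ⟨c, rfl, rfl⟩
    refine ⟨D.syz c, ?_⟩
    have h := (D.ker_gens 0 (-(-(c ᵥ* ((X : P[X]) • α.map C + (α * σ).map C - (q * α).map C)) ⬝ᵥ vC φ))).mpr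
      ⟨_, _, (D.syz c).symm, rfl⟩
    rw [zero_dotProduct, zero_add] at h
    exact (mul_eq_zero.mp h).resolve_right hf

end Data

end CompanionRes

end Polynomial

namespace MvPolynomial

/-- All monomials of `p` have degree `j - i` (so `p = 0` if `j < i`). -/
def HomW {σ K : Type*} [CommRing K] (p : MvPolynomial σ K) (i j : ℕ) : Prop :=
  ∀ m : σ →₀ ℕ, coeff m p ≠ 0 → m.degree + i = j

namespace HomW

variable {σ K : Type*} [CommRing K] {p q : MvPolynomial σ K} {i j i' j' : ℕ}

theorem zero : HomW (0 : MvPolynomial σ K) i j := fun m hm => absurd (coeff_zero m) hm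

theorem add (hp : HomW p i j) (hq : HomW q i j) : HomW (p + q) i j := by
  intro m hm
  by_cases h : coeff m p = 0
  · refine hq m fun h' => hm ?_
    rw [coeff_add, h, h', add_zero]
  · exact hp m h

theorem neg (hp : HomW p i j) : HomW (-p) i j := fun m hm => hp m (by simpa using hm)

theorem sub (hp : HomW p i j) (hq : HomW q i j) : HomW (p - q) i j := by
  rw [sub_eq_add_neg]; exact hp.add hq.neg

theorem smul (c : K) (hp : HomW p i j) : HomW (c • p) i j := by
  intro m hm
  refine hp m fun h => hm ?_
  rw [coeff_smul, h, smul_zero]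

theorem mul (hp : HomW p i j) (hq : HomW q i' j') : HomW (p * q) (i + i') (j + j') := by
  classical
  intro m hm
  rw [coeff_mul] at hm
  obtain ⟨x, hx, hx'⟩ := Finset.exists_ne_zero_of_sum_ne_zero hm
  have h1 := hp x.1 (left_ne_zero_of_mul hx')
  have h2 := hq x.2 (right_ne_zero_of_mul hx')
  rw [Finset.HasAntidiagonal.mem_antidiagonal] at hx
  rw [← hx, map_add]
  omega

theorem sum {ι : Type*} (s : Finset ι) {f : ι → MvPolynomial σ K}
    (h : ∀ x ∈ s, HomW (f x) i j) : HomW (∑ x ∈ s, f x) i j :=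
  Finset.sum_induction f (fun p => HomW p i j) (fun _ _ => add) zero h

theorem iff_isHomogeneous : HomW p 0 j ↔ p.IsHomogeneous j := by
  rw [IsHomogeneous, IsWeightedHomogeneous]
  simp only [HomW, add_zero, Finsupp.degree_eq_weight_one, Pi.one_def]

theorem shift_iff (t : ℕ) : HomW p (i + t) (j + t) ↔ HomW p i j := by
  simp only [HomW, ← add_assoc, add_left_inj]

theorem congr (h : HomW p i j) (hh : i + j' = i' + j) : HomW p i' j' := fun m hm => by
  have := h m hm
  omega

theorem eq_zero_of_lt (h : HomW p i j) (hij : j < i) : p = 0 := by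
  ext m
  by_contra hm
  have := h m (by simpa using hm)
  omega

theorem isHomogeneous_sub (h : HomW p i j) : p.IsHomogeneous (j - i) := by
  rcases le_or_gt i j with hij | hij
  · exact iff_isHomogeneous.mp (h.congr (by omega))
  · rw [h.eq_zero_of_lt hij]; exact isHomogeneous_zero _ _ _

theorem X (t : σ) : HomW (X t : MvPolynomial σ K) 0 1 :=
  iff_isHomogeneous.mpr (isHomogeneous_X _ _)

theorem C (c : K) : HomW (C c : MvPolynomial σ K) i i := by
  have := (shift_iff i).mpr (iff_isHomogeneous.mpr (isHomogeneous_C σ c))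
  simpa using this

theorem eq_C (h : HomW p i i) : p = MvPolynomial.C (coeff 0 p) := by
  classical
  ext m
  rw [coeff_C]
  split_ifs with h0
  · rw [h0]
  · by_contra hm
    have := h m hm
    rw [Nat.add_eq_right, Finsupp.degree_eq_zero_iff] at this
    exact h0 this.symm

theorem X_mul (t : σ) (h : HomW p i j) : HomW (MvPolynomial.X t * p) i (j + 1) :=
  ((X t).mul h).congr (by omega)

theorem of_X_mul {t : σ} (h : HomW (MvPolynomial.X t * p) i (j + 1)) : HomW p i j := by
  intro m hm
  have := h (Finsupp.single t 1 + m) (by rwa [coeff_X_mul])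
  rw [map_add, Finsupp.degree_single] at this
  omega

theorem coeff_zero_eq (h : HomW p i j) (hij : i ≠ j) : coeff 0 p = 0 := by
  by_contra h0
  have := h 0 h0
  rw [map_zero] at this
  omega

/-- Homogeneous pieces of different degrees are independent. -/
theorem eq_zero_of_sum_eq_zero {N : ℕ} {f : ℕ → MvPolynomial σ K} {a : ℕ}
    (hf : ∀ e, HomW (f e) i (a + e)) (h : ∑ e ∈ Finset.range N, f e = 0) (e : ℕ) (he : e < N) :
    f e = 0 := by
  ext m
  by_contra hm
  have h1 := congrArg (coeff m) h
  rw [coeff_sum, coeff_zero, Finset.sum_eq_single e] at h1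
  · exact hm (by simpa using h1)
  · intro b _ hb
    by_contra hb'
    have := hf e m hm
    have := hf b m hb'
    omega
  · intro h; exact absurd (Finset.mem_range.mpr he) h

theorem exists_split {p : MvPolynomial (Fin 2) K} (h : HomW p i (j + 1)) (hij : i ≤ j) :
    ∃ q r, HomW q i j ∧ HomW r i j ∧ p = MvPolynomial.X 0 * q + MvPolynomial.X 1 * r := by
  have e := p.divMonomial_add_modMonomial_single 0
  set q := p.divMonomial (Finsupp.single 0 1)
  set r' := p.modMonomial (Finsupp.single 0 1)
  have hr' : HomW r' i (j + 1) := by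
    intro m hm
    refine h m ?_
    by_cases hle : Finsupp.single 0 1 ≤ m
    · exact absurd (coeff_modMonomial_of_le _ hle) hm
    · rwa [coeff_modMonomial_of_not_le _ hle] at hm
  have hq : HomW q i j := of_X_mul (t := 0) (by rw [eq_sub_of_add_eq e]; exact h.sub hr')
  have hd : MvPolynomial.X 1 ∣ r' := by
    rw [X_dvd_iff_modMonomial_eq_zero]
    ext m
    by_cases hle : Finsupp.single 1 1 ≤ m
    · rw [coeff_modMonomial_of_le _ hle, coeff_zero]
    · rw [coeff_modMonomial_of_not_le _ hle, coeff_zero]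
      by_contra hm
      have h0 : ¬ Finsupp.single 0 1 ≤ m := fun hle => hm (coeff_modMonomial_of_le _ hle)
      have hdeg := hr' m hm
      rw [Finsupp.single_le_iff] at hle h0
      rw [Finsupp.degree_eq_sum, Fin.sum_univ_two] at hdeg
      omega
  obtain ⟨r, hr⟩ := hd
  exact ⟨q, r, hq, of_X_mul (t := 1) (hr ▸ hr'), by rw [← hr, e]⟩

theorem exists_koszul [IsDomain K] {q r : MvPolynomial (Fin 2) K}
    (h : MvPolynomial.X 0 * q + MvPolynomial.X 1 * r = 0) :
    ∃ c, q = MvPolynomial.X 1 * c ∧ r = - (MvPolynomial.X 0 * c) := by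
  have hd : (MvPolynomial.X 1 : MvPolynomial (Fin 2) K) ∣ q := by
    have : (MvPolynomial.X 1 : MvPolynomial (Fin 2) K) ∣ MvPolynomial.X 0 * q :=
      ⟨-r, by linear_combination h⟩
    refine (X_prime.dvd_or_dvd this).resolve_left ?_
    rw [X_dvd_X]
    simp
  obtain ⟨c, rfl⟩ := hd
  refine ⟨c, rfl, mul_left_cancel₀ (X_ne_zero (1 : Fin 2)) ?_⟩
  linear_combination h

end HomW

section Spaces

variable {σ ι : Type*} (K : Type*) [Field K]

/-- Vectors of polynomials whose `i`-th entry is homogeneous of degree `j - w i`. -/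
def homVec (σ : Type*) (w : ι → ℕ) (j : ℕ) : Submodule K (ι → MvPolynomial σ K) where
  carrier := {v | ∀ i, HomW (v i) (w i) j}
  zero_mem' := fun _ => HomW.zero
  add_mem' := fun ha hb i => (ha i).add (hb i)
  smul_mem' := fun c _ ha i => (ha i).smul c

variable {K}

theorem X_smul_mem_homVec {w : ι → ℕ} {j : ℕ} {v : ι → MvPolynomial σ K} (t : σ)
    (h : v ∈ homVec K σ w j) : (X t : MvPolynomial σ K) • v ∈ homVec K σ w (j + 1) :=
  fun i => (h i).X_mul t

theorem mem_homVec_of_X_smul {w : ι → ℕ} {j : ℕ} {v : ι → MvPolynomial σ K} {t : σ}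
    (h : (X t : MvPolynomial σ K) • v ∈ homVec K σ w (j + 1)) : v ∈ homVec K σ w j :=
  fun i => HomW.of_X_mul (h i)

theorem smul_mem_homVec {w : ι → ℕ} {i' j j' : ℕ} {p : MvPolynomial σ K} {v : ι → MvPolynomial σ K}
    (hp : HomW p i' (i' + j')) (h : v ∈ homVec K σ w j) : p • v ∈ homVec K σ w (j' + j) :=
  fun i => (hp.mul (h i)).congr (by omega)

/-- The polynomials homogeneous of degree `j - i`. -/
def homPoly (K σ : Type*) [Field K] (i j : ℕ) : Submodule K (MvPolynomial σ K) where
  carrier := {v | HomW v i j}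
  zero_mem' := HomW.zero
  add_mem' := fun ha hb => ha.add hb
  smul_mem' := fun c _ ha => ha.smul c

theorem homPoly_eq_restrictSupport (i j : ℕ) :
    homPoly K σ i j = restrictSupport K {m : σ →₀ ℕ | m.degree + i = j} := by
  ext p
  rw [mem_restrictSupport_iff]
  simp only [Set.subset_def, Finset.mem_coe, mem_support_iff, Set.mem_ofPred_eq]
  rfl

theorem card_degree_add_eq (n i j : ℕ) :
    Nat.card {m : Fin n →₀ ℕ | m.degree + i = j} = if i ≤ j then n.multichoose (j - i) else 0 := by
  split_ifs with h
  · have := Finset.card_finsuppAntidiag_nat_eq_multichoose (s := (Finset.univ : Finset (Fin n))) (j - i)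
    rw [Finset.card_univ, Fintype.card_fin] at this
    rw [← this, ← Nat.card_eq_finsetCard]
    refine Nat.card_congr (Equiv.subtypeEquivRight fun m => ?_)
    rw [Finset.mem_finsuppAntidiag]
    simp only [Set.mem_ofPred_eq, Finset.subset_univ, and_true]
    rw [← Finsupp.degree_eq_sum]
    omega
  · rw [Nat.card_eq_zero]
    left
    constructor
    rintro ⟨m, hm⟩
    simp only [Set.mem_ofPred_eq] at hm
    omega

theorem finite_degree_add_eq (n i j : ℕ) : {m : Fin n →₀ ℕ | m.degree + i = j}.Finite := by
  refine Set.Finite.subset (Finset.finite_toSet (Finset.finsuppAntidiag Finset.univ (j - i))) ?_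
  intro m hm
  simp only [Set.mem_ofPred_eq, Finsupp.degree_eq_sum] at hm
  simp only [Finset.mem_coe, Finset.mem_finsuppAntidiag, Finset.subset_univ, and_true]
  rw [← Finsupp.degree_eq_sum] at hm ⊢
  omega

theorem finrank_homPoly (n i j : ℕ) :
    Module.finrank K (homPoly K (Fin n) i j) = if i ≤ j then n.multichoose (j - i) else 0 := by
  rw [homPoly_eq_restrictSupport, Module.finrank_eq_nat_card_basis (basisRestrictSupport K _),
    card_degree_add_eq]

instance (n i j : ℕ) : FiniteDimensional K (homPoly K (Fin n) i j) := by
  rw [homPoly_eq_restrictSupport]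
  have := (finite_degree_add_eq n i j).to_subtype
  exact Module.Finite.of_basis (basisRestrictSupport K _)

/-- A graded piece is the product of the graded pieces of the factors. -/
noncomputable def homVecEquiv (σ : Type*) (w : ι → ℕ) (j : ℕ) :
    homVec K σ w j ≃ₗ[K] ∀ i, homPoly K σ (w i) j where
  toFun v i := ⟨v.1 i, v.2 i⟩
  invFun v := ⟨fun i => (v i).1, fun i => (v i).2⟩
  map_add' _ _ := rfl
  map_smul' _ _ := rfl
  left_inv _ := rfl
  right_inv _ := rfl

instance [Finite ι] (n : ℕ) (w : ι → ℕ) (j : ℕ) : FiniteDimensional K (homVec K (Fin n) w j) :=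
  Module.Finite.equiv (homVecEquiv (Fin n) w j).symm

theorem finrank_homVec [Fintype ι] (n : ℕ) (w : ι → ℕ) (j : ℕ) :
    Module.finrank K (homVec K (Fin n) w j) =
      ∑ i, if w i ≤ j then n.multichoose (j - w i) else 0 := by
  rw [(homVecEquiv (Fin n) w j).finrank_eq, Module.finrank_pi_fintype]
  simp only [finrank_homPoly]

end Spaces

section ModFirst

variable {K : Type*} [Field K] {n : ℕ}

/-- Setting the first variable to zero. -/
noncomputable def modFirst (K : Type*) [Field K] (n : ℕ) :
    MvPolynomial (Fin (n + 1)) K →ₐ[K] MvPolynomial (Fin n) K :=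
  aeval (Fin.cons 0 X)

theorem modFirst_X_zero : modFirst K n (X 0) = 0 := by simp [modFirst]

theorem modFirst_X_succ (i : Fin n) : modFirst K n (X i.succ) = X i := by simp [modFirst]

theorem modFirst_eq (p : MvPolynomial (Fin (n + 1)) K) :
    modFirst K n p = (finSuccEquiv K n p).coeff 0 := by
  induction p using MvPolynomial.induction_on with
  | C a => simp [modFirst, finSuccEquiv_apply, algebraMap_eq]
  | add p q hp hq => simp [hp, hq]
  | mul_X p i hp =>
    rw [map_mul, map_mul, Polynomial.mul_coeff_zero, hp]
    congr 1
    refine Fin.cases ?_ (fun i => ?_) i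
    · rw [modFirst_X_zero, finSuccEquiv_X_zero, Polynomial.coeff_X_zero]
    · rw [modFirst_X_succ, finSuccEquiv_X_succ, Polynomial.coeff_C_zero]

theorem modFirst_rename (p : MvPolynomial (Fin n) K) : modFirst K n (rename Fin.succ p) = p := by
  rw [modFirst, aeval_rename]
  exact aeval_X_left_apply p

theorem exists_of_modFirst_eq_zero {p : MvPolynomial (Fin (n + 1)) K} (h : modFirst K n p = 0) :
    ∃ q, p = X 0 * q := by
  rw [modFirst_eq, ← Polynomial.X_dvd_iff] at h
  obtain ⟨q, hq⟩ := h
  refine ⟨(finSuccEquiv K n).symm q, (finSuccEquiv K n).injective ?_⟩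
  rw [hq, map_mul, finSuccEquiv_X_zero, AlgEquiv.apply_symm_apply]

theorem HomW.modFirst {p : MvPolynomial (Fin (n + 1)) K} {i j : ℕ} (h : HomW p i j) :
    HomW (modFirst K n p) i j := by
  intro m hm
  rw [modFirst_eq, finSuccEquiv_coeff_coeff] at hm
  have := h _ hm
  rwa [Finsupp.degree_eq_sum, Fin.sum_univ_succ, Finsupp.cons_zero, zero_add,
    Finset.sum_congr rfl fun t _ => Finsupp.cons_succ t 0 m, ← Finsupp.degree_eq_sum] at this

theorem HomW.rename_succ {p : MvPolynomial (Fin n) K} {i j : ℕ} (h : HomW p i j) :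
    HomW (rename Fin.succ p) i j := by
  rcases le_or_gt i j with hij | hij
  · have := (IsHomogeneous.rename_isHomogeneous (f := Fin.succ) h.isHomogeneous_sub)
    exact (HomW.iff_isHomogeneous.mpr this).congr (by omega)
  · rw [h.eq_zero_of_lt hij, map_zero]; exact HomW.zero

end ModFirst

end MvPolynomial

namespace PlaneCubic

open MvPolynomial Matrix

variable {K : Type*} [Field K]

/-- Graded pieces of `B ⊕ B(-1) ⊕ B(-2)`. -/
abbrev gr (K : Type*) [Field K] (n j : ℕ) : Submodule K (Fin 3 → MvPolynomial (Fin n) K) :=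
  homVec K (Fin n) (Fin.val : Fin 3 → ℕ) j

theorem finrank_gr_two {j : ℕ} (hj : 1 ≤ j) : Module.finrank K (gr K 2 j) = 3 * j := by
  rw [finrank_homVec, Fin.sum_univ_three]
  simp only [Nat.multichoose_two, Fin.val_zero, Fin.val_one, Fin.val_two]
  split_ifs <;> omega

theorem exists_koszul_vec {u v : Fin 3 → MvPolynomial (Fin 2) K} {j : ℕ}
    (hu : u ∈ gr K 2 (j + 1))
    (h : (X 0 : MvPolynomial (Fin 2) K) • u + (X 1 : MvPolynomial (Fin 2) K) • v = 0) :
    ∃ c ∈ gr K 2 j, u = (X 1 : MvPolynomial (Fin 2) K) • c ∧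
      v = -((X 0 : MvPolynomial (Fin 2) K) • c) := by
  have : ∀ i, ∃ c, u i = X 1 * c ∧ v i = -(X 0 * c) := fun i =>
    HomW.exists_koszul (congrFun h i)
  choose c hc hc' using this
  have hu' : u = (X 1 : MvPolynomial (Fin 2) K) • c := funext hc
  exact ⟨c, mem_homVec_of_X_smul (hu' ▸ hu), hu', funext hc'⟩

theorem exists_split_vec {u : Fin 3 → MvPolynomial (Fin 2) K} {j : ℕ} (hj : 2 ≤ j)
    (hu : u ∈ gr K 2 (j + 1)) :
    ∃ v ∈ gr K 2 j, ∃ w ∈ gr K 2 j,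
      u = (X 0 : MvPolynomial (Fin 2) K) • v + (X 1 : MvPolynomial (Fin 2) K) • w := by
  have : ∀ i, ∃ q r, HomW q i.val j ∧ HomW r i.val j ∧ u i = X 0 * q + X 1 * r := fun i =>
    HomW.exists_split (hu i) (by omega)
  choose v w hv hw h using this
  exact ⟨v, hv, w, hw, funext h⟩

/-- A space of forms of degree `b + 1` on a plane cubic, with no socle in degree `b`. -/
structure Socle (S : (Fin 3 → MvPolynomial (Fin 2) K) →ₗ[MvPolynomial (Fin 2) K]
    (Fin 3 → MvPolynomial (Fin 2) K)) (b : ℕ) (W : Submodule K (Fin 3 → MvPolynomial (Fin 2) K)) :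
    Prop where
  map_gr : ∀ j, ∀ v ∈ gr K 2 j, S v ∈ gr K 2 (j + 1)
  pos : 1 ≤ b
  le : W ≤ gr K 2 (b + 1)
  dim : 2 * b + 3 ≤ Module.finrank K W
  socle : ∀ c ∈ gr K 2 b, (X 0 : MvPolynomial (Fin 2) K) • c ∈ W →
    (X 1 : MvPolynomial (Fin 2) K) • c ∈ W → S c ∈ W → c = 0

namespace Socle

variable {S : (Fin 3 → MvPolynomial (Fin 2) K) →ₗ[MvPolynomial (Fin 2) K]
    (Fin 3 → MvPolynomial (Fin 2) K)} {b : ℕ}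
    {W : Submodule K (Fin 3 → MvPolynomial (Fin 2) K)}

/-- The map `c ↦ (x c, y c, S c)` modulo `W`. -/
noncomputable def toQuot (h : Socle S b W) : gr K 2 b →ₗ[K]
    (gr K 2 (b + 1) ⧸ W.submoduleOf (gr K 2 (b + 1))) ×
    (gr K 2 (b + 1) ⧸ W.submoduleOf (gr K 2 (b + 1))) ×
    (gr K 2 (b + 1) ⧸ W.submoduleOf (gr K 2 (b + 1))) :=
  let π := (W.submoduleOf (gr K 2 (b + 1))).mkQ
  let m (t : Fin 2) : gr K 2 b →ₗ[K] gr K 2 (b + 1) :=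
    ((LinearMap.lsmul (MvPolynomial (Fin 2) K) (Fin 3 → MvPolynomial (Fin 2) K)
      (X t)).restrictScalars K).restrict fun _ hv => X_smul_mem_homVec t hv
  (π ∘ₗ m 0).prod ((π ∘ₗ m 1).prod
    (π ∘ₗ (S.restrictScalars K).restrict fun v hv => h.map_gr b v hv))

theorem toQuot_eq_iff (h : Socle S b W) (c : gr K 2 b) (u v w : gr K 2 (b + 1)) :
    h.toQuot c = (Submodule.Quotient.mk u, Submodule.Quotient.mk v, Submodule.Quotient.mk w) ↔
      (X 0 : MvPolynomial (Fin 2) K) • c.1 - u.1 ∈ W ∧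
      (X 1 : MvPolynomial (Fin 2) K) • c.1 - v.1 ∈ W ∧ S c.1 - w.1 ∈ W := by
  rw [Prod.ext_iff, Prod.ext_iff]
  exact and_congr (Submodule.Quotient.eq _) (and_congr (Submodule.Quotient.eq _)
    (Submodule.Quotient.eq _))

theorem toQuot_injective (h : Socle S b W) : Function.Injective h.toQuot := by
  rw [← LinearMap.ker_eq_bot, Submodule.eq_bot_iff]
  intro c hc
  have := (h.toQuot_eq_iff c 0 0 0).mp hc
  simp only [Submodule.coe_zero, sub_zero] at this
  exact Subtype.ext (h.socle c.1 c.2 this.1 this.2.1 this.2.2)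

theorem finrank_submoduleOf (h : Socle S b W) :
    Module.finrank K (W.submoduleOf (gr K 2 (b + 1))) = Module.finrank K W :=
  (Submodule.submoduleOfEquivOfLe h.le).finrank_eq

theorem finrank_quot (h : Socle S b W) :
    Module.finrank K (gr K 2 (b + 1) ⧸ W.submoduleOf (gr K 2 (b + 1))) + Module.finrank K W =
      3 * (b + 1) := by
  rw [← h.finrank_submoduleOf, Submodule.finrank_quotient_add_finrank, finrank_gr_two (by omega)]

theorem finrank_le (h : Socle S b W) : 3 * b ≤ 3 * Module.finrank K
    (gr K 2 (b + 1) ⧸ W.submoduleOf (gr K 2 (b + 1))) := by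
  have := LinearMap.finrank_le_finrank_of_injective h.toQuot_injective
  rw [Module.finrank_prod, Module.finrank_prod, finrank_gr_two h.pos] at this
  omega

theorem finrank_eq (h : Socle S b W) : Module.finrank K W = 2 * b + 3 := by
  have := h.finrank_le
  have := h.finrank_quot
  have := h.dim
  omega

theorem toQuot_surjective (h : Socle S b W) : Function.Surjective h.toQuot := by
  refine (LinearMap.injective_iff_surjective_of_finrank_eq_finrank ?_).mp h.toQuot_injective
  have := h.finrank_eq
  have := h.finrank_quot
  rw [Module.finrank_prod, Module.finrank_prod, finrank_gr_two h.pos]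
  omega

theorem exists_lift (h : Socle S b W) {u v w : Fin 3 → MvPolynomial (Fin 2) K}
    (hu : u ∈ gr K 2 (b + 1)) (hv : v ∈ gr K 2 (b + 1)) (hw : w ∈ gr K 2 (b + 1)) :
    ∃ c ∈ gr K 2 b, (X 0 : MvPolynomial (Fin 2) K) • c - u ∈ W ∧
      (X 1 : MvPolynomial (Fin 2) K) • c - v ∈ W ∧ S c - w ∈ W := by
  obtain ⟨c, hc⟩ := h.toQuot_surjective (Submodule.Quotient.mk ⟨u, hu⟩,
    Submodule.Quotient.mk ⟨v, hv⟩, Submodule.Quotient.mk ⟨w, hw⟩)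
  exact ⟨c.1, c.2, (h.toQuot_eq_iff c ⟨u, hu⟩ ⟨v, hv⟩ ⟨w, hw⟩).mp hc⟩

/-- The forms `c` of degree `b` with `x c, y c ∈ W`. -/
def ker (S : (Fin 3 → MvPolynomial (Fin 2) K) →ₗ[MvPolynomial (Fin 2) K]
    (Fin 3 → MvPolynomial (Fin 2) K)) (b : ℕ)
    (W : Submodule K (Fin 3 → MvPolynomial (Fin 2) K)) :
    Submodule K (Fin 3 → MvPolynomial (Fin 2) K) where
  carrier := {c | c ∈ gr K 2 b ∧ (X 0 : MvPolynomial (Fin 2) K) • c ∈ W ∧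
    (X 1 : MvPolynomial (Fin 2) K) • c ∈ W}
  zero_mem' := by simp
  add_mem' := by
    rintro c d ⟨h1, h2, h3⟩ ⟨h1', h2', h3'⟩
    refine ⟨add_mem h1 h1', ?_, ?_⟩ <;> rw [smul_add]
    exacts [add_mem h2 h2', add_mem h3 h3']
  smul_mem' := by
    rintro r c ⟨h1, h2, h3⟩
    refine ⟨Submodule.smul_mem _ _ h1, ?_, ?_⟩ <;> rw [smul_comm]
    exacts [Submodule.smul_mem _ _ h2, Submodule.smul_mem _ _ h3]

theorem finrank_ker (h : Socle S b W) : Module.finrank K (ker S b W) = b := by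
  have e : ker S b W ≃ₗ[K] (gr K 2 (b + 1) ⧸ W.submoduleOf (gr K 2 (b + 1))) := by
    refine LinearEquiv.ofBijective ((W.submoduleOf (gr K 2 (b + 1))).mkQ ∘ₗ
      ((S.restrictScalars K).restrict (p := ker S b W) fun v hv => h.map_gr b v hv.1)) ⟨?_, ?_⟩
    · rw [← LinearMap.ker_eq_bot, Submodule.eq_bot_iff]
      rintro ⟨c, hc⟩ hc'
      rw [LinearMap.mem_ker, LinearMap.comp_apply, Submodule.mkQ_apply,
        Submodule.Quotient.mk_eq_zero] at hc'
      exact Subtype.ext (h.socle c hc.1 hc.2.1 hc.2.2 hc')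
    · intro w
      obtain ⟨⟨w, hw⟩, rfl⟩ := Submodule.mkQ_surjective _ w
      obtain ⟨c, hc, h1, h2, h3⟩ := h.exists_lift (zero_mem _) (zero_mem _) hw
      rw [sub_zero] at h1 h2
      refine ⟨⟨c, hc, h1, h2⟩, ?_⟩
      rw [LinearMap.comp_apply, Submodule.mkQ_apply, Submodule.mkQ_apply, Submodule.Quotient.eq]
      exact h3
  rw [e.finrank_eq]
  have := h.finrank_eq
  have := h.finrank_quot
  omega

theorem exists_add (h : Socle S b W) {c : Fin 3 → MvPolynomial (Fin 2) K}
    (hc : c ∈ gr K 2 (b + 1)) : ∃ w ∈ W, ∃ d ∈ ker S b W, c = w + S d := by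
  obtain ⟨d, hd, h1, h2, h3⟩ := h.exists_lift (zero_mem _) (zero_mem _) hc
  rw [sub_zero] at h1 h2
  exact ⟨-(S d - c), neg_mem h3, d, ⟨hd, h1, h2⟩, by abel⟩

theorem exists_mul_add_mul (h : Socle S b W) {c : Fin 3 → MvPolynomial (Fin 2) K}
    (hc : c ∈ gr K 2 (b + 2)) : ∃ u ∈ W, ∃ v ∈ W,
      c = (X 0 : MvPolynomial (Fin 2) K) • u + (X 1 : MvPolynomial (Fin 2) K) • v := by
  obtain ⟨u, hu, v, hv, rfl⟩ := exists_split_vec (by have := h.pos; omega) hc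
  obtain ⟨d, hd, h1, h2, -⟩ := h.exists_lift (neg_mem hv) hu (zero_mem _)
  refine ⟨-((X 1 : MvPolynomial (Fin 2) K) • d - u), neg_mem h2, _, h1, ?_⟩
  rw [smul_neg, smul_sub, smul_sub, smul_neg, smul_comm]
  abel

section Basis

variable {ι κ : Type*} [Fintype ι] [Fintype κ]
  {g : ι → Fin 3 → MvPolynomial (Fin 2) K}

theorem exists_lin_comb (hg : Submodule.span K (Set.range g) = W)
    {w : Fin 3 → MvPolynomial (Fin 2) K} (hw : w ∈ W) :
    ∃ r : ι → K, w = Fintype.linearCombination (MvPolynomial (Fin 2) K) g (fun l => C (r l)) := by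
  rw [← hg, Submodule.mem_span_range_iff_exists_fun] at hw
  obtain ⟨r, rfl⟩ := hw
  refine ⟨r, ?_⟩
  simp only [Fintype.linearCombination_apply, ← algebraMap_eq, algebraMap_smul]

theorem exists_lin_comb_add (h : Socle S b W) (hg : Submodule.span K (Set.range g) = W) (t : ℕ) :
    ∀ c ∈ gr K 2 (b + 2 + t), ∃ z : ι → MvPolynomial (Fin 2) K, (∀ l, HomW (z l) 0 (t + 1)) ∧
      c = Fintype.linearCombination (MvPolynomial (Fin 2) K) g z := by
  induction t with
  | zero =>
    intro c hc
    obtain ⟨u, hu, v, hv, rfl⟩ := h.exists_mul_add_mul hc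
    obtain ⟨r, rfl⟩ := exists_lin_comb hg hu
    obtain ⟨s, rfl⟩ := exists_lin_comb hg hv
    refine ⟨(X 0 : MvPolynomial (Fin 2) K) • (fun l => C (r l)) +
      (X 1 : MvPolynomial (Fin 2) K) • (fun l => C (s l)), fun l => ?_, ?_⟩
    · exact ((HomW.C (i := 0) _).X_mul _).add ((HomW.C (i := 0) _).X_mul _)
    · rw [map_add, map_smul, map_smul]
  | succ t ih =>
    intro c hc
    obtain ⟨u, hu, v, hv, rfl⟩ := exists_split_vec (j := b + 2 + t) (by omega) hc
    obtain ⟨r, hr, rfl⟩ := ih _ hu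
    obtain ⟨s, hs, rfl⟩ := ih _ hv
    refine ⟨(X 0 : MvPolynomial (Fin 2) K) • r + (X 1 : MvPolynomial (Fin 2) K) • s,
      fun l => ((hr l).X_mul _).add ((hs l).X_mul _), ?_⟩
    rw [map_add, map_smul, map_smul]

variable {σ : Matrix ι ι (MvPolynomial (Fin 2) K)} {α : Matrix κ ι (MvPolynomial (Fin 2) K)}
  {c : κ → Fin 3 → MvPolynomial (Fin 2) K} {ξ η : κ → ι → K}

theorem map_lin_comb {A V ι : Type*} [CommRing A] [AddCommGroup V] [Module A V] [Fintype ι]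
    {S : V →ₗ[A] V} {g : ι → V} {σ : Matrix ι ι A}
    (hσ : ∀ j, S (g j) = Fintype.linearCombination A g (σ j)) (w : ι → A) :
    S (Fintype.linearCombination A g w) = Fintype.linearCombination A g (w ᵥ* σ) := by
  rw [Fintype.linearCombination_apply, map_sum]
  simp only [map_smul, hσ, Fintype.linearCombination_apply, vecMul, dotProduct, Finset.sum_smul,
    Finset.smul_sum, smul_smul]
  exact Finset.sum_comm

theorem smul_lin_comb {t : Fin 2} {ζ : κ → ι → K}
    (hζ : ∀ i, (X t : MvPolynomial (Fin 2) K) • c i =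
      Fintype.linearCombination (MvPolynomial (Fin 2) K) g (fun l => C (ζ i l)))
    (m : κ → MvPolynomial (Fin 2) K) :
    (X t : MvPolynomial (Fin 2) K) • Fintype.linearCombination _ c m =
      Fintype.linearCombination _ g (m ᵥ* (fun i l => C (ζ i l) : Matrix κ ι _)) := by
  simp only [Fintype.linearCombination_apply, Finset.smul_sum] at hζ ⊢
  simp only [smul_comm _ (m _) (c _), hζ, vecMul, dotProduct, Finset.sum_smul,
    Finset.smul_sum, smul_smul]
  exact Finset.sum_comm

/-- The relations among the generators are spanned by `α` and `α σ`. -/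
theorem exists_relation (h : Socle S b W) (hg : Submodule.span K (Set.range g) = W)
    (hgi : LinearIndependent K g) (hc : Submodule.span K (Set.range c) = ker S b W)
    (hσh : ∀ i j, HomW (σ i j) 0 1)
    (hσ : ∀ j, S (g j) = Fintype.linearCombination _ g (σ j))
    (hξ : ∀ i, (X 0 : MvPolynomial (Fin 2) K) • c i =
      Fintype.linearCombination (MvPolynomial (Fin 2) K) g (fun l => C (ξ i l)))
    (hη : ∀ i, (X 1 : MvPolynomial (Fin 2) K) • c i =
      Fintype.linearCombination (MvPolynomial (Fin 2) K) g (fun l => C (η i l)))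
    (hα : ∀ i l, α i l = X 0 * C (η i l) - X 1 * C (ξ i l)) (e : ℕ) :
    ∀ w : ι → MvPolynomial (Fin 2) K, (∀ l, HomW (w l) 0 e) →
      Fintype.linearCombination _ g w = 0 → ∃ u v : κ → MvPolynomial (Fin 2) K,
        (∀ i, HomW (u i) 1 e) ∧ (∀ i, HomW (v i) 2 e) ∧ w = u ᵥ* α + v ᵥ* (α * σ) := by
  have hconst : ∀ r : ι → K,
      Fintype.linearCombination (MvPolynomial (Fin 2) K) g (fun l => C (r l)) = 0 → r = 0 := by
    intro r hr
    simp only [Fintype.linearCombination_apply, ← algebraMap_eq, algebraMap_smul] at hr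
    exact funext (Fintype.linearIndependent_iff.mp hgi r hr)
  induction e with
  | zero =>
    intro w hw h0
    refine ⟨0, 0, fun _ => HomW.zero, fun _ => HomW.zero, ?_⟩
    have hw' : w = fun l => C (coeff 0 (w l)) := funext fun l => (hw l).eq_C
    rw [hw'] at h0 ⊢
    have := hconst _ h0
    ext1 l
    simp [show coeff 0 (w l) = 0 from congrFun this l]
  | succ e ih =>
    intro w hw h0
    have : ∀ l, ∃ q r, HomW q 0 e ∧ HomW r 0 e ∧ w l = X 0 * q + X 1 * r := fun l =>
      HomW.exists_split (hw l) (Nat.zero_le _)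
    choose u v hu hv hw' using this
    have hwe : w = (X 0 : MvPolynomial (Fin 2) K) • u + (X 1 : MvPolynomial (Fin 2) K) • v :=
      funext hw'
    have hgr : ∀ l, g l ∈ gr K 2 (b + 1) := fun l =>
      h.le (hg ▸ Submodule.subset_span (Set.mem_range_self l))
    have hLu : Fintype.linearCombination _ g u ∈ gr K 2 (e + (b + 1)) := by
      rw [Fintype.linearCombination_apply]
      exact sum_mem fun l _ => smul_mem_homVec (i' := 0) (by simpa using hu l) (hgr l)
    rw [hwe, map_add, map_smul, map_smul] at h0
    obtain ⟨d, hd, hd1, hd2⟩ := exists_koszul_vec (j := e + b) hLu h0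
    set ξC : Matrix κ ι (MvPolynomial (Fin 2) K) := fun i l => C (ξ i l)
    set ηC : Matrix κ ι (MvPolynomial (Fin 2) K) := fun i l => C (η i l)
    have hα' : α = (X 0 : MvPolynomial (Fin 2) K) • ηC - (X 1 : MvPolynomial (Fin 2) K) • ξC := by
      ext1 i l; exact hα i l
    have hαm : ∀ m : κ → MvPolynomial (Fin 2) K, m ᵥ* α =
        (X 0 : MvPolynomial (Fin 2) K) • (m ᵥ* ηC) - (X 1 : MvPolynomial (Fin 2) K) • (m ᵥ* ξC) := by
      intro m; rw [hα', vecMul_sub, vecMul_smul, vecMul_smul]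
    have hX0 := smul_lin_comb hξ
    have hX1 := smul_lin_comb hη
    rcases Nat.eq_zero_or_pos e with rfl | he
    · rw [zero_add] at hd
      have hu' : u = fun l => C (coeff 0 (u l)) := funext fun l => (hu l).eq_C
      have hv' : v = fun l => C (coeff 0 (v l)) := funext fun l => (hv l).eq_C
      have hLW : ∀ r : ι → K,
          Fintype.linearCombination (MvPolynomial (Fin 2) K) g (fun l => C (r l)) ∈ W := by
        intro r
        simp only [Fintype.linearCombination_apply, ← algebraMap_eq, algebraMap_smul, ← hg]
        exact sum_mem fun l _ => Submodule.smul_mem _ _ (Submodule.subset_span ⟨l, rfl⟩)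
      have hdk : d ∈ ker S b W := by
        refine ⟨hd, ?_, ?_⟩
        · rw [← neg_neg ((X 0 : MvPolynomial (Fin 2) K) • d), ← hd2, hv']; exact neg_mem (hLW _)
        · rw [← hd1, hu']; exact hLW _
      obtain ⟨m, rfl⟩ := exists_lin_comb hc hdk
      have hur : u = (fun i => C (m i)) ᵥ* ηC := by
        have h1 : Fintype.linearCombination (MvPolynomial (Fin 2) K) g
            (u - (fun i => C (m i)) ᵥ* ηC) = 0 := by
          rw [map_sub, hd1, hX1, sub_self]
        rw [hu'] at h1 ⊢
        have h2 := hconst (fun l => coeff 0 (u l) - ∑ i, m i * η i l) (by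
          rw [← h1]; congr 1; ext1 l
          simp [ηC, vecMul, dotProduct])
        ext1 l
        have h3 := congrFun h2 l
        simp only [Pi.zero_apply, sub_eq_zero] at h3
        simp [h3, ηC, vecMul, dotProduct]
      have hvr : v = -((fun i => C (m i)) ᵥ* ξC) := by
        have h1 : Fintype.linearCombination (MvPolynomial (Fin 2) K) g
            (v + (fun i => C (m i)) ᵥ* ξC) = 0 := by
          rw [map_add, hd2, hX0, neg_add_cancel]
        rw [hv'] at h1 ⊢
        have h2 := hconst (fun l => coeff 0 (v l) + ∑ i, m i * ξ i l) (by
          rw [← h1]; congr 1; ext1 l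
          simp [ξC, vecMul, dotProduct])
        ext1 l
        have h3 := congrFun h2 l
        simp only [Pi.zero_apply] at h3
        simp [eq_neg_of_add_eq_zero_left h3, ξC, vecMul, dotProduct]
      refine ⟨fun i => C (m i), 0, fun i => HomW.C _, fun i => HomW.zero, ?_⟩
      rw [zero_vecMul, add_zero, hαm, hwe, hur, hvr, smul_neg, sub_eq_add_neg]
    · obtain ⟨z, m, hz, hm, hdz⟩ : ∃ (z : ι → MvPolynomial (Fin 2) K) (m : κ → MvPolynomial (Fin 2) K),
          (∀ l, HomW (z l) 1 e) ∧ (∀ i, HomW (m i) 2 (e + 1)) ∧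
          d = Fintype.linearCombination _ g z + S (Fintype.linearCombination _ c m) := by
        obtain ⟨t, rfl⟩ : ∃ t, e = t + 1 := ⟨e - 1, by omega⟩
        rcases Nat.eq_zero_or_pos t with rfl | ht
        · obtain ⟨w', hw', d', hd', rfl⟩ := h.exists_add (c := d) (by convert hd using 2; omega)
          obtain ⟨r, rfl⟩ := exists_lin_comb hg hw'
          obtain ⟨m, rfl⟩ := exists_lin_comb hc hd'
          exact ⟨_, _, fun l => HomW.C _, fun i => HomW.C _, rfl⟩
        · obtain ⟨t, rfl⟩ : ∃ s, t = s + 1 := ⟨t - 1, by omega⟩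
          obtain ⟨z, hz, rfl⟩ := h.exists_lin_comb_add hg t d (by convert hd using 2; omega)
          exact ⟨z, 0, fun l => (hz l).congr (by omega), fun i => HomW.zero, by simp⟩
      have hmσ : ∀ ζ : κ → ι → K, ∀ l,
          HomW ((m ᵥ* (fun i l => C (ζ i l) : Matrix κ ι (MvPolynomial (Fin 2) K)) ᵥ* σ) l) 0 e := by
        intro ζ l
        refine HomW.sum _ fun x _ => ?_
        have h1 : HomW ((m ᵥ* (fun i l => C (ζ i l) : Matrix κ ι (MvPolynomial (Fin 2) K))) x)
            2 (e + 1) := HomW.sum _ fun i _ => ((hm i).mul (HomW.C (i := 0) _))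
        exact (h1.mul (hσh x l)).congr (by omega)
      obtain ⟨u₁, u₂, hu₁, hu₂, hue⟩ := ih (u - (X 1 : MvPolynomial (Fin 2) K) • z - m ᵥ* ηC ᵥ* σ)
        (fun l => ((hu l).sub (((hz l).X_mul 1).congr (by omega))).sub (hmσ η l)) (by
          rw [map_sub, map_sub, map_smul, ← map_lin_comb hσ, ← hX1, hd1, hdz, map_smul, smul_add]
          abel)
      obtain ⟨v₁, v₂, hv₁, hv₂, hve⟩ := ih (v + (X 0 : MvPolynomial (Fin 2) K) • z + m ᵥ* ξC ᵥ* σ)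
        (fun l => ((hv l).add (((hz l).X_mul 0).congr (by omega))).add (hmσ ξ l)) (by
          rw [map_add, map_add, map_smul, ← map_lin_comb hσ, ← hX0, hd2, hdz, map_smul, smul_add]
          abel)
      refine ⟨(X 0 : MvPolynomial (Fin 2) K) • u₁ + (X 1 : MvPolynomial (Fin 2) K) • v₁,
        (X 0 : MvPolynomial (Fin 2) K) • u₂ + (X 1 : MvPolynomial (Fin 2) K) • v₂ + m,
        fun i => ((hu₁ i).X_mul 0).add ((hv₁ i).X_mul 1),
        fun i => (((hu₂ i).X_mul 0).add ((hv₂ i).X_mul 1)).add (hm i), ?_⟩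
      have hu3 : u = u₁ ᵥ* α + u₂ ᵥ* (α * σ) + (X 1 : MvPolynomial (Fin 2) K) • z + m ᵥ* ηC ᵥ* σ := by
        rw [← hue]; abel
      have hv3 : v = v₁ ᵥ* α + v₂ ᵥ* (α * σ) - (X 0 : MvPolynomial (Fin 2) K) • z - m ᵥ* ξC ᵥ* σ := by
        rw [← hve]; abel
      have hm3 : m ᵥ* (α * σ) = (X 0 : MvPolynomial (Fin 2) K) • (m ᵥ* ηC ᵥ* σ) -
          (X 1 : MvPolynomial (Fin 2) K) • (m ᵥ* ξC ᵥ* σ) := by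
        rw [← vecMul_vecMul, hαm, sub_vecMul, smul_vecMul, smul_vecMul]
      simp only [add_vecMul, smul_vecMul]
      rw [hwe, hu3, hv3, hm3]
      simp only [smul_add, smul_sub]
      rw [smul_comm (X 1 : MvPolynomial (Fin 2) K) (X 0 : MvPolynomial (Fin 2) K) z]
      abel

end Basis

end Socle

end PlaneCubic

namespace PlaneCubic

open MvPolynomial Matrix

variable {K : Type*} [Field K]

/-- Setting the first variable to zero, on vectors. -/
noncomputable def modVec (K : Type*) [Field K] :
    (Fin 3 → MvPolynomial (Fin 3) K) →ₗ[K] (Fin 3 → MvPolynomial (Fin 2) K) where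
  toFun v i := modFirst K 2 (v i)
  map_add' v w := by ext1 i; simp
  map_smul' c v := by ext1 i; simp

theorem modVec_apply (v : Fin 3 → MvPolynomial (Fin 3) K) (i : Fin 3) :
    modVec K v i = modFirst K 2 (v i) := rfl

theorem modVec_smul (p : MvPolynomial (Fin 3) K) (v : Fin 3 → MvPolynomial (Fin 3) K) :
    modVec K (p • v) = modFirst K 2 p • modVec K v := by
  ext1 i; simp [modVec_apply]

theorem modVec_mem_gr {v : Fin 3 → MvPolynomial (Fin 3) K} {j : ℕ} (hv : v ∈ gr K 3 j) :
    modVec K v ∈ gr K 2 j := fun i => (hv i).modFirst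

theorem exists_of_modVec_eq_zero {v : Fin 3 → MvPolynomial (Fin 3) K} (h : modVec K v = 0) :
    ∃ w, v = (X 0 : MvPolynomial (Fin 3) K) • w := by
  have : ∀ i, ∃ q, v i = X 0 * q := fun i => exists_of_modFirst_eq_zero (congrFun h i)
  choose w hw using this
  exact ⟨w, funext hw⟩

/-- The section of `modVec` adding a variable. -/
noncomputable def liftVec (v : Fin 3 → MvPolynomial (Fin 2) K) : Fin 3 → MvPolynomial (Fin 3) K :=
  fun i => rename Fin.succ (v i)

theorem modVec_liftVec (v : Fin 3 → MvPolynomial (Fin 2) K) : modVec K (liftVec v) = v := by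
  ext1 i
  rw [modVec_apply, liftVec, modFirst_rename]

theorem liftVec_mem_gr {v : Fin 3 → MvPolynomial (Fin 2) K} {j : ℕ} (hv : v ∈ gr K 2 j) :
    liftVec v ∈ gr K 3 j := fun i => (hv i).rename_succ

/-- The reduction of an endomorphism modulo the first variable. -/
noncomputable def modEnd (S : (Fin 3 → MvPolynomial (Fin 3) K) →ₗ[MvPolynomial (Fin 3) K]
    (Fin 3 → MvPolynomial (Fin 3) K)) :
    (Fin 3 → MvPolynomial (Fin 2) K) →ₗ[MvPolynomial (Fin 2) K]
    (Fin 3 → MvPolynomial (Fin 2) K) where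
  toFun v := modVec K (S (liftVec v))
  map_add' v w := by
    rw [← map_add, ← map_add]; congr 2; ext1 i; simp [liftVec]
  map_smul' p v := by
    have : liftVec (p • v) = (rename Fin.succ p : MvPolynomial (Fin 3) K) • liftVec v := by
      ext1 i; simp [liftVec]
    rw [this, map_smul, modVec_smul, modFirst_rename, RingHom.id_apply]

theorem modEnd_modVec (S : (Fin 3 → MvPolynomial (Fin 3) K) →ₗ[MvPolynomial (Fin 3) K]
    (Fin 3 → MvPolynomial (Fin 3) K)) (v : Fin 3 → MvPolynomial (Fin 3) K) :
    modEnd S (modVec K v) = modVec K (S v) := by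
  have h : modVec K (liftVec (modVec K v) - v) = 0 := by rw [map_sub, modVec_liftVec, sub_self]
  obtain ⟨w, hw⟩ := exists_of_modVec_eq_zero h
  change modVec K (S (liftVec (modVec K v))) = _
  rw [← sub_eq_zero, ← map_sub, ← map_sub, hw, map_smul, modVec_smul, modFirst_X_zero, zero_smul]

/-- A graded submodule, saturated with respect to the first variable, without socle
modulo that variable. -/
structure Saturated (S : (Fin 3 → MvPolynomial (Fin 3) K) →ₗ[MvPolynomial (Fin 3) K]
    (Fin 3 → MvPolynomial (Fin 3) K)) (b : ℕ)
    (M : Submodule (MvPolynomial (Fin 3) K) (Fin 3 → MvPolynomial (Fin 3) K)) : Prop where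
  map_gr : ∀ j, ∀ v ∈ gr K 3 j, S v ∈ gr K 3 (j + 1)
  pos : 1 ≤ b
  stable : ∀ v ∈ M, S v ∈ M
  graded : ∀ (N : ℕ) (v : ℕ → Fin 3 → MvPolynomial (Fin 3) K), (∀ j, v j ∈ gr K 3 j) →
    ∑ j ∈ Finset.range N, v j ∈ M → ∀ j < N, v j ∈ M
  sat : ∀ v, (X 0 : MvPolynomial (Fin 3) K) • v ∈ M → v ∈ M
  low : ∀ v ∈ M, v ∈ gr K 3 b → v = 0
  dim : 2 * b + 3 ≤
    Module.finrank K (M.restrictScalars K ⊓ gr K 3 (b + 1) : Submodule K (Fin 3 → MvPolynomial (Fin 3) K))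
  socle : ∀ c ∈ gr K 3 b, ∀ h₁ ∈ gr K 3 b, ∀ h₂ ∈ gr K 3 b, ∀ h₃ ∈ gr K 3 b,
    (X 1 : MvPolynomial (Fin 3) K) • c - (X 0 : MvPolynomial (Fin 3) K) • h₁ ∈ M →
    (X 2 : MvPolynomial (Fin 3) K) • c - (X 0 : MvPolynomial (Fin 3) K) • h₂ ∈ M →
    S c - (X 0 : MvPolynomial (Fin 3) K) • h₃ ∈ M → ∃ c', c = (X 0 : MvPolynomial (Fin 3) K) • c'

namespace Saturated

variable {S : (Fin 3 → MvPolynomial (Fin 3) K) →ₗ[MvPolynomial (Fin 3) K]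
    (Fin 3 → MvPolynomial (Fin 3) K)} {b : ℕ}
    {M : Submodule (MvPolynomial (Fin 3) K) (Fin 3 → MvPolynomial (Fin 3) K)}

/-- The graded piece of degree `j` of `M`. -/
noncomputable abbrev piece (M : Submodule (MvPolynomial (Fin 3) K) (Fin 3 → MvPolynomial (Fin 3) K)) (j : ℕ) :
    Submodule K (Fin 3 → MvPolynomial (Fin 3) K) := M.restrictScalars K ⊓ gr K 3 j

theorem exists_of_modVec (h : Saturated S b M) {v : Fin 3 → MvPolynomial (Fin 3) K} {j : ℕ}
    (hv : v ∈ piece M (j + 1)) (h0 : modVec K v = 0) :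
    ∃ w ∈ piece M j, v = (X 0 : MvPolynomial (Fin 3) K) • w := by
  obtain ⟨w, rfl⟩ := exists_of_modVec_eq_zero h0
  exact ⟨w, ⟨h.sat w hv.1, mem_homVec_of_X_smul hv.2⟩, rfl⟩

theorem ker_modVec (h : Saturated S b M) {v : Fin 3 → MvPolynomial (Fin 3) K}
    (hv : v ∈ piece M (b + 1)) (h0 : modVec K v = 0) : v = 0 := by
  obtain ⟨w, hw, rfl⟩ := h.exists_of_modVec hv h0
  rw [h.low w hw.1 hw.2, smul_zero]

theorem disjoint_ker (h : Saturated S b M) :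
    Disjoint (piece M (b + 1)) (LinearMap.ker (modVec K)) := by
  rw [Submodule.disjoint_def]
  exact fun v hv hv' => h.ker_modVec hv hv'

theorem toSocle (h : Saturated S b M) :
    Socle (modEnd S) b ((piece M (b + 1)).map (modVec K)) where
  map_gr j v hv := modVec_mem_gr (h.map_gr j _ (liftVec_mem_gr hv))
  pos := h.pos
  le := by
    rintro _ ⟨v, hv, rfl⟩
    exact modVec_mem_gr hv.2
  dim := by
    refine h.dim.trans_eq ?_
    have hinj : Function.Injective ((modVec K).domRestrict (piece M (b + 1))) := by
      rw [LinearMap.injective_domRestrict_iff]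
      exact h.disjoint_ker
    rw [← LinearMap.finrank_range_of_inj hinj, LinearMap.range_domRestrict]
  socle c hc := by
    rintro ⟨m₁, hm₁, e₁⟩ ⟨m₂, hm₂, e₂⟩ ⟨m₃, hm₃, e₃⟩
    have hx : ∀ t : Fin 2, modVec K ((X t.succ : MvPolynomial (Fin 3) K) • liftVec c) =
        (X t : MvPolynomial (Fin 2) K) • c := fun t => by
      rw [modVec_smul, modFirst_X_succ, modVec_liftVec]
    have key : ∀ (v m : Fin 3 → MvPolynomial (Fin 3) K), v ∈ gr K 3 (b + 1) →
        m ∈ piece M (b + 1) → modVec K m = modVec K v →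
        ∃ w ∈ gr K 3 b, v - (X 0 : MvPolynomial (Fin 3) K) • w ∈ M := by
      intro v m hv hm hvm
      obtain ⟨w, hw⟩ := exists_of_modVec_eq_zero (v := v - m) (by rw [map_sub, hvm, sub_self])
      refine ⟨w, mem_homVec_of_X_smul (t := 0) (hw ▸ sub_mem hv hm.2), ?_⟩
      rw [← hw, sub_sub_cancel]
      exact hm.1
    have hlc : liftVec c ∈ gr K 3 b := liftVec_mem_gr hc
    obtain ⟨h₁, hh₁, k₁⟩ := key _ m₁ (X_smul_mem_homVec 1 hlc) hm₁ (e₁.trans (hx 0).symm)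
    obtain ⟨h₂, hh₂, k₂⟩ := key _ m₂ (X_smul_mem_homVec 2 hlc) hm₂ (e₂.trans (hx 1).symm)
    obtain ⟨h₃, hh₃, k₃⟩ := key _ m₃ (h.map_gr _ _ hlc) hm₃ e₃
    obtain ⟨c', hc'⟩ := h.socle _ hlc h₁ hh₁ h₂ hh₂ h₃ hh₃ k₁ k₂ k₃
    rw [← modVec_liftVec c, hc', modVec_smul, modFirst_X_zero, zero_smul]

theorem piece_eq_zero (h : Saturated S b M) (t : ℕ) : ∀ j, j + t = b →
    ∀ v ∈ piece M j, v = 0 := by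
  induction t with
  | zero =>
    rintro j rfl v hv
    exact h.low v hv.1 hv.2
  | succ t ih =>
    intro j hj v hv
    have := ih (j + 1) (by omega) ((X 0 : MvPolynomial (Fin 3) K) • v)
      ⟨M.smul_mem _ hv.1, X_smul_mem_homVec 0 hv.2⟩
    exact (smul_eq_zero.mp this).resolve_left (X_ne_zero 0)

end Saturated

theorem exists_gr_sum {n : ℕ} (v : Fin 3 → MvPolynomial (Fin n) K) :
    ∃ (N : ℕ) (w : ℕ → Fin 3 → MvPolynomial (Fin n) K), (∀ j, w j ∈ gr K n j) ∧
      v = ∑ j ∈ Finset.range N, w j := by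
  refine ⟨(Finset.univ.sup fun i => (v i).totalDegree) + 3,
    fun j i => if i.val ≤ j then homogeneousComponent (j - i.val) (v i) else 0, ?_, ?_⟩
  · intro j i
    dsimp only
    split_ifs with hij
    · exact (HomW.iff_isHomogeneous.mpr (homogeneousComponent_isHomogeneous _ _)).congr (by omega)
    · exact HomW.zero
  · ext1 i
    rw [Finset.sum_apply, ← Finset.sum_filter]
    conv_lhs => rw [← sum_homogeneousComponent (v i)]
    have hle : (v i).totalDegree ≤ Finset.univ.sup fun i => (v i).totalDegree :=
      Finset.le_sup (f := fun i => (v i).totalDegree) (Finset.mem_univ i)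
    rw [Finset.sum_subset (Finset.range_subset_range.mpr (show (v i).totalDegree + 1 ≤
      (Finset.univ.sup fun i => (v i).totalDegree) + 3 - i.val by omega))]
    · symm
      refine Finset.sum_nbij' (fun j => j - i.val) (fun j => j + i.val) ?_ ?_ ?_ ?_
        fun _ _ => rfl
      all_goals
        intro j hj
        simp only [Finset.mem_filter, Finset.mem_range] at hj ⊢
        omega
    · intro e _ he
      refine homogeneousComponent_eq_zero _ _ ?_
      rw [Finset.mem_range] at he
      omega

/-- Minimal generators, multiplication and relations of a saturated module. -/
structure Matrices (S : (Fin 3 → MvPolynomial (Fin 3) K) →ₗ[MvPolynomial (Fin 3) K]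
    (Fin 3 → MvPolynomial (Fin 3) K)) (b : ℕ)
    (M : Submodule (MvPolynomial (Fin 3) K) (Fin 3 → MvPolynomial (Fin 3) K))
    {ι κ : Type*} [Fintype ι] [Fintype κ] (g : ι → Fin 3 → MvPolynomial (Fin 3) K)
    (σ : Matrix ι ι (MvPolynomial (Fin 3) K)) (α : Matrix κ ι (MvPolynomial (Fin 3) K))
    (p q : Matrix κ κ (MvPolynomial (Fin 3) K)) : Prop where
  gr : ∀ l, g l ∈ gr K 3 (b + 1)
  span : Submodule.span (MvPolynomial (Fin 3) K) (Set.range g) = M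
  σ_hom : ∀ i j, HomW (σ i j) 0 1
  mul : ∀ j, S (g j) = Fintype.linearCombination (MvPolynomial (Fin 3) K) g (σ j)
  α_hom : ∀ i j, HomW (α i j) 0 1
  rel : ∀ i, Fintype.linearCombination (MvPolynomial (Fin 3) K) g (α i) = 0
  rel_span : ∀ w : ι → MvPolynomial (Fin 3) K, Fintype.linearCombination _ g w = 0 →
    ∃ u v : κ → MvPolynomial (Fin 3) K, w = u ᵥ* α + v ᵥ* (α * σ)
  indep : ∀ u v : κ → MvPolynomial (Fin 3) K, u ᵥ* α + v ᵥ* (α * σ) = 0 → u = 0 ∧ v = 0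
  p_hom : ∀ i j, HomW (p i j) 0 2
  q_hom : ∀ i j, HomW (q i j) 0 1
  sq : α * σ * σ = p * α + q * (α * σ)

end PlaneCubic

namespace PlaneCubic

open MvPolynomial Matrix

variable {K : Type*} [Field K]

theorem lin_comb_mem_gr {ι : Type*} [Fintype ι] {n j t : ℕ} {g : ι → Fin 3 → MvPolynomial (Fin n) K}
    (hg : ∀ l, g l ∈ gr K n j) {w : ι → MvPolynomial (Fin n) K} (hw : ∀ l, HomW (w l) 0 t) :
    Fintype.linearCombination (MvPolynomial (Fin n) K) g w ∈ gr K n (j + t) := by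
  rw [Fintype.linearCombination_apply, add_comm]
  exact sum_mem fun l _ => smul_mem_homVec (i' := 0) ((hw l).congr (by omega)) (hg l)

theorem modVec_lin_comb {ι : Type*} [Fintype ι] (g : ι → Fin 3 → MvPolynomial (Fin 3) K)
    (w : ι → MvPolynomial (Fin 3) K) :
    modVec K (Fintype.linearCombination (MvPolynomial (Fin 3) K) g w) =
      Fintype.linearCombination (MvPolynomial (Fin 2) K) (fun l => modVec K (g l))
        (fun l => modFirst K 2 (w l)) := by
  simp only [Fintype.linearCombination_apply, map_sum, modVec_smul]

namespace Saturated

variable {S : (Fin 3 → MvPolynomial (Fin 3) K) →ₗ[MvPolynomial (Fin 3) K]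
    (Fin 3 → MvPolynomial (Fin 3) K)} {b : ℕ}
    {M : Submodule (MvPolynomial (Fin 3) K) (Fin 3 → MvPolynomial (Fin 3) K)}

theorem exists_basis (h : Saturated S b M) : ∃ g : Fin (2 * b + 3) → Fin 3 → MvPolynomial (Fin 3) K,
    Submodule.span K (Set.range g) = piece M (b + 1) ∧
    LinearIndependent K (fun l => modVec K (g l)) := by
  have hinj : Function.Injective ((modVec K).domRestrict (piece M (b + 1))) :=
    (LinearMap.injective_domRestrict_iff).mpr h.disjoint_ker
  have hfin : Module.finrank K (piece M (b + 1)) = 2 * b + 3 := by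
    rw [← h.toSocle.finrank_eq, ← LinearMap.range_domRestrict, LinearMap.finrank_range_of_inj hinj]
  have : Module.Finite K (piece M (b + 1)) := Module.finite_of_finrank_pos (by omega)
  let B := Module.finBasisOfFinrankEq K (piece M (b + 1)) hfin
  refine ⟨fun l => (B l).1, ?_, ?_⟩
  · have : (Set.range fun l => (B l).1) = (piece M (b + 1)).subtype '' Set.range B := by
      rw [← Set.range_comp]; rfl
    rw [this, ← Submodule.map_span, B.span_eq, Submodule.map_subtype_top]
  · have := B.linearIndependent.map' _ (LinearMap.ker_eq_bot.mpr hinj)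
    simpa only [Function.comp_def, LinearMap.domRestrict_apply] using this

section

variable {ι κ : Type*} [Fintype ι] [Fintype κ] {g : ι → Fin 3 → MvPolynomial (Fin 3) K}

theorem span_modVec (hg : Submodule.span K (Set.range g) = piece M (b + 1)) :
    Submodule.span K (Set.range fun l => modVec K (g l)) = (piece M (b + 1)).map (modVec K) := by
  rw [← hg, Submodule.map_span, ← Set.range_comp]; rfl

theorem mem_piece (hg : Submodule.span K (Set.range g) = piece M (b + 1)) (l : ι) :
    g l ∈ piece M (b + 1) := hg ▸ Submodule.subset_span ⟨l, rfl⟩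

theorem lin_comb_mem_piece (hg : Submodule.span K (Set.range g) = piece M (b + 1)) {t : ℕ}
    {w : ι → MvPolynomial (Fin 3) K} (hw : ∀ l, HomW (w l) 0 t) :
    Fintype.linearCombination (MvPolynomial (Fin 3) K) g w ∈ piece M (b + 1 + t) := by
  refine ⟨?_, lin_comb_mem_gr (fun l => (mem_piece hg l).2) hw⟩
  rw [Fintype.linearCombination_apply]
  exact sum_mem fun l _ => M.smul_mem _ (mem_piece hg l).1

theorem exists_const (hg : Submodule.span K (Set.range g) = piece M (b + 1))
    {w : Fin 3 → MvPolynomial (Fin 3) K} (hw : w ∈ piece M (b + 1)) :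
    ∃ r : ι → K, w = Fintype.linearCombination (MvPolynomial (Fin 3) K) g (fun l => C (r l)) := by
  rw [← hg, Submodule.mem_span_range_iff_exists_fun] at hw
  obtain ⟨r, rfl⟩ := hw
  refine ⟨r, ?_⟩
  simp only [Fintype.linearCombination_apply, ← algebraMap_eq, algebraMap_smul]

theorem exists_lin_comb (h : Saturated S b M)
    (hg : Submodule.span K (Set.range g) = piece M (b + 1)) (t : ℕ) :
    ∀ v ∈ piece M (b + 1 + t), ∃ z : ι → MvPolynomial (Fin 3) K, (∀ l, HomW (z l) 0 t) ∧
      v = Fintype.linearCombination (MvPolynomial (Fin 3) K) g z := by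
  induction t with
  | zero =>
    intro v hv
    obtain ⟨r, hr⟩ := exists_const hg hv
    exact ⟨_, fun l => HomW.C _, hr⟩
  | succ t ih =>
    intro v hv
    obtain ⟨z, hz, hvz⟩ := h.toSocle.exists_lin_comb_add (span_modVec hg) t (modVec K v)
      (by convert modVec_mem_gr hv.2 using 2; ring)
    have hz' : ∀ l, HomW (rename Fin.succ (z l) : MvPolynomial (Fin 3) K) 0 (t + 1) :=
      fun l => (hz l).rename_succ
    obtain ⟨w, hw, hvw⟩ := h.exists_of_modVec (j := b + 1 + t)
      (sub_mem hv (lin_comb_mem_piece hg hz')) (by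
        rw [map_sub, modVec_lin_comb, hvz]
        simp only [modFirst_rename, sub_self])
    obtain ⟨y, hy, rfl⟩ := ih w hw
    refine ⟨fun l => rename Fin.succ (z l) + X 0 * y l, fun l => (hz' l).add ((hy l).X_mul 0), ?_⟩
    rw [sub_eq_iff_eq_add.mp hvw, ← map_smul, ← map_add, add_comm]
    rfl

variable {σ : Matrix ι ι (MvPolynomial (Fin 3) K)} {α : Matrix κ ι (MvPolynomial (Fin 3) K)}

theorem exists_relation (h : Saturated S b M)
    (hg : Submodule.span K (Set.range g) = piece M (b + 1))
    (hgi : LinearIndependent K fun l => modVec K (g l))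
    (hσh : ∀ i j, HomW (σ i j) 0 1)
    (hσ : ∀ j, S (g j) = Fintype.linearCombination _ g (σ j))
    (hαh : ∀ i j, HomW (α i j) 0 1)
    (hα : ∀ i, Fintype.linearCombination (MvPolynomial (Fin 3) K) g (α i) = 0)
    {c : κ → Fin 3 → MvPolynomial (Fin 2) K} {ξ η : κ → ι → K}
    (hc : Submodule.span K (Set.range c) =
      Socle.ker (modEnd S) b ((piece M (b + 1)).map (modVec K)))
    (hξ : ∀ i, (X 0 : MvPolynomial (Fin 2) K) • c i = Fintype.linearCombination
      (MvPolynomial (Fin 2) K) (fun l => modVec K (g l)) (fun l => C (ξ i l)))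
    (hη : ∀ i, (X 1 : MvPolynomial (Fin 2) K) • c i = Fintype.linearCombination
      (MvPolynomial (Fin 2) K) (fun l => modVec K (g l)) (fun l => C (η i l)))
    (hξη : ∀ i l, modFirst K 2 (α i l) = X 0 * C (η i l) - X 1 * C (ξ i l)) (e : ℕ) :
    ∀ w : ι → MvPolynomial (Fin 3) K, (∀ l, HomW (w l) 0 e) →
      Fintype.linearCombination _ g w = 0 → ∃ u v : κ → MvPolynomial (Fin 3) K,
        (∀ i, HomW (u i) 1 e) ∧ (∀ i, HomW (v i) 2 e) ∧ w = u ᵥ* α + v ᵥ* (α * σ) := by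
  have hσ' : ∀ j, modEnd S (modVec K (g j)) = Fintype.linearCombination _
      (fun l => modVec K (g l)) (σ.map (modFirst K 2) j) := fun j => by
    rw [modEnd_modVec, hσ, modVec_lin_comb]; rfl
  have red : ∀ (e : ℕ) (w : ι → MvPolynomial (Fin 3) K), (∀ l, HomW (w l) 0 e) →
      Fintype.linearCombination _ g w = 0 → ∃ u v : κ → MvPolynomial (Fin 3) K,
        (∀ i, HomW (u i) 1 e) ∧ (∀ i, HomW (v i) 2 e) ∧
        (∀ l, HomW ((w - (u ᵥ* α + v ᵥ* (α * σ))) l) 0 e) ∧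
        Fintype.linearCombination _ g (w - (u ᵥ* α + v ᵥ* (α * σ))) = 0 ∧
        ∃ w', w - (u ᵥ* α + v ᵥ* (α * σ)) = (X 0 : MvPolynomial (Fin 3) K) • w' := by
    intro e w hw h0
    obtain ⟨u, v, hu, hv, huv⟩ := h.toSocle.exists_relation (span_modVec hg) hgi hc
      (σ := σ.map (modFirst K 2)) (α := α.map (modFirst K 2)) (fun i j => (hσh i j).modFirst) hσ' hξ hη
      hξη e (fun l => modFirst K 2 (w l)) (fun l => (hw l).modFirst)
      (by rw [← modVec_lin_comb, h0, map_zero])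
    have hu' : ∀ i, HomW (rename Fin.succ (u i) : MvPolynomial (Fin 3) K) 1 e :=
      fun i => (hu i).rename_succ
    have hv' : ∀ i, HomW (rename Fin.succ (v i) : MvPolynomial (Fin 3) K) 2 e :=
      fun i => (hv i).rename_succ
    refine ⟨fun i => rename Fin.succ (u i), fun i => rename Fin.succ (v i), hu', hv', ?_, ?_, ?_⟩
    · intro l
      refine (hw l).sub (HomW.add ?_ ?_)
      · exact HomW.sum _ fun i _ => ((hu' i).mul (hαh i l)).congr (by omega)
      · exact HomW.sum _ fun i _ => ((hv' i).mul
          (HomW.sum _ fun j _ => (hαh i j).mul (hσh j l))).congr (by omega)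
    · have h1 : ∀ u : κ → MvPolynomial (Fin 3) K,
          Fintype.linearCombination (MvPolynomial (Fin 3) K) g (u ᵥ* α) = 0 := by
        intro u
        have : u ᵥ* α = ∑ i, u i • α i := by
          ext1 l; simp [vecMul, dotProduct, Finset.sum_apply]
        simp only [this, map_sum, map_smul, hα, smul_zero, Finset.sum_const_zero]
      rw [map_sub, map_add, h0, h1, ← vecMul_vecMul, ← Socle.map_lin_comb hσ, h1, map_zero, add_zero,
        sub_zero]
    · have : ∀ l, ∃ q, (w - ((fun i => rename Fin.succ (u i)) ᵥ* α +
          (fun i => rename Fin.succ (v i)) ᵥ* (α * σ))) l = X 0 * q := by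
        intro l
        apply exists_of_modFirst_eq_zero
        have := congrFun huv l
        rw [Pi.sub_apply, Pi.add_apply, map_sub, map_add, this]
        simp only [Pi.add_apply, vecMul, dotProduct, map_sum, map_mul, modFirst_rename,
          Matrix.map_apply, Matrix.mul_apply, sub_self]
      choose w' hw' using this
      exact ⟨w', funext hw'⟩
  induction e with
  | zero =>
    intro w hw h0
    obtain ⟨u, v, hu, hv, hhom, -, w', hw'⟩ := red 0 w hw h0
    refine ⟨u, v, hu, hv, ?_⟩
    rw [← sub_eq_zero]
    ext1 l
    have h1 := (hhom l).eq_C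
    have h2 := congrArg (coeff 0) (congrFun hw' l)
    rw [Pi.smul_apply, smul_eq_mul, coeff_X_mul', if_neg (by simp)] at h2
    rw [h1, h2, C_0, Pi.zero_apply]
  | succ e ih =>
    intro w hw h0
    obtain ⟨u, v, hu, hv, hhom, hL, w', hw'⟩ := red (e + 1) w hw h0
    rw [hw'] at hhom hL
    rw [map_smul, smul_eq_zero] at hL
    obtain ⟨u', v', hu', hv', rfl⟩ := ih w' (fun l => (hhom l).of_X_mul)
      (hL.resolve_left (X_ne_zero 0))
    refine ⟨u + (X 0 : MvPolynomial (Fin 3) K) • u', v + (X 0 : MvPolynomial (Fin 3) K) • v',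
      fun i => (hu i).add ((hu' i).X_mul 0), fun i => (hv i).add ((hv' i).X_mul 0), ?_⟩
    rw [sub_eq_iff_eq_add.mp hw', add_vecMul, add_vecMul, smul_vecMul, smul_vecMul, smul_add]
    abel

end

end Saturated

end PlaneCubic

namespace PlaneCubic

open MvPolynomial Matrix

variable {K : Type*} [Field K]

theorem vecMul_mul_eq_zero_of_ker {A ι κ : Type*} [CommRing A] [IsDomain A] [IsNoetherianRing A]
    [Fintype ι] [Fintype κ] {n : ℕ} {g : ι → Fin n → A} {β γ : Matrix κ ι A}
    (hspan : ∀ w : ι → A, Fintype.linearCombination A g w = 0 →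
      ∃ u v : κ → A, w = u ᵥ* β + v ᵥ* γ)
    (hmem : ∀ u v : κ → A, Fintype.linearCombination A g (u ᵥ* β + v ᵥ* γ) = 0)
    (hcard : 2 * Fintype.card κ + n ≤ Fintype.card ι) (u v : κ → A)
    (h : u ᵥ* β + v ᵥ* γ = 0) : u = 0 ∧ v = 0 := by
  let T : (κ → A) × (κ → A) →ₗ[A] (ι → A) := β.vecMulLinear.coprod γ.vecMulLinear
  have hT : ∀ x, T x = x.1 ᵥ* β + x.2 ᵥ* γ := fun x => rfl
  have hrange : LinearMap.range T = LinearMap.ker (Fintype.linearCombination A g) := by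
    ext w
    rw [LinearMap.mem_range, LinearMap.mem_ker]
    constructor
    · rintro ⟨x, rfl⟩; exact hmem _ _
    · intro hw
      obtain ⟨u, v, rfl⟩ := hspan w hw
      exact ⟨(u, v), rfl⟩
  have h1 := (LinearMap.ker T).finrank_quotient_add_finrank
  rw [T.quotKerEquivRange.finrank_eq] at h1
  have h2 := (LinearMap.ker (Fintype.linearCombination A g)).finrank_quotient_add_finrank
  rw [(Fintype.linearCombination A g).quotKerEquivRange.finrank_eq] at h2
  have h3 := Submodule.finrank_le (LinearMap.range (Fintype.linearCombination A g))
  rw [Module.finrank_prod, Module.finrank_pi, hrange] at h1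
  rw [Module.finrank_pi] at h2
  rw [Module.finrank_pi, Fintype.card_fin] at h3
  have h4 : Module.finrank A (LinearMap.ker T) = 0 := by omega
  rw [Submodule.finrank_eq_zero] at h4
  have := LinearMap.ker_eq_bot.mp h4 (a₁ := (u, v)) (a₂ := 0) (by rw [hT, h, map_zero])
  exact Prod.ext_iff.mp this

namespace Saturated

variable {S : (Fin 3 → MvPolynomial (Fin 3) K) →ₗ[MvPolynomial (Fin 3) K]
    (Fin 3 → MvPolynomial (Fin 3) K)} {b : ℕ}
    {M : Submodule (MvPolynomial (Fin 3) K) (Fin 3 → MvPolynomial (Fin 3) K)}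

theorem exists_socle_basis (h : Saturated S b M) : ∃ c : Fin b → Fin 3 → MvPolynomial (Fin 2) K,
    Submodule.span K (Set.range c) =
      Socle.ker (modEnd S) b ((piece M (b + 1)).map (modVec K)) := by
  have hfin := h.toSocle.finrank_ker
  have := h.pos
  have : Module.Finite K (Socle.ker (modEnd S) b ((piece M (b + 1)).map (modVec K))) :=
    Module.finite_of_finrank_pos (by omega)
  let B := Module.finBasisOfFinrankEq K _ hfin
  refine ⟨fun l => (B l).1, ?_⟩
  have : (Set.range fun l => (B l).1) = (Socle.ker (modEnd S) b
      ((piece M (b + 1)).map (modVec K))).subtype '' Set.range B := by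
    rw [← Set.range_comp]; rfl
  rw [this, ← Submodule.map_span, B.span_eq, Submodule.map_subtype_top]

theorem span_eq {ι : Type*} [Fintype ι] {g : ι → Fin 3 → MvPolynomial (Fin 3) K}
    (h : Saturated S b M) (hg : Submodule.span K (Set.range g) = piece M (b + 1)) :
    Submodule.span (MvPolynomial (Fin 3) K) (Set.range g) = M := by
  apply le_antisymm
  · rw [Submodule.span_le]
    rintro _ ⟨l, rfl⟩
    exact (mem_piece hg l).1
  · intro v hv
    obtain ⟨N, w, hw, rfl⟩ := exists_gr_sum v
    have hwM := h.graded N w hw hv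
    refine sum_mem fun j hj => ?_
    rw [Finset.mem_range] at hj
    rcases le_or_gt j b with hjb | hjb
    · rw [h.piece_eq_zero (b - j) j (by omega) (w j) ⟨hwM j hj, hw j⟩]
      exact zero_mem _
    · obtain ⟨t, rfl⟩ := Nat.exists_eq_add_of_le (Nat.succ_le_of_lt hjb)
      obtain ⟨z, -, hz⟩ := h.exists_lin_comb hg t _ ⟨hwM _ hj, hw _⟩
      rw [hz, Fintype.linearCombination_apply]
      exact sum_mem fun l _ => Submodule.smul_mem _ _ (Submodule.subset_span ⟨l, rfl⟩)

theorem exists_relation_of_homogeneous {ι κ : Type*} [Fintype ι] [Fintype κ]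
    {g : ι → Fin 3 → MvPolynomial (Fin 3) K} {β γ : Matrix κ ι (MvPolynomial (Fin 3) K)}
    (hg : ∀ l, g l ∈ gr K 3 (b + 1))
    (hrel : ∀ (e : ℕ) (w : ι → MvPolynomial (Fin 3) K), (∀ l, HomW (w l) 0 e) →
      Fintype.linearCombination (MvPolynomial (Fin 3) K) g w = 0 →
      ∃ u v : κ → MvPolynomial (Fin 3) K, w = u ᵥ* β + v ᵥ* γ)
    (w : ι → MvPolynomial (Fin 3) K)
    (hw : Fintype.linearCombination (MvPolynomial (Fin 3) K) g w = 0) :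
    ∃ u v : κ → MvPolynomial (Fin 3) K, w = u ᵥ* β + v ᵥ* γ := by
  let N := (Finset.univ.sup fun l => (w l).totalDegree) + 1
  let wc : ℕ → ι → MvPolynomial (Fin 3) K := fun e l => homogeneousComponent e (w l)
  have hwc : ∀ e l, HomW (wc e l) 0 e := fun e l =>
    HomW.iff_isHomogeneous.mpr (homogeneousComponent_isHomogeneous _ _)
  have hsum : w = ∑ e ∈ Finset.range N, wc e := by
    ext1 l
    have hle : (w l).totalDegree ≤ Finset.univ.sup fun l => (w l).totalDegree :=
      Finset.le_sup (f := fun l => (w l).totalDegree) (Finset.mem_univ l)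
    rw [Finset.sum_apply]
    conv_lhs => rw [← sum_homogeneousComponent (w l)]
    refine Finset.sum_subset (Finset.range_subset_range.mpr (by omega)) ?_
    intro e _ he
    refine homogeneousComponent_eq_zero _ _ ?_
    rw [Finset.mem_range] at he
    omega
  have hzero : ∀ e < N, Fintype.linearCombination (MvPolynomial (Fin 3) K) g (wc e) = 0 := by
    intro e he
    ext1 i
    refine HomW.eq_zero_of_sum_eq_zero (a := b + 1) (i := i.val)
      (f := fun e => Fintype.linearCombination (MvPolynomial (Fin 3) K) g (wc e) i)
      (fun e => lin_comb_mem_gr hg (hwc e) i) (N := N) ?_ e he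
    rw [← Finset.sum_apply, ← map_sum, ← hsum, hw, Pi.zero_apply]
  have : ∀ e, ∃ u v : κ → MvPolynomial (Fin 3) K, e < N → wc e = u ᵥ* β + v ᵥ* γ := by
    intro e
    by_cases he : e < N
    · obtain ⟨u, v, huv⟩ := hrel e (wc e) (hwc e) (hzero e he)
      exact ⟨u, v, fun _ => huv⟩
    · exact ⟨0, 0, fun h => absurd h he⟩
  choose u v huv using this
  refine ⟨∑ e ∈ Finset.range N, u e, ∑ e ∈ Finset.range N, v e, ?_⟩
  rw [hsum, Matrix.sum_vecMul, Matrix.sum_vecMul, ← Finset.sum_add_distrib]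
  exact Finset.sum_congr rfl fun e he => huv e (Finset.mem_range.mp he)

theorem exists_matrices (h : Saturated S b M) :
    ∃ (g : Fin (2 * b + 3) → Fin 3 → MvPolynomial (Fin 3) K)
      (σ : Matrix (Fin (2 * b + 3)) (Fin (2 * b + 3)) (MvPolynomial (Fin 3) K))
      (α : Matrix (Fin b) (Fin (2 * b + 3)) (MvPolynomial (Fin 3) K))
      (p q : Matrix (Fin b) (Fin b) (MvPolynomial (Fin 3) K)), Matrices S b M g σ α p q := by
  obtain ⟨g, hg, hgi⟩ := h.exists_basis
  obtain ⟨c, hc⟩ := h.exists_socle_basis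
  have hσ : ∀ j, ∃ z : Fin (2 * b + 3) → MvPolynomial (Fin 3) K, (∀ l, HomW (z l) 0 1) ∧
      S (g j) = Fintype.linearCombination (MvPolynomial (Fin 3) K) g z := fun j =>
    h.exists_lin_comb hg 1 _ ⟨h.stable _ (mem_piece hg j).1, h.map_gr _ _ (mem_piece hg j).2⟩
  choose σ hσh hσ using hσ
  have hcm : ∀ i, c i ∈ Socle.ker (modEnd S) b ((piece M (b + 1)).map (modVec K)) :=
    fun i => hc ▸ Submodule.subset_span ⟨i, rfl⟩
  choose ξ hξ using fun i => Socle.exists_lin_comb (span_modVec hg) (hcm i).2.1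
  choose η hη using fun i => Socle.exists_lin_comb (span_modVec hg) (hcm i).2.2
  have hα : ∀ i, ∃ a : Fin (2 * b + 3) → MvPolynomial (Fin 3) K, (∀ l, HomW (a l) 0 1) ∧
      Fintype.linearCombination (MvPolynomial (Fin 3) K) g a = 0 ∧
      ∀ l, modFirst K 2 (a l) = X 0 * C (η i l) - X 1 * C (ξ i l) := by
    intro i
    let y : Fin (2 * b + 3) → MvPolynomial (Fin 2) K :=
      fun l => X 0 * C (η i l) - X 1 * C (ξ i l)
    have hy : ∀ l, HomW (rename Fin.succ (y l) : MvPolynomial (Fin 3) K) 0 1 := fun l =>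
      HomW.rename_succ (((HomW.C (i := 0) _).X_mul 0).sub ((HomW.C (i := 0) _).X_mul 1))
    obtain ⟨w, hw, hyw⟩ := h.exists_of_modVec (j := b + 1) (lin_comb_mem_piece hg hy) (by
      have : y = (X 0 : MvPolynomial (Fin 2) K) • (fun l => C (η i l)) -
        (X 1 : MvPolynomial (Fin 2) K) • (fun l => C (ξ i l)) := rfl
      rw [modVec_lin_comb]
      simp only [modFirst_rename]
      change Fintype.linearCombination _ _ y = 0
      rw [this, map_sub, map_smul, map_smul, ← hη, ← hξ, smul_comm, sub_self])
    obtain ⟨r, rfl⟩ := exists_const hg hw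
    refine ⟨fun l => rename Fin.succ (y l) - X 0 * C (r l), fun l =>
      (hy l).sub ((HomW.C (i := 0) _).X_mul 0), ?_, fun l => ?_⟩
    · rw [← map_smul, ← sub_eq_zero, ← map_sub] at hyw
      exact hyw
    · rw [map_sub, map_mul, modFirst_X_zero, zero_mul, sub_zero, modFirst_rename]
  choose α hαh hα hξη using hα
  have hrel := h.exists_relation hg hgi hσh hσ hαh hα hc hξ hη hξη
  have hmem : ∀ u v : Fin b → MvPolynomial (Fin 3) K, Fintype.linearCombination
      (MvPolynomial (Fin 3) K) g (u ᵥ* Matrix.of α + v ᵥ* (Matrix.of α * Matrix.of σ)) = 0 := by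
    have h1 : ∀ u : Fin b → MvPolynomial (Fin 3) K,
        Fintype.linearCombination (MvPolynomial (Fin 3) K) g (u ᵥ* Matrix.of α) = 0 := by
      intro u
      have : u ᵥ* Matrix.of α = ∑ i, u i • α i := by
        ext1 l; simp [vecMul, dotProduct, Finset.sum_apply]
      simp only [this, map_sum, map_smul, hα, smul_zero, Finset.sum_const_zero]
    intro u v
    rw [map_add, h1, ← vecMul_vecMul, ← Socle.map_lin_comb (S := S) (σ := Matrix.of σ) hσ, h1, map_zero, add_zero]
  have hspan := exists_relation_of_homogeneous (fun l => (mem_piece hg l).2) (fun e w hw h0 => by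
    obtain ⟨u, v, -, -, huv⟩ := hrel e w hw h0
    exact ⟨u, v, huv⟩)
  have hsq : ∀ i, ∃ u v : Fin b → MvPolynomial (Fin 3) K, (∀ j, HomW (u j) 0 2) ∧
      (∀ j, HomW (v j) 0 1) ∧ (Matrix.of α * Matrix.of σ * Matrix.of σ) i =
        u ᵥ* Matrix.of α + v ᵥ* (Matrix.of α * Matrix.of σ) := by
    intro i
    obtain ⟨u, v, hu, hv, huv⟩ := hrel 3 ((Matrix.of α * Matrix.of σ * Matrix.of σ) i)
      (fun l => HomW.sum _ fun j _ => HomW.mul (j := 2)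
        (HomW.sum _ fun j' _ => HomW.mul (hαh i j') (hσh j' j)) (hσh j l)) (by
      have : (Matrix.of α * Matrix.of σ * Matrix.of σ) i =
          ((Pi.single i 1 : Fin b → MvPolynomial (Fin 3) K) ᵥ* (Matrix.of α * Matrix.of σ)) ᵥ*
            Matrix.of σ := by
        rw [vecMul_vecMul, single_one_vecMul]; rfl
      have h2 := hmem 0 (Pi.single i 1)
      rw [zero_vecMul, zero_add] at h2
      rw [this, ← Socle.map_lin_comb (S := S) (σ := Matrix.of σ) hσ, h2, map_zero])
    exact ⟨u, v, fun j => (hu j).congr (by omega), fun j => (hv j).congr (by omega), huv⟩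
  choose p q hp hq hpq using hsq
  exact ⟨g, Matrix.of σ, Matrix.of α, Matrix.of p, Matrix.of q,
    { gr := fun l => (mem_piece hg l).2
      span := h.span_eq hg
      σ_hom := hσh
      mul := hσ
      α_hom := hαh
      rel := hα
      rel_span := hspan
      indep := vecMul_mul_eq_zero_of_ker hspan hmem (by simp)
      p_hom := hp
      q_hom := hq
      sq := by
        exact Matrix.ext fun i l => congrFun (hpq i) l }⟩

end Saturated

end PlaneCubic

namespace PlaneCubic

open MvPolynomial Matrix

variable {K : Type*} [Field K]

/-- Vectors as polynomials of degree less than three. -/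
noncomputable def toPoly {A : Type*} [CommRing A] : (Fin 3 → A) →ₗ[A] Polynomial A where
  toFun v := ∑ i, Polynomial.C (v i) * Polynomial.X ^ i.val
  map_add' v w := by simp [add_mul, Finset.sum_add_distrib]
  map_smul' c v := by simp [mul_assoc, Finset.mul_sum, Polynomial.smul_eq_C_mul]

section toPoly

variable {A : Type*} [CommRing A]

theorem toPoly_apply (v : Fin 3 → A) :
    toPoly v = ∑ i : Fin 3, Polynomial.C (v i) * Polynomial.X ^ i.val := rfl

theorem coeff_toPoly (v : Fin 3 → A) (i : Fin 3) : (toPoly v).coeff i.val = v i := by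
  fin_cases i <;>
    simp [toPoly_apply, Fin.sum_univ_three, Polynomial.coeff_X, Polynomial.coeff_X_pow,
      Polynomial.coeff_C]

theorem degree_toPoly_lt (v : Fin 3 → A) : (toPoly v).degree < 3 := by
  have h : toPoly v ∈ Polynomial.degreeLT A 3 := by
    rw [toPoly_apply]
    refine Submodule.sum_mem _ fun i _ => Polynomial.mem_degreeLT.mpr ?_
    exact lt_of_le_of_lt (Polynomial.degree_C_mul_X_pow_le _ _) (by exact_mod_cast i.2)
  exact_mod_cast Polynomial.mem_degreeLT.mp h

theorem toPoly_coeff {p : Polynomial A} (hp : p.degree < 3) :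
    toPoly (fun i => p.coeff i.val) = p := by
  have hp' : p.natDegree < 3 := by
    by_cases h0 : p = 0
    · simp [h0]
    · exact (Polynomial.natDegree_lt_iff_degree_lt h0).mpr (by exact_mod_cast hp)
  conv_rhs => rw [p.as_sum_range_C_mul_X_pow' hp']
  rw [toPoly_apply, Finset.sum_range]

theorem toPoly_injective : Function.Injective (toPoly (A := A)) := fun v w h => by
  ext1 i; rw [← coeff_toPoly v, h, coeff_toPoly]

/-- Multiplication by the variable modulo a monic cubic polynomial. -/
noncomputable def compMul (F : Polynomial A) : (Fin 3 → A) →ₗ[A] (Fin 3 → A) where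
  toFun v := ![0, v 0, v 1] - v 2 • fun i : Fin 3 => F.coeff i.val
  map_add' v w := by
    ext1 i; simp only [Pi.add_apply, Pi.sub_apply, Pi.smul_apply, smul_eq_mul]
    fin_cases i <;> simp <;> ring
  map_smul' c v := by
    ext1 i; simp only [Pi.sub_apply, Pi.smul_apply, smul_eq_mul, RingHom.id_apply]
    fin_cases i <;> simp <;> ring

theorem compMul_apply (F : Polynomial A) (v : Fin 3 → A) :
    compMul F v = ![0, v 0, v 1] - v 2 • fun i : Fin 3 => F.coeff i.val := rfl

theorem X_mul_toPoly {F : Polynomial A} (hF : F.Monic) (hdeg : F.natDegree = 3) (v : Fin 3 → A) :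
    Polynomial.X * toPoly v = toPoly (compMul F v) + Polynomial.C (v 2) * F := by
  have h1 : F = Polynomial.X ^ 3 + toPoly (fun i : Fin 3 => F.coeff i.val) := by
    conv_lhs => rw [hF.as_sum, hdeg]
    rw [toPoly_apply, Finset.sum_range]
  have h2 : toPoly (compMul F v) = toPoly ![0, v 0, v 1] -
      Polynomial.C (v 2) * toPoly (fun i : Fin 3 => F.coeff i.val) := by
    rw [compMul_apply, map_sub, map_smul, Polynomial.smul_eq_C_mul]
  rw [h2]
  conv_rhs => enter [2, 2]; rw [h1]
  simp only [toPoly_apply, Fin.sum_univ_three]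
  simp
  ring

end toPoly

theorem finSuccEquiv_rename (p : MvPolynomial (Fin 3) K) :
    finSuccEquiv K 3 (rename Fin.succ p) = Polynomial.C p := by
  induction p using MvPolynomial.induction_on with
  | C a => simp [finSuccEquiv_apply]
  | add p q hp hq => simp [hp, hq]
  | mul_X p i hp => rw [map_mul, map_mul, hp, rename_X, finSuccEquiv_X_succ, map_mul]

/-- Vectors as polynomials of degree less than three in the first variable. -/
noncomputable def emb (v : Fin 3 → MvPolynomial (Fin 3) K) : MvPolynomial (Fin 4) K :=
  ∑ i : Fin 3, rename Fin.succ (v i) * X 0 ^ i.val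

theorem finSuccEquiv_emb (v : Fin 3 → MvPolynomial (Fin 3) K) :
    finSuccEquiv K 3 (emb v) = toPoly v := by
  simp only [emb, map_sum, map_mul, map_pow, finSuccEquiv_rename, finSuccEquiv_X_zero, toPoly_apply]

theorem emb_add (v w : Fin 3 → MvPolynomial (Fin 3) K) : emb (v + w) = emb v + emb w :=
  (finSuccEquiv K 3).injective (by simp only [map_add, finSuccEquiv_emb])

theorem emb_sub (v w : Fin 3 → MvPolynomial (Fin 3) K) : emb (v - w) = emb v - emb w :=
  (finSuccEquiv K 3).injective (by simp only [map_sub, finSuccEquiv_emb])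

theorem emb_zero : emb (0 : Fin 3 → MvPolynomial (Fin 3) K) = 0 :=
  (finSuccEquiv K 3).injective (by simp only [map_zero, finSuccEquiv_emb])

theorem emb_smul (p : MvPolynomial (Fin 3) K) (v : Fin 3 → MvPolynomial (Fin 3) K) :
    emb (p • v) = rename Fin.succ p * emb v :=
  (finSuccEquiv K 3).injective (by
    rw [map_mul, finSuccEquiv_emb, finSuccEquiv_emb, finSuccEquiv_rename, map_smul,
      Polynomial.smul_eq_C_mul])

theorem emb_sum {ι : Type*} (s : Finset ι) (v : ι → Fin 3 → MvPolynomial (Fin 3) K) :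
    emb (∑ i ∈ s, v i) = ∑ i ∈ s, emb (v i) :=
  (finSuccEquiv K 3).injective (by simp only [map_sum, finSuccEquiv_emb])

theorem HomW_pow_X {n : ℕ} (t : Fin n) (e : ℕ) : HomW ((X t : MvPolynomial (Fin n) K) ^ e) 0 e :=
  HomW.iff_isHomogeneous.mpr (isHomogeneous_X_pow t e)

theorem emb_isHomogeneous {v : Fin 3 → MvPolynomial (Fin 3) K} {j : ℕ} (hv : v ∈ gr K 3 j) :
    (emb v).IsHomogeneous j :=
  HomW.iff_isHomogeneous.mp (HomW.sum _ fun i _ =>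
    ((hv i).rename_succ.mul (HomW_pow_X 0 i.val)).congr (by omega))

theorem exists_emb_add_mul {f : MvPolynomial (Fin 4) K} (hF : (finSuccEquiv K 3 f).Monic)
    (hdeg : (finSuccEquiv K 3 f).natDegree = 3) (x : MvPolynomial (Fin 4) K) :
    ∃ v q, x = emb v + q * f := by
  have h3 : (finSuccEquiv K 3 x %ₘ finSuccEquiv K 3 f).degree < 3 := by
    refine (Polynomial.degree_modByMonic_lt _ hF).trans_eq ?_
    rw [Polynomial.degree_eq_natDegree hF.ne_zero, hdeg]; rfl
  refine ⟨fun i => (finSuccEquiv K 3 x %ₘ finSuccEquiv K 3 f).coeff i.val,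
    (finSuccEquiv K 3).symm (finSuccEquiv K 3 x /ₘ finSuccEquiv K 3 f), ?_⟩
  apply (finSuccEquiv K 3).injective
  rw [map_add, map_mul, finSuccEquiv_emb, toPoly_coeff h3, AlgEquiv.apply_symm_apply, mul_comm,
    Polynomial.modByMonic_add_div]

theorem eq_zero_of_dvd_emb {f : MvPolynomial (Fin 4) K} (hF : (finSuccEquiv K 3 f).Monic)
    (hdeg : (finSuccEquiv K 3 f).natDegree = 3) {v : Fin 3 → MvPolynomial (Fin 3) K}
    (h : f ∣ emb v) : v = 0 := by
  have h1 : finSuccEquiv K 3 f ∣ toPoly v := finSuccEquiv_emb v ▸ map_dvd (finSuccEquiv K 3) h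
  have h2 := Polynomial.eq_zero_of_dvd_of_degree_lt h1 ((degree_toPoly_lt v).trans_eq (by
    rw [Polynomial.degree_eq_natDegree hF.ne_zero, hdeg]; rfl))
  exact toPoly_injective (h2.trans (map_zero _).symm)

theorem X_zero_mul_emb {f : MvPolynomial (Fin 4) K} (hF : (finSuccEquiv K 3 f).Monic)
    (hdeg : (finSuccEquiv K 3 f).natDegree = 3) (v : Fin 3 → MvPolynomial (Fin 3) K) :
    X 0 * emb v = emb (compMul (finSuccEquiv K 3 f) v) + rename Fin.succ (v 2) * f := by
  apply (finSuccEquiv K 3).injective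
  rw [map_mul, map_add, map_mul, finSuccEquiv_emb, finSuccEquiv_emb, finSuccEquiv_X_zero,
    finSuccEquiv_rename, X_mul_toPoly hF hdeg]

theorem compMul_mem_gr {f : MvPolynomial (Fin 4) K} (hf : f.IsHomogeneous 3) {j : ℕ}
    {v : Fin 3 → MvPolynomial (Fin 3) K} (hv : v ∈ gr K 3 j) :
    compMul (finSuccEquiv K 3 f) v ∈ gr K 3 (j + 1) := by
  have hc : ∀ i : Fin 3, HomW ((finSuccEquiv K 3 f).coeff i.val) 0 (3 - i.val) := fun i =>
    HomW.iff_isHomogeneous.mpr (hf.finSuccEquiv_coeff_isHomogeneous _ _ (by omega))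
  intro i
  rw [compMul_apply, Pi.sub_apply, Pi.smul_apply, smul_eq_mul]
  refine HomW.sub ?_ (((hv 2).mul (hc i)).congr ?_)
  · fin_cases i
    · exact HomW.zero
    · exact (hv 0).congr (by simp; omega)
    · exact (hv 1).congr (by simp; omega)
  · simp only [Fin.val_two]; omega

end PlaneCubic

namespace PlaneCubic

open MvPolynomial Matrix

section

variable {K : Type*} [Field K]

theorem Matrices.data {f : MvPolynomial (Fin 4) K} (hF : (finSuccEquiv K 3 f).Monic)
    (hdeg : (finSuccEquiv K 3 f).natDegree = 3) {b : ℕ}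
    {M : Submodule (MvPolynomial (Fin 3) K) (Fin 3 → MvPolynomial (Fin 3) K)}
    {ι κ : Type*} [Fintype ι] [Fintype κ] {g : ι → Fin 3 → MvPolynomial (Fin 3) K}
    {σ : Matrix ι ι (MvPolynomial (Fin 3) K)} {α : Matrix κ ι (MvPolynomial (Fin 3) K)}
    {p q : Matrix κ κ (MvPolynomial (Fin 3) K)}
    (h : Matrices (compMul (finSuccEquiv K 3 f)) b M g σ α p q) :
    Polynomial.CompanionRes.Data (fun l => toPoly (g l)) (finSuccEquiv K 3 f) σ (fun l => g l 2) α p q := by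
  have hlin : ∀ w : ι → MvPolynomial (Fin 3) K, ∑ j, Polynomial.C (w j) * toPoly (g j) =
      toPoly (Fintype.linearCombination (MvPolynomial (Fin 3) K) g w) := fun w => by
    simp [Fintype.linearCombination_apply, map_sum, Polynomial.smul_eq_C_mul]
  refine ⟨hF, hdeg, fun j => degree_toPoly_lt _, fun j => ?_, fun i => ?_, fun w hw => ?_,
    h.indep, h.sq⟩
  · rw [X_mul_toPoly hF hdeg, h.mul, hlin]
  · rw [hlin, h.rel, map_zero]
  · refine h.rel_span w (toPoly_injective ?_)
    rw [← hlin, hw, map_zero]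

end

variable {k : Type} [Field k]

theorem entryOk_of_isHomogeneous {d e c : ℕ} {q : R4 k} (h : q.IsHomogeneous c) (hc : 0 < c)
    (hd : d = e + c) : EntryOk k d e q :=
  ⟨Or.inr ⟨c, hd, h⟩, (HomW.iff_isHomogeneous.mpr h).coeff_zero_eq hc.ne⟩

theorem entryOk_zero {d e : ℕ} : EntryOk k d e 0 := ⟨Or.inl rfl, coeff_zero _⟩

theorem HomW_one_apply {ι : Type*} [DecidableEq ι] {x : R4 k} {c : ℕ} (hx : HomW x 0 c) (i j : ι) :
    HomW ((x • (1 : Matrix ι ι (R4 k))) i j) 0 c := by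
  by_cases h : i = j
  · subst h; simpa using hx
  · simpa [h] using HomW.zero

theorem hasMinFreeRes3_of_matrices {f : R4 k} (hf : f.IsHomogeneous 3)
    (hF : (finSuccEquiv k 3 f).Monic) (hdeg : (finSuccEquiv k 3 f).natDegree = 3)
    {I : Ideal (R4 k)} (hfI : f ∈ I) {b : ℕ} (hb : 2 ≤ b)
    {M : Submodule (MvPolynomial (Fin 3) k) (Fin 3 → MvPolynomial (Fin 3) k)}
    (hM : ∀ v, v ∈ M ↔ emb v ∈ I) {n m n2 : ℕ} {g : Fin n → Fin 3 → MvPolynomial (Fin 3) k}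
    {σ : Matrix (Fin n) (Fin n) (MvPolynomial (Fin 3) k)}
    {α : Matrix (Fin m) (Fin n) (MvPolynomial (Fin 3) k)}
    {p q : Matrix (Fin m) (Fin m) (MvPolynomial (Fin 3) k)}
    (h : Matrices (compMul (finSuccEquiv k 3 f)) b M g σ α p q) (e : Fin n2 ≃ Fin n ⊕ Fin m) :
    HasMinFreeRes3 k ⊥ I (Fin.append (fun _ : Fin n => b + 1) (fun _ : Fin 1 => 3))
      (fun _ : Fin n2 => b + 2) (fun _ : Fin m => b + 4) := by
  have D := h.data hF hdeg
  set E := finSuccEquiv k 3 with hE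
  let ρ : MvPolynomial (Fin 3) k → R4 k := rename Fin.succ
  have hEρ : ∀ x, E (ρ x) = Polynomial.C x := finSuccEquiv_rename
  have hX0 : E (X 0) = Polynomial.X := finSuccEquiv_X_zero
  let A : Matrix (Fin n) (Fin n) (R4 k) := (X 0 : R4 k) • (1 : Matrix (Fin n) (Fin n) (R4 k)) - σ.map ρ
  let B : Matrix (Fin m) (Fin n) (R4 k) :=
    (X 0 : R4 k) • α.map ρ + (α * σ).map ρ - (q * α).map ρ
  let G : Matrix (Fin m) (Fin m) (R4 k) :=
    (X 0 ^ 2 : R4 k) • (1 : Matrix (Fin m) (Fin m) (R4 k)) - (X 0 : R4 k) • q.map ρ - p.map ρ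
  have hEA : ∀ i j, E (A i j) =
      ((Polynomial.X : Polynomial (MvPolynomial (Fin 3) k)) •
          (1 : Matrix (Fin n) (Fin n) (Polynomial (MvPolynomial (Fin 3) k))) - σ.map Polynomial.C :
        Matrix (Fin n) (Fin n) (Polynomial (MvPolynomial (Fin 3) k))) i j := fun i j => by
    by_cases hij : i = j <;> simp [A, hEρ, hX0, hij]
  have hEB : ∀ i j, E (B i j) =
      ((Polynomial.X : Polynomial (MvPolynomial (Fin 3) k)) • α.map Polynomial.C
        + (α * σ).map Polynomial.C - (q * α).map Polynomial.C) i j := fun i j => by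
    simp only [B, Matrix.sub_apply, Matrix.add_apply, Matrix.smul_apply, smul_eq_mul, map_sub,
      map_add, map_mul, Matrix.map_apply, hEρ, hX0]
  have hEG : ∀ i j, E (G i j) =
      ((Polynomial.X ^ 2 : Polynomial (MvPolynomial (Fin 3) k)) •
          (1 : Matrix (Fin m) (Fin m) (Polynomial (MvPolynomial (Fin 3) k))) - (Polynomial.X : Polynomial (MvPolynomial (Fin 3) k)) • q.map Polynomial.C
        - p.map Polynomial.C : Matrix (Fin m) (Fin m) (Polynomial (MvPolynomial (Fin 3) k))) i j :=
      fun i j => by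
    by_cases hij : i = j <;> simp [G, hEρ, hX0, hij]
  have hX : HomW (X 0 : R4 k) 0 1 := HomW.X 0
  let M2 : Fin n2 → Fin (n + 1) → R4 k := fun i =>
    Sum.elim (fun i => Fin.append (A i) fun _ : Fin 1 => - ρ (g i 2))
      (fun i => Fin.append (α.map ρ i) fun _ : Fin 1 => 0) (e i)
  let M3 : Fin m → Fin n2 → R4 k := fun l i => Sum.elim (fun i => - B l i) (fun i => G l i) (e i)
  let gens : Fin (n + 1) → R4 k := Fin.append (fun l => emb (g l)) fun _ : Fin 1 => f
  have hgens : ∀ w : Fin (n + 1) → R4 k, E (∑ j, w j * gens j) =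
      (fun j => E (w (Fin.castAdd 1 j))) ⬝ᵥ (fun l => toPoly (g l)) +
        E (w (Fin.natAdd n 0)) * E f := fun w => by
    rw [Fin.sum_univ_add]
    simp [gens, dotProduct, hE, finSuccEquiv_emb]
  have hsum : ∀ (u : Fin n2 → R4 k) (x : Fin n ⊕ Fin m → R4 k),
      ∑ i, u i * x (e i) = ∑ i, u (e.symm (Sum.inl i)) * x (Sum.inl i) +
        ∑ i, u (e.symm (Sum.inr i)) * x (Sum.inr i) := fun u x => by
    rw [← Fintype.sum_sum_type (f := fun y => u (e.symm y) * x y), ← e.sum_comp]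
    simp
  have hM2l : ∀ (u : Fin n2 → R4 k) (j : Fin n), E (∑ i, u i * M2 i (Fin.castAdd 1 j)) =
      ((fun i => E (u (e.symm (Sum.inl i)))) ᵥ*
        ((Polynomial.X : Polynomial (MvPolynomial (Fin 3) k)) •
          (1 : Matrix (Fin n) (Fin n) (Polynomial (MvPolynomial (Fin 3) k))) - σ.map Polynomial.C :
          Matrix (Fin n) (Fin n) (Polynomial (MvPolynomial (Fin 3) k))) +
        (fun i => E (u (e.symm (Sum.inr i)))) ᵥ* α.map Polynomial.C) j := fun u j => by
    rw [hsum u fun y => Sum.elim (fun i => Fin.append (A i) fun _ : Fin 1 => - ρ (g i 2))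
      (fun i => Fin.append (α.map ρ i) fun _ : Fin 1 => 0) y (Fin.castAdd 1 j)]
    simp only [Sum.elim_inl, Sum.elim_inr, Fin.append_left, map_add, map_sum, map_mul, hEA,
      Matrix.map_apply, hEρ, Pi.add_apply, vecMul, dotProduct]
  have hM2r : ∀ (u : Fin n2 → R4 k), E (∑ i, u i * M2 i (Fin.natAdd n 0)) =
      - ((fun i => E (u (e.symm (Sum.inl i)))) ⬝ᵥ Polynomial.CompanionRes.vC (fun l => g l 2)) := fun u => by
    rw [hsum u fun y => Sum.elim (fun i => Fin.append (A i) fun _ : Fin 1 => - ρ (g i 2))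
      (fun i => Fin.append (α.map ρ i) fun _ : Fin 1 => 0) y (Fin.natAdd n 0)]
    simp [hEρ, dotProduct, Polynomial.CompanionRes.vC]
  have hM3l : ∀ (t : Fin m → R4 k) (i : Fin n), E (∑ l, t l * M3 l (e.symm (Sum.inl i))) =
      (-((fun l => E (t l)) ᵥ* ((Polynomial.X : Polynomial (MvPolynomial (Fin 3) k)) •
        α.map Polynomial.C + (α * σ).map Polynomial.C - (q * α).map Polynomial.C))) i :=
    fun t i => by
    simp only [M3, Equiv.apply_symm_apply, Sum.elim_inl, mul_neg, Finset.sum_neg_distrib, map_neg,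
      map_sum, map_mul, hEB, Pi.neg_apply, vecMul, dotProduct]
  have hM3r : ∀ (t : Fin m → R4 k) (i : Fin m), E (∑ l, t l * M3 l (e.symm (Sum.inr i))) =
      ((fun l => E (t l)) ᵥ* ((Polynomial.X ^ 2 : Polynomial (MvPolynomial (Fin 3) k)) •
          (1 : Matrix (Fin m) (Fin m) (Polynomial (MvPolynomial (Fin 3) k)))
        - (Polynomial.X : Polynomial (MvPolynomial (Fin 3) k)) • q.map Polynomial.C
        - p.map Polynomial.C : Matrix (Fin m) (Fin m) (Polynomial (MvPolynomial (Fin 3) k)))) i := fun t i => by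
    simp only [M3, Equiv.apply_symm_apply, Sum.elim_inr, map_sum, map_mul, hEG, vecMul, dotProduct]
  have hall : ∀ (x y : Fin (n + 1) → R4 k), (∀ j, x j = y j) ↔
      (fun j => E (x (Fin.castAdd 1 j))) = (fun j => E (y (Fin.castAdd 1 j))) ∧
        E (x (Fin.natAdd n 0)) = E (y (Fin.natAdd n 0)) := fun x y => by
    constructor
    · intro hxy; simp only [hxy, and_self]
    · rintro ⟨h1, h2⟩ j
      refine Fin.addCases (fun j => E.injective (congrFun h1 j)) (fun j => ?_) j
      rw [Subsingleton.elim j 0]; exact E.injective h2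
  have hall2 : ∀ (x y : Fin n2 → R4 k), (∀ j, x j = y j) ↔
      (fun j => E (x (e.symm (Sum.inl j)))) = (fun j => E (y (e.symm (Sum.inl j)))) ∧
      (fun j => E (x (e.symm (Sum.inr j)))) = (fun j => E (y (e.symm (Sum.inr j)))) :=
    fun x y => by
    constructor
    · intro hxy; simp only [hxy, and_self]
    · rintro ⟨h1, h2⟩ j
      obtain ⟨y, rfl⟩ := e.symm.surjective j
      rcases y with y | y
      · exact E.injective (congrFun h1 y)
      · exact E.injective (congrFun h2 y)
  refine ⟨gens, M2, M3, ?_, ?_, ?_, ?_, ?_, ?_, ?_⟩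
  · intro j
    refine Fin.addCases (fun j => ?_) (fun j => ?_) j
    · simp only [gens, Fin.append_left]
      exact ⟨(hM _).mp (h.span ▸ Submodule.subset_span ⟨j, rfl⟩), emb_isHomogeneous (h.gr j)⟩
    · simp only [gens, Fin.append_right]
      exact ⟨hfI, hf⟩
  · intro x hx
    obtain ⟨v, c, rfl⟩ := exists_emb_add_mul hF hdeg x
    have hv : v ∈ M := (hM v).mpr (by
      simpa using I.sub_mem hx (I.mul_mem_left c hfI))
    rw [← h.span, Submodule.mem_span_range_iff_exists_fun] at hv
    obtain ⟨w, rfl⟩ := hv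
    refine ⟨Fin.append (fun j => ρ (w j)) fun _ => c, ?_⟩
    rw [Fin.sum_univ_add]
    simp [gens, emb_sum, emb_smul, ρ]
  · intro i j
    simp only [M2]
    rcases e i with i | i
    · refine Fin.addCases (fun j => ?_) (fun j => ?_) j
      · simp only [Sum.elim_inl, Fin.append_left]
        exact entryOk_of_isHomogeneous (HomW.iff_isHomogeneous.mp
          ((HomW_one_apply hX i j).sub (h.σ_hom i j).rename_succ)) one_pos rfl
      · simp only [Sum.elim_inl, Fin.append_right]
        refine entryOk_of_isHomogeneous (c := b - 1) (HomW.iff_isHomogeneous.mp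
          (((h.gr i 2).rename_succ.neg).congr ?_)) (by omega) (by omega)
        simp only [Fin.val_two]; omega
    · refine Fin.addCases (fun j => ?_) (fun j => ?_) j
      · simp only [Sum.elim_inr, Fin.append_left]
        exact entryOk_of_isHomogeneous (HomW.iff_isHomogeneous.mp
          (h.α_hom i j).rename_succ) one_pos rfl
      · simp only [Sum.elim_inr, Fin.append_right]
        exact entryOk_zero
  · intro i j
    simp only [M3]
    have hmul : ∀ {l₁ l₂ l₃ : ℕ} {x : Matrix (Fin l₁) (Fin l₂) (MvPolynomial (Fin 3) k)}
        {y : Matrix (Fin l₂) (Fin l₃) (MvPolynomial (Fin 3) k)}, (∀ i j, HomW (x i j) 0 1) →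
        (∀ i j, HomW (y i j) 0 1) → ∀ i j, HomW ((x * y) i j) 0 2 := fun hx hy i j =>
      HomW.sum _ fun l _ => (hx i l).mul (hy l j)
    rcases e j with j | j
    · exact entryOk_of_isHomogeneous (c := 2) (HomW.iff_isHomogeneous.mp
        (((hX.mul (h.α_hom i j).rename_succ).add (hmul h.α_hom h.σ_hom i j).rename_succ).sub
          (hmul h.q_hom h.α_hom i j).rename_succ).neg) two_pos rfl
    · exact entryOk_of_isHomogeneous (c := 2) (HomW.iff_isHomogeneous.mp
        (((HomW_one_apply (HomW_pow_X 0 2) i j).sub (hX.mul (h.q_hom i j).rename_succ)).sub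
          (h.p_hom i j).rename_succ)) two_pos rfl
  · intro w
    rw [Ideal.mem_bot, ← map_eq_zero_iff E E.injective, hgens, D.ker_gens]
    constructor
    · rintro ⟨u, t, h1, h2⟩
      refine ⟨fun i => E.symm (Sum.elim u t (e i)), (hall _ _).mpr ⟨?_, ?_⟩⟩
      · rw [h1]; funext j; rw [hM2l]; simp
      · rw [h2, hM2r]; simp
    · rintro ⟨u, hu⟩
      obtain ⟨h1, h2⟩ := (hall _ _).mp hu
      refine ⟨_, fun i => E (u (e.symm (Sum.inr i))), ?_, h2.trans (hM2r u)⟩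
      rw [h1]; funext j; rw [hM2l]
  · intro u
    have hz : (∀ j, ∑ i, u i * M2 i j = 0) ↔ _ := (hall (fun j => ∑ i, u i * M2 i j) 0)
    rw [hz]
    simp only [hM2l, hM2r, Pi.zero_apply, map_zero]
    refine (D.ker_syz _ _).trans ?_
    constructor
    · rintro ⟨c, h1, h2⟩
      refine ⟨fun l => E.symm (c l), (hall2 _ _).mpr ⟨?_, ?_⟩⟩
      · rw [h1]; funext i; rw [hM3l]; simp
      · rw [h2]; funext i; rw [hM3r]; simp
    · rintro ⟨t, ht⟩
      obtain ⟨h1, h2⟩ := (hall2 _ _).mp ht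
      refine ⟨fun l => E (t l), ?_, ?_⟩
      · rw [h1]; funext i; rw [hM3l]
      · rw [h2]; funext i; rw [hM3r]
  · intro t ht
    have := Polynomial.CompanionRes.eq_zero_of_vecMul_quadratic p q (fun l => E (t l)) (by
      funext i; rw [← hM3r, ht, map_zero]; rfl)
    funext l
    exact E.injective ((congrFun this l).trans (map_zero E).symm)

end PlaneCubic

namespace PlaneCubic

open MvPolynomial Matrix

section

variable {K : Type*} [Field K] {ι : Type*}

/-- Vectors of forms of degree `d` proportional to the point itself at every `z s` are multiples
of the tautological vector modulo `f`. -/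
def EigenRigid {n : ℕ} (f : MvPolynomial (Fin n) K) (d : ℕ) (z : ι → Fin n → K) : Prop :=
  ∀ h : Fin n → MvPolynomial (Fin n) K, (∀ i, (h i).IsHomogeneous d) →
    (∀ s, ∃ c : K, ∀ i, eval (z s) (h i) = c * z s i) → ∃ g, ∀ i, f ∣ h i - X i * g

/-- Polynomials vanishing on the punctured lines spanned by the vectors `z s`. -/
def coneIdeal {n : ℕ} (z : ι → Fin n → K) : Ideal (MvPolynomial (Fin n) K) where
  carrier := {p | ∀ s, ∀ c : K, c ≠ 0 → eval (c • z s) p = 0}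
  zero_mem' := fun s c _ => map_zero _
  add_mem' := fun ha hb s c hc => by rw [map_add, ha s c hc, hb s c hc, add_zero]
  smul_mem' := fun p q hq s c hc => by rw [smul_eq_mul, map_mul, hq s c hc, mul_zero]

theorem mem_coneIdeal {n : ℕ} {z : ι → Fin n → K} {p : MvPolynomial (Fin n) K} :
    p ∈ coneIdeal z ↔ ∀ s, ∀ c : K, c ≠ 0 → eval (c • z s) p = 0 := Iff.rfl

theorem eval_smul_of_isHomogeneous {n d : ℕ} {p : MvPolynomial (Fin n) K} (hp : p.IsHomogeneous d)
    (c : K) (v : Fin n → K) : eval (c • v) p = c ^ d * eval v p := by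
  simp only [eval_eq, Finset.mul_sum]
  refine Finset.sum_congr rfl fun m hm => ?_
  have hd : ∑ i ∈ m.support, m i = d := by
    have := hp (mem_support_iff.mp hm)
    rw [Finsupp.weight_apply, Finsupp.sum] at this
    simpa using this
  simp only [Pi.smul_apply, smul_eq_mul, mul_pow, Finset.prod_mul_distrib,
    Finset.prod_pow_eq_pow_sum, hd]
  ring

theorem mem_coneIdeal_of_isHomogeneous {n d : ℕ} {z : ι → Fin n → K}
    {p : MvPolynomial (Fin n) K} (hp : p.IsHomogeneous d) :
    p ∈ coneIdeal z ↔ ∀ s, eval (z s) p = 0 := by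
  refine ⟨fun h s => by simpa using h s 1 one_ne_zero, fun h s c _ => ?_⟩
  rw [eval_smul_of_isHomogeneous hp, h, mul_zero]

theorem mem_coneIdeal_of_sum_mem [Infinite K] {n : ℕ} {z : ι → Fin n → K} {N : ℕ}
    {p : ℕ → MvPolynomial (Fin n) K} (hp : ∀ j, (p j).IsHomogeneous j)
    (h : ∑ j ∈ Finset.range N, p j ∈ coneIdeal z) (j : ℕ) (hj : j < N) : p j ∈ coneIdeal z := by
  refine (mem_coneIdeal_of_isHomogeneous (hp j)).mpr fun s => ?_
  let Q : Polynomial K := ∑ j ∈ Finset.range N, Polynomial.C (eval (z s) (p j)) * Polynomial.X ^ j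
  have hQ : Polynomial.X * Q = 0 := Polynomial.funext fun c => by
    by_cases hc : c = 0
    · simp [hc]
    · have h1 := h s c hc
      simp only [map_sum, eval_smul_of_isHomogeneous (hp _)] at h1
      simp only [Q, Polynomial.eval_mul, Polynomial.eval_finsetSum, Polynomial.eval_C,
        Polynomial.eval_pow, Polynomial.eval_X, Polynomial.eval_zero]
      simp only [mul_comm (eval (z s) _), h1, mul_zero]
  have hQ0 : Q = 0 := (mul_eq_zero.mp hQ).resolve_left Polynomial.X_ne_zero
  have := congrArg (fun q => Polynomial.coeff q j) hQ0
  simpa [Q, Polynomial.coeff_X_pow, Finset.sum_ite_eq, hj] using this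

/-- The vectors whose associated polynomial lies in an ideal. -/
noncomputable def embIdeal (I : Ideal (MvPolynomial (Fin 4) K)) :
    Submodule (MvPolynomial (Fin 3) K) (Fin 3 → MvPolynomial (Fin 3) K) where
  carrier := {v | emb v ∈ I}
  zero_mem' := by simp [emb_zero]
  add_mem' ha hb := by
    simp only [Set.mem_ofPred_eq, emb_add] at *
    exact I.add_mem ha hb
  smul_mem' p v hv := by
    simp only [Set.mem_ofPred_eq, emb_smul] at *
    exact I.mul_mem_left _ hv

theorem mem_embIdeal {I : Ideal (MvPolynomial (Fin 4) K)} {v : Fin 3 → MvPolynomial (Fin 3) K} :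
    v ∈ embIdeal I ↔ emb v ∈ I := Iff.rfl

theorem exists_eq_of_dvd {f : MvPolynomial (Fin 4) K} (hF : (finSuccEquiv K 3 f).Monic)
    (hdeg : (finSuccEquiv K 3 f).natDegree = 3) {c : Fin 3 → MvPolynomial (Fin 3) K}
    {g : MvPolynomial (Fin 4) K} (h : f ∣ emb c - X 1 * g) :
    ∃ w q, g = emb w + q * f ∧ c = (X 0 : MvPolynomial (Fin 3) K) • w := by
  obtain ⟨w, q, rfl⟩ := exists_emb_add_mul hF hdeg g
  refine ⟨w, q, rfl, sub_eq_zero.mp (eq_zero_of_dvd_emb hF hdeg ?_)⟩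
  have h1 : emb (c - (X 0 : MvPolynomial (Fin 3) K) • w) =
      (emb c - X 1 * (emb w + q * f)) + (X 1 * q) * f := by
    rw [emb_sub, emb_smul, rename_X, Fin.succ_zero_eq_one]; ring
  rw [h1]
  exact dvd_add h (dvd_mul_left _ _)

theorem three_le_finrank {b : ℕ} (hb : 1 ≤ b) :
    Module.finrank K (gr K 3 (b + 1)) = (3 * ((b + 1) * b / 2) + (b + 1)) + (2 * b + 3) := by
  rw [finrank_homVec, Fin.sum_univ_three]
  obtain ⟨b, rfl⟩ := Nat.exists_eq_add_of_le' hb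
  have h2 : (2 : ℕ) ≤ b + 1 + 1 := by omega
  have h1 : (1 : ℕ) ≤ b + 1 + 1 := by omega
  simp only [Fin.val_zero, Fin.val_one, Fin.val_two, if_pos h1, if_pos h2, zero_le, if_true]
  simp only [Nat.multichoose_eq]
  have e0 : 3 + (b + 1 + 1 - 0) - 1 = b + 2 + 2 := by omega
  have e1 : 3 + (b + 1 + 1 - 1) - 1 = b + 1 + 2 := by omega
  have e2 : 3 + (b + 1 + 1 - 2) - 1 = b + 2 := by omega
  have f0 : b + 1 + 1 - 0 = b + 2 := by omega
  have f1 : b + 1 + 1 - 1 = b + 1 := by omega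
  have f2 : b + 1 + 1 - 2 = b := by omega
  rw [e0, e1, e2, f0, f1, f2, Nat.choose_symm_add, Nat.choose_symm_add, Nat.choose_symm_add]
  have hsum : (b + 1 + 1) * (b + 1) / 2 = (b + 2).choose 2 := by
    rw [Nat.choose_two_right]; rfl
  rw [hsum]
  have r1 : (b + 1 + 2).choose 2 = (b + 2).choose 2 + (b + 2) := by
    rw [show b + 1 + 2 = (b + 2) + 1 from rfl, Nat.choose_succ_succ' (b + 2) 1]; simp; ring
  have r2 : (b + 2 + 2).choose 2 = (b + 2).choose 2 + (b + 2) + (b + 3) := by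
    rw [show b + 2 + 2 = (b + 1 + 2) + 1 from rfl, Nat.choose_succ_succ' (b + 1 + 2) 1, r1]
    simp; ring
  rw [r1, r2]
  ring

theorem saturated_of_eigenRigid [Infinite K] [Fintype ι] {f : MvPolynomial (Fin 4) K}
    (hf : f.IsHomogeneous 3) (hF : (finSuccEquiv K 3 f).Monic)
    (hdeg : (finSuccEquiv K 3 f).natDegree = 3) {z : ι → Fin 4 → K}
    (hz : ∀ s, eval (z s) f = 0) (hz1 : ∀ s, z s 1 ≠ 0) {b : ℕ} (hb : 1 ≤ b)
    (hcard : Fintype.card ι = 3 * ((b + 1) * b / 2) + (b + 1)) (hN : EigenRigid f b z) :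
    Saturated (compMul (finSuccEquiv K 3 f)) b (embIdeal (coneIdeal z)) := by
  have hfI : f ∈ coneIdeal z := (mem_coneIdeal_of_isHomogeneous hf).mpr hz
  refine ⟨fun j v hv => compMul_mem_gr hf hv, hb, ?_, ?_, ?_, ?_, ?_, ?_⟩
  · intro v hv
    rw [mem_embIdeal] at *
    have : emb (compMul (finSuccEquiv K 3 f) v) = X 0 * emb v - rename Fin.succ (v 2) * f := by
      rw [X_zero_mul_emb hF hdeg]; ring
    rw [this]
    exact Ideal.sub_mem _ (Ideal.mul_mem_left _ _ hv) (Ideal.mul_mem_left _ _ hfI)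
  · intro N v hv h j hj
    rw [mem_embIdeal, emb_sum] at h
    exact mem_coneIdeal_of_sum_mem (fun j => emb_isHomogeneous (hv j)) h j hj
  · intro v hv s c hc
    have h1 := hv s c hc
    rw [emb_smul, rename_X, Fin.succ_zero_eq_one, map_mul, eval_X] at h1
    exact (mul_eq_zero.mp h1).resolve_left (by simp [hc, hz1 s])
  · intro v hv hvb
    have hv' := (mem_coneIdeal_of_isHomogeneous (emb_isHomogeneous hvb)).mp hv
    obtain ⟨g, hg⟩ := hN ![emb v, 0, 0, 0]
      (fun i => by
        fin_cases i
        · exact emb_isHomogeneous hvb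
        all_goals exact isHomogeneous_zero _ _ _)
      (fun s => ⟨0, fun i => by fin_cases i <;> simp [hv' s]⟩)
    obtain ⟨w, q, rfl, hw⟩ := exists_eq_of_dvd hF hdeg (c := 0) (by simpa [emb_zero] using hg 1)
    have hw0 : w = 0 := (smul_eq_zero.mp hw.symm).resolve_left (X_ne_zero 0)
    have h0 := hg 0
    simp only [hw0, emb_zero, zero_add, Matrix.cons_val_zero] at h0
    refine eq_zero_of_dvd_emb hF hdeg ?_
    have := dvd_add h0 (Dvd.intro_left (X 0 * q) rfl)
    rwa [mul_assoc, sub_add_cancel] at this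
  · let L : gr K 3 (b + 1) →ₗ[K] (ι → K) :=
      { toFun := fun v s => eval (z s) (emb v.1)
        map_add' := fun v w => by ext s; simp [emb_add]
        map_smul' := fun c v => by
          ext s
          have : ((c • v : gr K 3 (b + 1)) : Fin 3 → MvPolynomial (Fin 3) K) =
              (C c : MvPolynomial (Fin 3) K) • v.1 := by
            funext i; simp [smul_eq_C_mul]
          rw [this, emb_smul]; simp }
    have h1 := L.finrank_range_add_finrank_ker
    have h2 : Module.finrank K (LinearMap.range L) ≤ Fintype.card ι := by
      simpa using (LinearMap.range L).finrank_le
    have h3 : Module.finrank K (LinearMap.ker L) ≤ Module.finrank K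
        ((embIdeal (coneIdeal z)).restrictScalars K ⊓ gr K 3 (b + 1) :
          Submodule K (Fin 3 → MvPolynomial (Fin 3) K)) := by
      rw [← Submodule.finrank_map_subtype_eq (gr K 3 (b + 1)) (LinearMap.ker L)]
      have : FiniteDimensional K ((embIdeal (coneIdeal z)).restrictScalars K ⊓ gr K 3 (b + 1) :
          Submodule K (Fin 3 → MvPolynomial (Fin 3) K)) := Submodule.finiteDimensional_inf_right _ _
      refine Submodule.finrank_mono ?_
      rintro _ ⟨v, hv, rfl⟩
      refine ⟨?_, v.2⟩
      exact (mem_coneIdeal_of_isHomogeneous (emb_isHomogeneous v.2)).mpr fun s => congrFun hv s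
    have h4 := three_le_finrank (K := K) hb
    omega
  · intro c hc h₁ hh₁ h₂ hh₂ h₃ hh₃ m₁ m₂ m₃
    have key : ∀ {u : Fin 3 → MvPolynomial (Fin 3) K}, u ∈ embIdeal (coneIdeal z) →
        ∀ s, eval (z s) (emb u) = 0 := fun hu s => by simpa using hu s 1 one_ne_zero
    have e1 := fun s => key m₁ s
    have e2 := fun s => key m₂ s
    have e3 := fun s => key m₃ s
    have hS : emb (compMul (finSuccEquiv K 3 f) c) = X 0 * emb c - rename Fin.succ (c 2) * f := by
      rw [X_zero_mul_emb hF hdeg]; ring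
    simp only [emb_sub, emb_smul, rename_X, hS, map_sub, map_mul, eval_X, hz, mul_zero, sub_zero,
      Fin.succ_zero_eq_one, Fin.succ_one_eq_two, show Fin.succ (2 : Fin 3) = 3 from rfl] at e1 e2 e3
    obtain ⟨g, hg⟩ := hN ![emb h₃, emb c, emb h₁, emb h₂]
      (fun i => by
        fin_cases i
        · exact emb_isHomogeneous hh₃
        · exact emb_isHomogeneous hc
        · exact emb_isHomogeneous hh₁
        · exact emb_isHomogeneous hh₂)
      (fun s => ⟨eval (z s) (emb c) / z s 1, fun i => by
        have := hz1 s
        fin_cases i <;> simp only [Fin.zero_eta, Fin.mk_one, Fin.reduceFinMk, Matrix.cons_val] <;>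
          field_simp
        · linear_combination -e3 s
        · linear_combination -e1 s
        · linear_combination -e2 s⟩)
    obtain ⟨w, q, -, hw⟩ := exists_eq_of_dvd hF hdeg (c := c) (by simpa using hg 1)
    exact ⟨w, hw⟩

end

variable {k : Type} [Field k]

theorem pointsIdeal_range {ι : Type*} {Z : ι → P3 k} {z : ι → Fin 4 → k}
    (hz : ∀ s, ∃ hv : z s ≠ 0, Projectivization.mk k (z s) hv = Z s) :
    pointsIdeal k (Set.range Z) = coneIdeal z := by
  ext p
  constructor
  · intro hp s c hc
    obtain ⟨hv, h⟩ := hz s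
    refine hp (Z s) ⟨s, rfl⟩ (c • z s) (smul_ne_zero hc hv) ?_
    rw [← h, Projectivization.mk_eq_mk_iff']
    exact ⟨c, rfl⟩
  · rintro hp _ ⟨s, rfl⟩ v hv0 hv
    obtain ⟨hs, h⟩ := hz s
    rw [← h, Projectivization.mk_eq_mk_iff'] at hv
    obtain ⟨c, rfl⟩ := hv
    exact hp s c fun h0 => hv0 (by rw [h0, zero_smul])

theorem hasMinFreeRes3_coneIdeal [Infinite k] {ι : Type*} [Fintype ι] {f : R4 k}
    (hf : f.IsHomogeneous 3) (hF : (finSuccEquiv k 3 f).Monic)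
    (hdeg : (finSuccEquiv k 3 f).natDegree = 3) {z : ι → Fin 4 → k}
    (hz : ∀ s, eval (z s) f = 0) (hz1 : ∀ s, z s 1 ≠ 0) {a : ℕ} (ha : 3 ≤ a)
    (hcard : Fintype.card ι = 3 * (a * (a - 1) / 2) + a) (hN : EigenRigid f (a - 1) z) :
    HasMinFreeRes3 k ⊥ (coneIdeal z)
      (Fin.append (fun _ : Fin (2 * a + 1) => a) (fun _ : Fin 1 => 3))
      (fun _ : Fin (3 * a) => a + 1) (fun _ : Fin (a - 1) => a + 3) := by
  obtain ⟨b, rfl⟩ := Nat.exists_eq_add_of_le' (show 1 ≤ a by omega)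
  rw [Nat.add_sub_cancel] at *
  obtain ⟨g, σ, α, p, q, h⟩ :=
    (saturated_of_eigenRigid hf hF hdeg hz hz1 (by omega) hcard hN).exists_matrices
  exact hasMinFreeRes3_of_matrices hf hF hdeg ((mem_coneIdeal_of_isHomogeneous hf).mpr hz)
    (by omega) (fun v => mem_embIdeal) h ((finCongr (by ring)).trans finSumFinEquiv.symm)

end PlaneCubic

namespace PlaneCubic

open MvPolynomial Matrix

/-- Functions given by polynomials. -/
def IsPolyFun {σ K : Type*} [CommRing K] (φ : (σ → K) → K) : Prop :=
  ∃ P : MvPolynomial σ K, ∀ x, eval x P = φ x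

namespace IsPolyFun

variable {σ τ K : Type*} [Field K] {φ ψ : (σ → K) → K}

theorem const (c : K) : IsPolyFun fun _ : σ → K => c := ⟨C c, fun _ => eval_C _⟩

theorem coord (i : σ) : IsPolyFun fun x : σ → K => x i := ⟨X i, fun _ => eval_X _⟩

theorem add (h : IsPolyFun φ) (h' : IsPolyFun ψ) : IsPolyFun fun x => φ x + ψ x := by
  obtain ⟨P, hP⟩ := h
  obtain ⟨Q, hQ⟩ := h'
  exact ⟨P + Q, fun x => by simp [hP, hQ]⟩

theorem mul (h : IsPolyFun φ) (h' : IsPolyFun ψ) : IsPolyFun fun x => φ x * ψ x := by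
  obtain ⟨P, hP⟩ := h
  obtain ⟨Q, hQ⟩ := h'
  exact ⟨P * Q, fun x => by simp [hP, hQ]⟩

theorem sub (h : IsPolyFun φ) (h' : IsPolyFun ψ) : IsPolyFun fun x => φ x - ψ x := by
  obtain ⟨P, hP⟩ := h
  obtain ⟨Q, hQ⟩ := h'
  exact ⟨P - Q, fun x => by simp [hP, hQ]⟩

theorem neg (h : IsPolyFun φ) : IsPolyFun fun x => -φ x := by
  obtain ⟨P, hP⟩ := h
  exact ⟨-P, fun x => by simp [hP]⟩

theorem pow (h : IsPolyFun φ) (n : ℕ) : IsPolyFun fun x => φ x ^ n := by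
  obtain ⟨P, hP⟩ := h
  exact ⟨P ^ n, fun x => by simp [hP]⟩

theorem sum {ι : Type*} (s : Finset ι) {φ : ι → (σ → K) → K} (h : ∀ i ∈ s, IsPolyFun (φ i)) :
    IsPolyFun fun x => ∑ i ∈ s, φ i x := by
  choose! P hP using h
  exact ⟨∑ i ∈ s, P i, fun x => by
    rw [map_sum]; exact Finset.sum_congr rfl fun i hi => hP i hi x⟩

theorem prod {ι : Type*} (s : Finset ι) {φ : ι → (σ → K) → K} (h : ∀ i ∈ s, IsPolyFun (φ i)) :
    IsPolyFun fun x => ∏ i ∈ s, φ i x := by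
  choose! P hP using h
  exact ⟨∏ i ∈ s, P i, fun x => by
    rw [map_prod]; exact Finset.prod_congr rfl fun i hi => hP i hi x⟩

theorem comp {φ : (τ → K) → K} (h : IsPolyFun φ) {y : (σ → K) → τ → K}
    (hy : ∀ t, IsPolyFun fun x => y x t) : IsPolyFun fun x => φ (y x) := by
  obtain ⟨P, hP⟩ := h
  choose Q hQ using hy
  refine ⟨bind₁ Q P, fun x => ?_⟩
  change _ = φ (y x)
  rw [← hP, ← aeval_eq_eval, ← aeval_eq_eval, aeval_bind₁]
  congr 2
  funext t
  rw [aeval_eq_eval]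
  exact hQ t x

theorem evalAt (p : MvPolynomial τ K) {y : (σ → K) → τ → K}
    (hy : ∀ t, IsPolyFun fun x => y x t) : IsPolyFun fun x => eval (y x) p :=
  comp ⟨p, fun _ => rfl⟩ hy

theorem det {n : Type*} [Fintype n] [DecidableEq n] {M : (σ → K) → Matrix n n K}
    (h : ∀ i j, IsPolyFun fun x => M x i j) : IsPolyFun fun x => (M x).det := by
  simp only [det_apply']
  exact sum _ fun p _ => (const _).mul (prod _ fun i _ => h _ _)

theorem adjugate {n : Type*} [Fintype n] [DecidableEq n] {M : (σ → K) → Matrix n n K}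
    (h : ∀ i j, IsPolyFun fun x => M x i j) (i j : n) :
    IsPolyFun fun x => (M x).adjugate i j := by
  simp only [adjugate_apply]
  refine det fun i' j' => ?_
  by_cases hi : i' = j
  · simp only [hi, updateRow_self]; exact const _
  · simp only [updateRow_ne hi]; exact h _ _

theorem mulVec {m n : Type*} [Fintype n] {M : (σ → K) → Matrix m n K}
    (h : ∀ i j, IsPolyFun fun x => M x i j) {v : (σ → K) → n → K}
    (hv : ∀ j, IsPolyFun fun x => v x j) (i : m) : IsPolyFun fun x => (M x *ᵥ v x) i :=
  sum _ fun j _ => (h i j).mul (hv j)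

theorem linearMap {n V : Type*} [Fintype n] [AddCommGroup V] [Module K V]
    (G : (n → K) →ₗ[K] V) (l : V →ₗ[K] K) {v : (σ → K) → n → K}
    (hv : ∀ j, IsPolyFun fun x => v x j) : IsPolyFun fun x => l (G (v x)) := by
  classical
  have : ∀ x, l (G (v x)) = ∑ j, v x j * l (G (Pi.single j 1)) := fun x => by
    conv_lhs => rw [pi_eq_sum_univ (v x)]
    simp only [map_sum, map_smul, smul_eq_mul]
    refine Finset.sum_congr rfl fun j _ => ?_
    congr 3
    funext i
    simp [Pi.single_apply, eq_comm]
  simp only [this]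
  exact sum _ fun j _ => (hv j).mul (const _)

/-- Injectivity of a polynomial family of linear maps is an open condition. -/
theorem exists_of_injective {n V : Type*} [Fintype n] [AddCommGroup V] [Module K V]
    [FiniteDimensional K V] {L : (σ → K) → V →ₗ[K] (n → K)}
    (h : ∀ v j, IsPolyFun fun x => L x v j) {x₀ : σ → K} (h₀ : Function.Injective (L x₀)) :
    ∃ P : MvPolynomial σ K, eval x₀ P ≠ 0 ∧ ∀ x, eval x P ≠ 0 → Function.Injective (L x) := by
  obtain ⟨G, hG⟩ := (L x₀).exists_leftInverse_of_injective (LinearMap.ker_eq_bot.mpr h₀)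
  let b := Module.finBasis K V
  have hpoly : IsPolyFun fun x => (LinearMap.toMatrix b b (G ∘ₗ L x)).det := det fun i j => by
    simp only [LinearMap.toMatrix_apply, LinearMap.comp_apply]
    exact linearMap G (b.coord i) fun t => h _ t
  obtain ⟨P, hP⟩ := hpoly
  refine ⟨P, ?_, fun x hx => ?_⟩
  · rw [hP]; beta_reduce; rw [hG]; simp
  · rw [hP] at hx; beta_reduce at hx; rw [LinearMap.det_toMatrix] at hx
    have : Function.Injective (G ∘ₗ L x) :=
      (LinearEquiv.ofIsUnitDet (f := G ∘ₗ L x) (v := b) (v' := b) (by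
        rw [LinearMap.det_toMatrix]; exact hx.isUnit)).injective
    exact Function.Injective.of_comp (by simpa using this)

theorem exists_ne_zero [Infinite K] {ι : Type*} (s : Finset ι) {φ : ι → (σ → K) → K}
    (h : ∀ i ∈ s, IsPolyFun (φ i)) (hne : ∀ i ∈ s, ∃ x, φ i x ≠ 0) :
    ∃ x, ∀ i ∈ s, φ i x ≠ 0 := by
  choose! P hP using h
  have h0 : ∏ i ∈ s, P i ≠ 0 := Finset.prod_ne_zero_iff.mpr fun i hi h0 => by
    obtain ⟨x, hx⟩ := hne i hi
    exact hx (by rw [← hP i hi, h0, map_zero])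
  obtain ⟨x, hx⟩ : ∃ x, eval x (∏ i ∈ s, P i) ≠ 0 := by
    by_contra! hc
    exact h0 (MvPolynomial.funext fun x => by rw [hc, map_zero])
  rw [map_prod] at hx
  exact ⟨x, fun i hi => by rw [← hP i hi]; exact Finset.prod_ne_zero_iff.mp hx i hi⟩

end IsPolyFun

/-- A polynomial that is not a multiple of an irreducible polynomial `f` is nonzero somewhere on
the zero locus of `f`. -/
theorem exists_eval_ne_zero_of_irreducible {σ K : Type*} [Finite σ] [Field K] [IsAlgClosed K]
    {f p : MvPolynomial σ K} (hf : Irreducible f) (hp : ¬ f ∣ p) :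
    ∃ v : σ → K, eval v f = 0 ∧ eval v p ≠ 0 := by
  by_contra! hc
  have hprime : (Ideal.span {f}).IsPrime :=
    (Ideal.span_singleton_prime hf.ne_zero).mpr hf.prime
  have h1 : p ∈ (Ideal.span {f}).radical := by
    rw [← vanishingIdeal_zeroLocus_eq_radical (K := K)]
    intro v hv
    rw [aeval_eq_eval]
    refine hc v ?_
    have := hv f (Ideal.subset_span rfl)
    rwa [aeval_eq_eval] at this
  rw [hprime.radical, Ideal.mem_span_singleton] at h1
  exact hp h1

end PlaneCubic

namespace PlaneCubic

open MvPolynomial Matrix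

section

variable {K : Type*} [Field K] {ι : Type*} {m n p : ℕ}

/-- Substitution of linear forms for the variables. -/
noncomputable def linSub (A : Matrix (Fin m) (Fin n) K) :
    MvPolynomial (Fin m) K →ₐ[K] MvPolynomial (Fin n) K :=
  aeval fun i => ∑ j, C (A i j) * X j

theorem linSub_X (A : Matrix (Fin m) (Fin n) K) (i : Fin m) :
    linSub A (X i) = ∑ j, C (A i j) * X j := aeval_X _ _

theorem eval_linSub (A : Matrix (Fin m) (Fin n) K) (v : Fin n → K) (q : MvPolynomial (Fin m) K) :
    eval v (linSub A q) = eval (A *ᵥ v) q := by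
  have : (aeval v).comp (linSub A) = aeval (A *ᵥ v) := MvPolynomial.algHom_ext fun i => by
    simp [linSub_X, mulVec, dotProduct, aeval_eq_eval]
  rw [← aeval_eq_eval, ← aeval_eq_eval]
  exact DFunLike.congr_fun this q

theorem linSub_linSub (A : Matrix (Fin m) (Fin n) K) (B : Matrix (Fin n) (Fin p) K)
    (q : MvPolynomial (Fin m) K) : linSub B (linSub A q) = linSub (A * B) q := by
  rw [← AlgHom.comp_apply]
  congr 1
  refine MvPolynomial.algHom_ext fun i => ?_
  simp only [AlgHom.comp_apply, linSub_X, map_sum, map_mul, Matrix.mul_apply, Finset.sum_mul,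
    Finset.mul_sum]
  rw [Finset.sum_comm]
  refine Finset.sum_congr rfl fun j _ => Finset.sum_congr rfl fun l _ => ?_
  rw [linSub, algHom_C, algebraMap_eq, mul_assoc]

theorem linSub_one (q : MvPolynomial (Fin n) K) : linSub (1 : Matrix (Fin n) (Fin n) K) q = q := by
  conv_rhs => rw [← AlgHom.id_apply (R := K) q]
  congr 1
  refine MvPolynomial.algHom_ext fun i => ?_
  simp [linSub_X, Matrix.one_apply, ite_mul]

theorem isHomogeneous_linForm (c : Fin n → K) :
    (∑ j, C (c j) * X j : MvPolynomial (Fin n) K).IsHomogeneous 1 :=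
  IsHomogeneous.sum _ _ _ fun j _ => by
    simpa using (isHomogeneous_C _ (c j)).mul (isHomogeneous_X K j)

theorem isHomogeneous_linSub (A : Matrix (Fin m) (Fin n) K) {q : MvPolynomial (Fin m) K} {d : ℕ}
    (hq : q.IsHomogeneous d) : (linSub A q).IsHomogeneous d := by
  have := IsHomogeneous.aeval (R := K) hq (fun i => ∑ j, C (A i j) * X j)
    (fun i => isHomogeneous_linForm (A i))
  rwa [one_mul] at this

theorem linSub_cancel {A B : Matrix (Fin n) (Fin n) K} (h : A * B = 1)
    (q : MvPolynomial (Fin n) K) : linSub B (linSub A q) = q := by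
  rw [linSub_linSub, h, linSub_one]

theorem eigenRigid_linSub {A B : Matrix (Fin n) (Fin n) K} (h : A * B = 1)
    {f : MvPolynomial (Fin n) K} {d : ℕ} {z : ι → Fin n → K} (hN : EigenRigid (linSub A f) d z) :
    EigenRigid f d fun s => A *ᵥ z s := by
  have h' : B * A = 1 := mul_eq_one_comm.mp h
  intro q hq hq'
  obtain ⟨g, hg⟩ := hN (fun i => ∑ j, C (B i j) * linSub A (q j))
    (fun i => IsHomogeneous.sum _ _ _ fun j _ => by
      simpa using (isHomogeneous_C _ (B i j)).mul (isHomogeneous_linSub A (hq j)))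
    (fun s => by
      obtain ⟨c, hc⟩ := hq' s
      refine ⟨c, fun i => ?_⟩
      simp only [map_sum, map_mul, eval_C, eval_linSub, hc]
      have : ∑ j, B i j * (A *ᵥ z s) j = z s i := by
        change (B *ᵥ (A *ᵥ z s)) i = _
        rw [mulVec_mulVec, h', one_mulVec]
      rw [← this, Finset.mul_sum]
      exact Finset.sum_congr rfl fun j _ => by ring)
  refine ⟨linSub B g, fun l => ?_⟩
  have h1 : linSub A f ∣ linSub A (q l) - linSub A (X l) * g := by
    have e : linSub A (q l) - linSub A (X l) * g =
        ∑ i, C (A l i) * ((∑ j, C (B i j) * linSub A (q j)) - X i * g) := by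
      simp only [mul_sub, Finset.sum_sub_distrib, linSub_X, Finset.sum_mul, mul_assoc]
      congr 1
      simp only [Finset.mul_sum]
      rw [Finset.sum_comm]
      have : ∀ j, ∑ i, C (A l i) * (C (B i j) * linSub A (q j)) =
          C ((A * B) l j) * linSub A (q j) := fun j => by
        simp only [Matrix.mul_apply, map_sum, map_mul, Finset.sum_mul, mul_assoc]
      simp only [this, h, Matrix.one_apply]
      rw [Finset.sum_eq_single l (fun b _ hb => by simp [hb.symm]) (by simp)]
      simp
    rw [e]
    exact Finset.dvd_sum fun i _ => Dvd.dvd.mul_left (hg i) _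
  have h2 := map_dvd (linSub B) h1
  simpa only [map_sub, map_mul, linSub_cancel h] using h2

theorem eigenRigid_linSub_iff {A B : Matrix (Fin n) (Fin n) K} (h : A * B = 1)
    {f : MvPolynomial (Fin n) K} {d : ℕ} {z : ι → Fin n → K} :
    EigenRigid (linSub A f) d (fun s => B *ᵥ z s) ↔ EigenRigid f d z := by
  refine ⟨fun hN => ?_, fun hN => eigenRigid_linSub (mul_eq_one_comm.mp h) ?_⟩
  · have := eigenRigid_linSub h hN
    simpa only [mulVec_mulVec, h, one_mulVec] using this
  · rwa [linSub_cancel h]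

theorem eigenRigid_C_mul {f : MvPolynomial (Fin n) K} {c : K} (hc : c ≠ 0) {d : ℕ}
    {z : ι → Fin n → K} : EigenRigid (C c * f) d z ↔ EigenRigid f d z := by
  have hu : IsUnit (C c : MvPolynomial (Fin n) K) := hc.isUnit.map C
  simp only [EigenRigid, hu.mul_left_dvd]

theorem mem_coneIdeal_linSub {A : Matrix (Fin m) (Fin n) K} {z : ι → Fin n → K}
    {q : MvPolynomial (Fin m) K} :
    linSub A q ∈ coneIdeal z ↔ q ∈ coneIdeal fun s => A *ᵥ z s := by
  simp only [mem_coneIdeal, eval_linSub, mulVec_smul]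

theorem exists_matrix {κ : Type*} [Finite κ] {u w : κ → Fin n → K} (hu : LinearIndependent K u)
    (hw : LinearIndependent K w) : ∃ A : Matrix (Fin n) (Fin n) K, A.det ≠ 0 ∧
      ∀ i, A *ᵥ w i = u i := by
  let e := hw.linearCombinationEquiv.symm ≪≫ₗ hu.linearCombinationEquiv
  obtain ⟨g, hg⟩ := Submodule.exists_linearEquiv_restrict_eq e
  refine ⟨LinearMap.toMatrix' g.toLinearMap, ?_, fun i => ?_⟩
  · rw [LinearMap.det_toMatrix']
    exact g.isUnit_det'.ne_zero
  · have h1 := hg ⟨w i, Submodule.subset_span ⟨i, rfl⟩⟩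
    have h2 : hw.linearCombinationEquiv.symm ⟨w i, Submodule.subset_span ⟨i, rfl⟩⟩ =
        Finsupp.single i 1 := by
      rw [LinearEquiv.symm_apply_eq]
      ext; simp
    rw [← Matrix.toLin'_apply, Matrix.toLin'_toMatrix']
    simp only [e, LinearEquiv.trans_apply, h2] at h1
    simpa using h1.symm

end

section

variable {k : Type} [Field k]

theorem entryOk_linSub (A : Matrix (Fin 4) (Fin 4) k) {d e : ℕ} {q : R4 k} (h : EntryOk k d e q) :
    EntryOk k d e (linSub A q) := by
  obtain ⟨h1, h2⟩ := h
  have h3 : coeff 0 (linSub A q) = coeff 0 q := by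
    have := eval_linSub A 0 q
    rwa [mulVec_zero, eval_zero, constantCoeff_eq] at this
  refine ⟨?_, by rw [h3, h2]⟩
  rcases h1 with rfl | ⟨c, hc, hq⟩
  · exact Or.inl (map_zero _)
  · exact Or.inr ⟨c, hc, isHomogeneous_linSub A hq⟩

theorem hasMinFreeRes3_linSub {A B : Matrix (Fin 4) (Fin 4) k} (h : A * B = 1) {I J : Ideal (R4 k)}
    (hIJ : ∀ q, q ∈ I ↔ linSub A q ∈ J) {n1 n2 n3 : ℕ} {d1 : Fin n1 → ℕ} {d2 : Fin n2 → ℕ}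
    {d3 : Fin n3 → ℕ} (hJ : HasMinFreeRes3 k ⊥ J d1 d2 d3) : HasMinFreeRes3 k ⊥ I d1 d2 d3 := by
  have h' : B * A = 1 := mul_eq_one_comm.mp h
  have c1 : ∀ q, linSub B (linSub A q) = q := linSub_cancel h
  have c2 : ∀ q, linSub A (linSub B q) = q := linSub_cancel h'
  have inj : Function.Injective (linSub A) := Function.LeftInverse.injective c1
  obtain ⟨g, M2, M3, hg, hI, hM2, hM3, e1, e2, e3⟩ := hJ
  refine ⟨fun j => linSub B (g j), fun i j => linSub B (M2 i j), fun i j => linSub B (M3 i j),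
    fun j => ⟨?_, isHomogeneous_linSub B (hg j).2⟩, fun x hx => ?_,
    fun i j => entryOk_linSub B (hM2 i j), fun i j => entryOk_linSub B (hM3 i j),
    fun w => ?_, fun u => ?_, fun t ht => ?_⟩
  · rw [hIJ, c2]; exact (hg j).1
  · obtain ⟨w, hw⟩ := hI _ ((hIJ x).mp hx)
    refine ⟨fun j => linSub B (w j), ?_⟩
    rw [Ideal.mem_bot] at hw ⊢
    have := congrArg (linSub B) hw
    simpa only [map_sub, map_sum, map_mul, c1, map_zero] using this
  · have := e1 fun j => linSub A (w j)
    rw [Ideal.mem_bot] at this ⊢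
    have l1 : ∑ j, w j * linSub B (g j) = 0 ↔ ∑ j, linSub A (w j) * g j = 0 := by
      rw [← inj.eq_iff]; simp only [map_sum, map_mul, c2, map_zero]
    rw [l1, this]
    constructor
    · rintro ⟨u, hu⟩
      exact ⟨fun i => linSub B (u i), fun j => inj (by simp only [hu, map_sum, map_mul, c2])⟩
    · rintro ⟨u, hu⟩
      exact ⟨fun i => linSub A (u i), fun j => by simp only [hu, map_sum, map_mul, c2]⟩
  · have := e2 fun i => linSub A (u i)
    have l1 : ∀ j, ∑ i, u i * linSub B (M2 i j) = 0 ↔ ∑ i, linSub A (u i) * M2 i j = 0 :=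
      fun j => by rw [← inj.eq_iff]; simp only [map_sum, map_mul, c2, map_zero]
    simp only [l1, this]
    constructor
    · rintro ⟨u, hu⟩
      exact ⟨fun i => linSub B (u i), fun j => inj (by simp only [hu, map_sum, map_mul, c2])⟩
    · rintro ⟨u, hu⟩
      exact ⟨fun i => linSub A (u i), fun j => by simp only [hu, map_sum, map_mul, c2]⟩
  · have := e3 (fun i => linSub A (t i)) fun j => by
      have := congrArg (linSub A) (ht j)
      simpa only [map_sum, map_mul, c2, map_zero] using this
    funext i
    exact inj (by simpa using congrFun this i)

theorem finSuccEquiv_monic {f : MvPolynomial (Fin 4) k} (hf : f.IsHomogeneous 3)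
    (h1 : eval (Pi.single 0 1) f = 1) :
    (finSuccEquiv k 3 f).Monic ∧ (finSuccEquiv k 3 f).natDegree = 3 := by
  have hhom : ∀ i, i ≤ 3 → ((finSuccEquiv k 3 f).coeff i).IsHomogeneous (3 - i) := fun i hi =>
    hf.finSuccEquiv_coeff_isHomogeneous i (3 - i) (by omega)
  have hdeg : (finSuccEquiv k 3 f).natDegree ≤ 3 := by
    rw [natDegree_finSuccEquiv]
    exact (degreeOf_le_totalDegree f 0).trans hf.totalDegree_le
  have hz : ∀ i, i < 3 → eval 0 ((finSuccEquiv k 3 f).coeff i) = 0 := fun i hi => by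
    rw [eval_zero, constantCoeff_eq]
    by_contra hne
    have := hhom i hi.le hne
    simp only [map_zero] at this
    omega
  have hc3 : (finSuccEquiv k 3 f).coeff 3 = 1 := by
    have e := eval_eq_eval_mv_eval' (0 : Fin 3 → k) 1 f
    have e1 : (Fin.cons 1 (0 : Fin 3 → k) : Fin 4 → k) = Pi.single 0 1 := by
      funext i; refine Fin.cases ?_ (fun i => ?_) i <;> simp
    rw [e1, h1, Polynomial.eval_eq_sum_range'
      (n := 4) (Nat.lt_succ_of_le (Polynomial.natDegree_map_le.trans hdeg))] at e
    simp only [Finset.sum_range_succ, Finset.sum_range_zero, Polynomial.coeff_map, one_pow,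
      mul_one, hz 0 (by omega), hz 1 (by omega), hz 2 (by omega), zero_add] at e
    rw [HomW.eq_C (HomW.iff_isHomogeneous.mpr (hhom 3 le_rfl))] at e ⊢
    rw [eval_C] at e
    rw [← e, C_1]
  have hd : (finSuccEquiv k 3 f).natDegree = 3 :=
    le_antisymm hdeg (Polynomial.le_natDegree_of_ne_zero (by rw [hc3]; exact one_ne_zero))
  exact ⟨by rw [Polynomial.Monic, Polynomial.leadingCoeff, hd, hc3], hd⟩

theorem hasMinFreeRes3_of_eigenRigid [Infinite k] {ι : Type*} [Fintype ι] {f : R4 k}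
    (hf : f.IsHomogeneous 3) (hf0 : f ≠ 0) {z : ι → Fin 4 → k} (hz0 : ∀ s, z s ≠ 0)
    (hz : ∀ s, eval (z s) f = 0) {a : ℕ} (ha : 3 ≤ a)
    (hcard : Fintype.card ι = 3 * (a * (a - 1) / 2) + a) (hN : EigenRigid f (a - 1) z) :
    HasMinFreeRes3 k ⊥ (coneIdeal z)
      (Fin.append (fun _ : Fin (2 * a + 1) => a) (fun _ : Fin 1 => 3))
      (fun _ : Fin (3 * a) => a + 1) (fun _ : Fin (a - 1) => a + 3) := by
  obtain ⟨A, hA, hAf, hAz⟩ : ∃ A : Matrix (Fin 4) (Fin 4) k, A.det ≠ 0 ∧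
      eval (A *ᵥ Pi.single 0 1) f ≠ 0 ∧ ∀ s, (A.adjugate *ᵥ z s) 1 ≠ 0 := by
    let M : (Fin 4 × Fin 4 → k) → Matrix (Fin 4) (Fin 4) k := fun x => of fun i j => x (i, j)
    have hM : ∀ i j, IsPolyFun fun x => M x i j := fun i j => IsPolyFun.coord (i, j)
    have hsurj : ∀ A, M (fun q => A q.1 q.2) = A := fun A => rfl
    obtain ⟨x, hx⟩ := IsPolyFun.exists_ne_zero (Finset.univ : Finset (ι ⊕ Bool))
      (φ := Sum.elim (fun s x => ((M x).adjugate *ᵥ z s) 1)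
        (fun b x => if b then (M x).det else eval (M x *ᵥ Pi.single 0 1) f))
      (by
        rintro (s | b) -
        · exact IsPolyFun.mulVec (v := fun _ => z s) (IsPolyFun.adjugate hM)
            (fun j => IsPolyFun.const _) _
        · cases b
          · exact IsPolyFun.evalAt f fun i => IsPolyFun.mulVec (v := fun _ => Pi.single 0 1) hM
              (fun j => IsPolyFun.const _) _
          · exact IsPolyFun.det hM)
      (by
        rintro (s | b) -
        · obtain ⟨A, hA, hAz⟩ := exists_matrix (κ := Unit) (u := fun _ => z s)
            (w := fun _ => Pi.single 1 1) (LinearIndependent.of_subsingleton () (hz0 s))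
            (LinearIndependent.of_subsingleton () (by simp))
          refine ⟨fun q => A q.1 q.2, ?_⟩
          rw [Sum.elim_inl, hsurj, ← hAz (), mulVec_mulVec, adjugate_mul, smul_mulVec, one_mulVec]
          simpa using hA
        · cases b
          · obtain ⟨v, hv⟩ : ∃ v, eval v f ≠ 0 := by
              by_contra! hc
              exact hf0 (MvPolynomial.funext fun x => by rw [hc, map_zero])
            refine ⟨fun q => v q.1, ?_⟩
            have : M (fun q => v q.1) *ᵥ Pi.single 0 1 = v := by
              funext i; simp [M]
            change eval (M (fun q => v q.1) *ᵥ Pi.single 0 1) f ≠ 0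
            rwa [this]
          · exact ⟨fun q => (1 : Matrix (Fin 4) (Fin 4) k) q.1 q.2, by simp [hsurj]⟩)
    refine ⟨M x, by simpa using hx (Sum.inr true) (Finset.mem_univ _),
      by simpa using hx (Sum.inr false) (Finset.mem_univ _), fun s => ?_⟩
    simpa using hx (Sum.inl s) (Finset.mem_univ _)
  set B := A.det⁻¹ • A.adjugate with hB
  have hAB : A * B = 1 := by
    rw [hB, mul_smul_comm, mul_adjugate, smul_smul, inv_mul_cancel₀ hA, one_smul]
  set c := eval (A *ᵥ Pi.single 0 1) f
  have hf' : (C c⁻¹ * linSub A f).IsHomogeneous 3 := by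
    simpa using (isHomogeneous_C _ c⁻¹).mul (isHomogeneous_linSub A hf)
  obtain ⟨hF, hdeg⟩ := finSuccEquiv_monic hf' (by
    rw [map_mul, eval_C, eval_linSub]; exact inv_mul_cancel₀ hAf)
  refine hasMinFreeRes3_linSub hAB (J := coneIdeal fun s => B *ᵥ z s) (fun q => ?_)
    (hasMinFreeRes3_coneIdeal hf' hF hdeg (fun s => ?_) (fun s => ?_) ha hcard ?_)
  · rw [mem_coneIdeal_linSub]; simp only [mulVec_mulVec, hAB, one_mulVec]
  · rw [map_mul, eval_linSub, mulVec_mulVec, hAB, one_mulVec, hz, mul_zero]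
  · rw [hB, smul_mulVec, Pi.smul_apply, smul_eq_mul]
    exact mul_ne_zero (inv_ne_zero hA) (hAz s)
  · rw [eigenRigid_C_mul (inv_ne_zero hAf), eigenRigid_linSub_iff hAB]
    exact hN

end

end PlaneCubic

namespace MvPolynomial

variable {σ K : Type*} [CommRing K]

/-- The part of `c` contributing to degree `j` in a product with a form of degree `i`. -/
noncomputable def shiftComponent (i j : ℕ) (c : MvPolynomial σ K) : MvPolynomial σ K :=
  if i ≤ j then homogeneousComponent (j - i) c else 0

theorem homW_shiftComponent (i j : ℕ) (c : MvPolynomial σ K) : HomW (shiftComponent i j c) i j := by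
  rw [shiftComponent]
  split_ifs with h
  · exact (HomW.iff_isHomogeneous.mpr (homogeneousComponent_isHomogeneous (j - i) c)).congr
      (by omega)
  · exact HomW.zero

theorem homogeneousComponent_mul {P : MvPolynomial σ K} {i : ℕ} (hP : P.IsHomogeneous i) (j : ℕ)
    (c : MvPolynomial σ K) :
    homogeneousComponent j (P * c) = P * shiftComponent i j c := by
  classical
  let _ : GradedAlgebra (homogeneousSubmodule σ K) := gradedAlgebra
  have key := DirectSum.coe_decompose_mul_of_left_mem (𝒜 := homogeneousSubmodule σ K) (b := c) j
    (i := i) (a := P) (by simpa using hP)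
  rw [shiftComponent]
  have e : ∀ (q : MvPolynomial σ K) (l : ℕ),
      ((DirectSum.decompose (homogeneousSubmodule σ K) q) l : MvPolynomial σ K) =
        homogeneousComponent l q := fun q l => decomposition.decompose'_apply q l
  rw [e, e] at key
  rw [key]
  split_ifs <;> simp

theorem exists_homW_of_eq_add {F P Q c c' : MvPolynomial σ K} {i i' j : ℕ}
    (hF : F.IsHomogeneous j) (hP : P.IsHomogeneous i) (hQ : Q.IsHomogeneous i')
    (h : F = P * c + Q * c') : ∃ b b', F = P * b + Q * b' ∧ HomW b i j ∧ HomW b' i' j := by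
  refine ⟨shiftComponent i j c, shiftComponent i' j c', ?_, homW_shiftComponent i j c,
    homW_shiftComponent i' j c'⟩
  rw [← homogeneousComponent_mul hP, ← homogeneousComponent_mul hQ, ← map_add, ← h,
    homogeneousComponent_eq_self hF]

theorem exists_homW_of_dvd {F P : MvPolynomial σ K} {i j : ℕ}
    (hF : F.IsHomogeneous j) (hP : P.IsHomogeneous i) (h : P ∣ F) : ∃ b, F = P * b ∧ HomW b i j := by
  obtain ⟨c, rfl⟩ := h
  obtain ⟨b, b', hb, hb', -⟩ := exists_homW_of_eq_add (c := c) (c' := 0) (Q := 0) hF hP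
    (isHomogeneous_zero σ K 0) (by ring)
  exact ⟨b, by rw [hb, zero_mul, add_zero], hb'⟩

theorem eq_zero_of_dvd_of_lt {F P : MvPolynomial σ K} {i j : ℕ}
    (hF : F.IsHomogeneous j) (hP : P.IsHomogeneous i) (h : P ∣ F) (hij : j < i) : F = 0 := by
  obtain ⟨b, hb, hb'⟩ := exists_homW_of_dvd hF hP h
  rw [hb, hb'.eq_zero_of_lt hij, mul_zero]

theorem sub_aeval_mem_span (g : σ → MvPolynomial σ K) (p : MvPolynomial σ K) :
    p - aeval g p ∈ Ideal.span (Set.range fun i => X i - g i) := by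
  set I := Ideal.span (Set.range fun i => X i - g i)
  rw [← Ideal.Quotient.mk_eq_mk_iff_sub_mem]
  have : (Ideal.Quotient.mkₐ K I) = (Ideal.Quotient.mkₐ K I).comp (aeval g) :=
    algHom_ext fun i => by
      simp only [AlgHom.comp_apply, aeval_X]
      exact (Ideal.Quotient.mk_eq_mk_iff_sub_mem _ _).mpr (Ideal.subset_span ⟨i, rfl⟩)
  exact DFunLike.congr_fun this p

end MvPolynomial

namespace PlaneCubic

open MvPolynomial Matrix

variable {K : Type*} [Field K]

/-- A line of the plane not passing through the point `(0, 0, 1)`. -/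
noncomputable def line (α β : K) : MvPolynomial (Fin 3) K := X 2 - C α * X 0 - C β * X 1

/-- A linear form vanishing at `linePt α β r`. -/
noncomputable def cutForm (r : K) : MvPolynomial (Fin 3) K := X 1 - C r * X 0

/-- The affine points of `line α β`. -/
def linePt (α β r : K) : Fin 3 → K := ![1, r, α + β * r]

theorem eval_line (α β : K) (v : Fin 3 → K) : eval v (line α β) = v 2 - α * v 0 - β * v 1 := by
  simp [line]

theorem eval_line_linePt (α β r : K) : eval (linePt α β r) (line α β) = 0 := by
  simp [eval_line, linePt]

theorem isHomogeneous_line (α β : K) : (line α β).IsHomogeneous 1 := by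
  have h := isHomogeneous_linForm ![-α, -β, 1]
  rw [Fin.sum_univ_three] at h
  convert h using 1
  simp [line]; ring

theorem isHomogeneous_cutForm (r : K) : (cutForm r).IsHomogeneous 1 := by
  have h := isHomogeneous_linForm ![-r, 1, 0]
  rw [Fin.sum_univ_three] at h
  convert h using 1
  simp [cutForm]; ring

theorem exists_eq_line_add_cutForm [Infinite K] {α β r : K} {p : MvPolynomial (Fin 3) K}
    (hp : ∀ c : K, c ≠ 0 → eval (c • linePt α β r) p = 0) :
    ∃ A B, p = line α β * A + cutForm r * B := by
  let g : Fin 3 → MvPolynomial (Fin 3) K := ![X 0, C r * X 0, C (α + β * r) * X 0]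
  have h0 : aeval g p = 0 := by
    have : X 0 * aeval g p = 0 := MvPolynomial.funext fun v => by
      rw [map_mul, eval_X, map_zero]
      by_cases hv : v 0 = 0
      · rw [hv, zero_mul]
      · have e : eval v (aeval g p) = eval (v 0 • linePt α β r) p := by
          have : (aeval v).comp (aeval g) = aeval (v 0 • linePt α β r) :=
            MvPolynomial.algHom_ext fun i => by
              fin_cases i <;> simp [g, linePt, aeval_eq_eval, mul_comm]
          rw [← aeval_eq_eval, ← aeval_eq_eval]
          exact DFunLike.congr_fun this p
        rw [e, hp _ hv, mul_zero]
    exact (mul_eq_zero.mp this).resolve_left (X_ne_zero 0)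
  have h1 := sub_aeval_mem_span g p
  rw [h0, sub_zero] at h1
  have hle : Ideal.span (Set.range fun i => X i - g i) ≤ Ideal.span {line α β, cutForm r} := by
    rw [Ideal.span_le]
    rintro _ ⟨i, rfl⟩
    rw [SetLike.mem_coe, Ideal.mem_span_pair]
    fin_cases i
    · exact ⟨0, 0, by simp [g]⟩
    · exact ⟨0, 1, by simp [g, cutForm]⟩
    · exact ⟨1, C β, by simp [g, cutForm, line]; ring⟩
  obtain ⟨A, B, h⟩ := Ideal.mem_span_pair.mp (hle h1)
  exact ⟨A, B, by rw [← h]; ring⟩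

theorem exists_eq_line_add_prod [Infinite K] {κ : Type*} {α β : K} {r : κ → K}
    (hr : Function.Injective r) {p : MvPolynomial (Fin 3) K} (s : Finset κ)
    (hp : ∀ i ∈ s, ∀ c : K, c ≠ 0 → eval (c • linePt α β (r i)) p = 0) :
    ∃ A B, p = line α β * A + (∏ i ∈ s, cutForm (r i)) * B := by
  classical
  induction s using Finset.induction_on with
  | empty => exact ⟨0, p, by simp⟩
  | insert j s hj ih =>
    obtain ⟨A, B, h⟩ := ih fun i hi => hp i (Finset.mem_insert_of_mem hi)
    obtain ⟨A', B', h'⟩ := exists_eq_line_add_cutForm (α := α) (β := β) (r := r j) (p := B)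
      fun c hc => by
        have h1 := hp j (Finset.mem_insert_self _ _) c hc
        rw [h, map_add, map_mul, eval_smul_of_isHomogeneous (isHomogeneous_line α β),
          eval_line_linePt, mul_zero, zero_mul, zero_add, map_mul] at h1
        refine (mul_eq_zero.mp h1).resolve_left ?_
        rw [map_prod]
        refine Finset.prod_ne_zero_iff.mpr fun i hi => ?_
        rw [eval_smul_of_isHomogeneous (isHomogeneous_cutForm _), pow_one]
        refine mul_ne_zero hc ?_
        simp only [cutForm, linePt, map_sub, map_mul, eval_X, eval_C]
        simp only [cons_val_zero, cons_val_one, mul_one, sub_ne_zero]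
        exact fun e => hj (hr e ▸ hi)
    refine ⟨A + (∏ i ∈ s, cutForm (r i)) * A', B', ?_⟩
    rw [Finset.prod_insert hj, h]
    conv_lhs => rw [h']
    ring

/-- A line meeting the plane curve `E` in three distinct points of the affine chart, with
parameters `r i`. -/
structure Transversal (E : MvPolynomial (Fin 3) K) (α β : K) (r : Fin 3 → K) : Prop where
  injective : Function.Injective r
  eval_ne_zero : eval ![0, 1, β] E ≠ 0
  eval_linePt : ∀ i, eval (linePt α β (r i)) E = 0

namespace Transversal

variable {E : MvPolynomial (Fin 3) K} {α β : K} {r : Fin 3 → K}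

theorem exists_eq [Infinite K] (h : Transversal E α β r) (hE : E.IsHomogeneous 3) :
    ∃ A, E = line α β * A + (∏ i, cutForm (r i)) * C (eval ![0, 1, β] E) := by
  obtain ⟨A, B, hAB⟩ := exists_eq_line_add_prod (α := α) (β := β) h.injective (p := E)
    Finset.univ fun i _ c _ => by rw [eval_smul_of_isHomogeneous hE, h.eval_linePt, mul_zero]
  have hprod : (∏ i, cutForm (r i)).IsHomogeneous 3 := by
    have := IsHomogeneous.prod Finset.univ (fun i => cutForm (r i)) (fun _ => 1)
      fun i _ => isHomogeneous_cutForm _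
    simpa using this
  obtain ⟨b, b', hb, -, hb'⟩ := exists_homW_of_eq_add hE (isHomogeneous_line α β) hprod hAB
  refine ⟨b, ?_⟩
  rw [hb'.eq_C] at hb
  have : eval ![0, 1, β] E = coeff 0 b' := by
    conv_lhs => rw [hb]
    simp [line, cutForm]
  rw [this]
  exact hb

theorem exists_param_eq [Infinite K] (h : Transversal E α β r) (hE : E.IsHomogeneous 3) {t : K}
    (ht : eval (linePt α β t) E = 0) : ∃ i, t = r i := by
  obtain ⟨A, hA⟩ := h.exists_eq hE
  rw [hA, map_add, map_mul, eval_line_linePt, zero_mul, zero_add, map_mul, eval_C, map_prod] at ht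
  have := (mul_eq_zero.mp ht).resolve_right h.eval_ne_zero
  obtain ⟨i, -, hi⟩ := Finset.prod_eq_zero_iff.mp this
  refine ⟨i, ?_⟩
  simpa [cutForm, linePt, sub_eq_zero] using hi

theorem exists_eq_of_vanishing [Infinite K] (h : Transversal E α β r) (hE : E.IsHomogeneous 3)
    {p : MvPolynomial (Fin 3) K}
    (hp : ∀ i, ∀ c : K, c ≠ 0 → eval (c • linePt α β (r i)) p = 0) :
    ∃ c p', p = E * c + line α β * p' := by
  obtain ⟨A, hA⟩ := h.exists_eq hE
  obtain ⟨A', B, hB⟩ := exists_eq_line_add_prod (α := α) (β := β) h.injective (p := p)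
    Finset.univ fun i _ => hp i
  set a := eval ![0, 1, β] E with ha
  have hca : (C a⁻¹ * C a : MvPolynomial (Fin 3) K) = 1 := by
    rw [← C_mul, inv_mul_cancel₀ h.eval_ne_zero, C_1]
  have hP : ∏ i, cutForm (r i) = C a⁻¹ * (E - line α β * A) := by
    rw [hA, add_sub_cancel_left, mul_left_comm, hca, mul_one]
  refine ⟨C a⁻¹ * B, A' - C a⁻¹ * A * B, ?_⟩
  rw [hB, hP]
  ring

end Transversal

theorem line_dvd_iff {α β : K} {p : MvPolynomial (Fin 3) K} :
    line α β ∣ p ↔ aeval ![X 0, X 1, C α * X 0 + C β * X 1] p =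
      (0 : MvPolynomial (Fin 3) K) := by
  constructor
  · rintro ⟨q, rfl⟩
    rw [map_mul, line]
    simp [algHom_C, algebraMap_eq]
  · intro h
    have h1 := sub_aeval_mem_span ![X 0, X 1, C α * X 0 + C β * X 1] p
    rw [h, sub_zero] at h1
    rw [← Ideal.mem_span_singleton]
    refine (Ideal.span_le.mpr ?_) h1
    rintro _ ⟨i, rfl⟩
    rw [SetLike.mem_coe, Ideal.mem_span_singleton]
    fin_cases i
    · simp
    · simp
    · exact ⟨1, by simp [line]; ring⟩

theorem line_dvd_mul_iff {α β : K} {p q : MvPolynomial (Fin 3) K} :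
    line α β ∣ p * q ↔ line α β ∣ p ∨ line α β ∣ q := by
  simp only [line_dvd_iff, map_mul, mul_eq_zero]

theorem line_ne_zero (α β : K) : line α β ≠ 0 := fun h => by
  have := eval_line α β ![0, 0, 1]
  rw [h] at this
  simp at this

theorem Transversal.dvd_of_dvd_mul {E : MvPolynomial (Fin 3) K} {α β : K} {r : Fin 3 → K}
    (h : Transversal E α β r) {p : MvPolynomial (Fin 3) K} (hp : E ∣ line α β * p) : E ∣ p := by
  obtain ⟨c, hc⟩ := hp
  have h1 : line α β ∣ E * c := ⟨p, hc.symm⟩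
  rcases line_dvd_mul_iff.mp h1 with ⟨q, hq⟩ | ⟨c', rfl⟩
  · refine absurd ?_ h.eval_ne_zero
    rw [hq, map_mul, eval_line]
    simp
  · refine ⟨c', mul_left_cancel₀ (line_ne_zero α β) ?_⟩
    rw [hc]; ring

end PlaneCubic

namespace MvPolynomial

variable {K : Type*} [Field K]

theorem exists_eq_X_mul_of_aeval_eq_zero {p : MvPolynomial (Fin 3) K}
    (h : aeval ![(0 : MvPolynomial (Fin 3) K), X 1, X 2] p = 0) : ∃ a, p = X 0 * a := by
  have h1 := sub_aeval_mem_span ![(0 : MvPolynomial (Fin 3) K), X 1, X 2] p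
  rw [h, sub_zero] at h1
  refine Ideal.mem_span_singleton.mp ((Ideal.span_le.mpr ?_) h1)
  rintro _ ⟨i, rfl⟩
  rw [SetLike.mem_coe, Ideal.mem_span_singleton]
  fin_cases i <;> simp

theorem exists_eq_X_mul_add_of_aeval_eq_zero {p : MvPolynomial (Fin 3) K}
    (h : aeval ![(0 : MvPolynomial (Fin 3) K), 0, X 2] p = 0) :
    ∃ a b, p = X 0 * a + X 1 * b := by
  have h1 := sub_aeval_mem_span ![(0 : MvPolynomial (Fin 3) K), 0, X 2] p
  rw [h, sub_zero] at h1
  have hle : Ideal.span (Set.range fun i => X i - ![(0 : MvPolynomial (Fin 3) K), 0, X 2] i) ≤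
      Ideal.span {X 0, X 1} := by
    rw [Ideal.span_le]
    rintro _ ⟨i, rfl⟩
    rw [SetLike.mem_coe, Ideal.mem_span_pair]
    fin_cases i
    · exact ⟨1, 0, by simp⟩
    · exact ⟨0, 1, by simp⟩
    · exact ⟨0, 0, by simp⟩
  obtain ⟨a, b, hab⟩ := Ideal.mem_span_pair.mp (hle h1)
  exact ⟨a, b, by rw [← hab]; ring⟩

/-- Exactness of the Koszul complex on three variables at the linear syzygies. -/
theorem exists_cross_eq {c : Fin 3 → MvPolynomial (Fin 3) K}
    (h : X 0 * c 0 + X 1 * c 1 + X 2 * c 2 = 0) :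
    ∃ g : Fin 3 → MvPolynomial (Fin 3) K, c 0 = g 1 * X 2 - g 2 * X 1 ∧
      c 1 = g 2 * X 0 - g 0 * X 2 ∧ c 2 = g 0 * X 1 - g 1 * X 0 := by
  obtain ⟨a, b, hab⟩ := exists_eq_X_mul_add_of_aeval_eq_zero (p := c 2) <| by
    have := congrArg (aeval ![(0 : MvPolynomial (Fin 3) K), 0, X 2]) h
    simpa [X_ne_zero] using this
  have h2 : X 0 * (c 0 + X 2 * a) + X 1 * (c 1 + X 2 * b) = 0 := by
    rw [← h, hab]; ring
  obtain ⟨e, he⟩ := exists_eq_X_mul_of_aeval_eq_zero (p := c 1 + X 2 * b) <| by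
    have := congrArg (aeval ![(0 : MvPolynomial (Fin 3) K), X 1, X 2]) h2
    simpa [X_ne_zero] using this
  have h3 : c 0 + X 2 * a + X 1 * e = 0 := by
    refine (mul_eq_zero.mp (?_ : (X 0 : MvPolynomial (Fin 3) K) * _ = 0)).resolve_left
      (X_ne_zero 0)
    rw [← h2, he]; ring
  refine ⟨![b, -a, e], ?_, ?_, ?_⟩
  · simp only [Matrix.cons_val]
    linear_combination h3
  · simp only [Matrix.cons_val]
    linear_combination he
  · simp only [Matrix.cons_val]
    linear_combination hab

theorem exists_eq_X_mul_of_cross {w : Fin 3 → MvPolynomial (Fin 3) K}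
    (h01 : w 0 * X 1 = w 1 * X 0) (h02 : w 0 * X 2 = w 2 * X 0) :
    ∃ b, ∀ i, w i = X i * b := by
  obtain ⟨b, hb⟩ := exists_eq_X_mul_of_aeval_eq_zero (p := w 0) <| by
    have := congrArg (aeval ![(0 : MvPolynomial (Fin 3) K), X 1, X 2]) h01
    simpa [X_ne_zero] using this
  have hX : (X 0 : MvPolynomial (Fin 3) K) ≠ 0 := X_ne_zero 0
  refine ⟨b, fun i => ?_⟩
  fin_cases i
  · exact hb
  · refine mul_right_cancel₀ hX (?_ : w 1 * X 0 = X 1 * b * X 0)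
    rw [← h01, hb]; ring
  · refine mul_right_cancel₀ hX (?_ : w 2 * X 0 = X 2 * b * X 0)
    rw [← h02, hb]; ring

end MvPolynomial

namespace PlaneCubic

open MvPolynomial Matrix

variable {K : Type*} [Field K]

/-- A family of transversal lines of the plane curve `E`, no two of which meet on `E`. -/
structure LineConfig (E : MvPolynomial (Fin 3) K) {κ : Type*} (α β : κ → K) (r : κ → Fin 3 → K) :
    Prop where
  transversal : ∀ j, Transversal E (α j) (β j) (r j)
  eval_ne_zero : ∀ j j', j' ≠ j → ∀ i, eval (linePt (α j) (β j) (r j i)) (line (α j') (β j')) ≠ 0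

theorem linePt_ne_zero (α β r : K) : linePt α β r ≠ 0 := fun h => by
  have := congrFun h 0
  simp [linePt] at this

theorem isHomogeneous_prod_line {κ : Type*} (α β : κ → K) (s : Finset κ) :
    (∏ j ∈ s, line (α j) (β j)).IsHomogeneous s.card := by
  have := IsHomogeneous.prod s (fun j => line (α j) (β j)) (fun _ => 1)
    fun j _ => isHomogeneous_line _ _
  simpa using this

namespace LineConfig

variable {E : MvPolynomial (Fin 3) K} {κ : Type*} {α β : κ → K} {r : κ → Fin 3 → K}

theorem dvd_of_dvd_prod_mul (h : LineConfig E α β r) (s : Finset κ) {p : MvPolynomial (Fin 3) K}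
    (hp : E ∣ (∏ j ∈ s, line (α j) (β j)) * p) : E ∣ p := by
  classical
  induction s using Finset.induction_on with
  | empty => simpa using hp
  | insert j s hj ih =>
    rw [Finset.prod_insert hj, mul_assoc] at hp
    exact ih ((h.transversal j).dvd_of_dvd_mul hp)

theorem exists_eq_prod [Infinite K] (h : LineConfig E α β r) (hE : E.IsHomogeneous 3)
    (s : Finset κ) {F : MvPolynomial (Fin 3) K}
    (hF : ∀ j ∈ s, ∀ i, ∀ c : K, c ≠ 0 → eval (c • linePt (α j) (β j) (r j i)) F = 0) :
    ∃ c F', F = E * c + (∏ j ∈ s, line (α j) (β j)) * F' := by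
  classical
  induction s using Finset.induction_on with
  | empty => exact ⟨0, F, by simp⟩
  | insert j s hj ih =>
    obtain ⟨c, F', hF'⟩ := ih fun i hi => hF i (Finset.mem_insert_of_mem hi)
    obtain ⟨c', F'', hF''⟩ := (h.transversal j).exists_eq_of_vanishing hE (p := F')
      fun i a ha => by
        have h1 := hF j (Finset.mem_insert_self _ _) i a ha
        rw [hF', map_add, map_mul, eval_smul_of_isHomogeneous hE, (h.transversal j).eval_linePt,
          mul_zero, zero_mul, zero_add, map_mul] at h1
        refine (mul_eq_zero.mp h1).resolve_left ?_
        rw [map_prod]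
        refine Finset.prod_ne_zero_iff.mpr fun j' hj' => ?_
        rw [eval_smul_of_isHomogeneous (isHomogeneous_line _ _), pow_one]
        exact mul_ne_zero ha (h.eval_ne_zero j j' (fun e => hj (e ▸ hj')) i)
    refine ⟨c + (∏ j ∈ s, line (α j) (β j)) * c', F'', ?_⟩
    rw [Finset.prod_insert hj, hF']
    conv_lhs => rw [hF'']
    ring

theorem exists_homW_eq_prod [Infinite K] (h : LineConfig E α β r) (hE : E.IsHomogeneous 3)
    (s : Finset κ) {F : MvPolynomial (Fin 3) K} {d : ℕ} (hFd : F.IsHomogeneous d)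
    (hF : ∀ j ∈ s, ∀ i, eval (linePt (α j) (β j) (r j i)) F = 0) :
    ∃ c F', F = E * c + (∏ j ∈ s, line (α j) (β j)) * F' ∧ HomW c 3 d ∧ HomW F' s.card d := by
  obtain ⟨c, F', hcF⟩ := h.exists_eq_prod hE s (F := F) fun j hj i c _ => by
    rw [eval_smul_of_isHomogeneous hFd, hF j hj i, mul_zero]
  exact exists_homW_of_eq_add hFd hE (isHomogeneous_prod_line α β s) hcF

theorem exists_eq_prod_mul_C [Infinite K] [Fintype κ] (h : LineConfig E α β r)
    (hE : E.IsHomogeneous 3) {F : MvPolynomial (Fin 3) K} (hFd : F.IsHomogeneous (Fintype.card κ))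
    (j₀ : κ) (i₀ : Fin 3)
    (hF : ∀ j i, (j, i) ≠ (j₀, i₀) → eval (linePt (α j) (β j) (r j i)) F = 0) :
    ∃ c a, F = E * c + (∏ j, line (α j) (β j)) * C a := by
  classical
  obtain ⟨c, F', hcF, -, hF'⟩ := h.exists_homW_eq_prod hE (Finset.univ.erase j₀) hFd
    fun j hj i => hF j i fun e => Finset.ne_of_mem_erase hj (congrArg Prod.fst e)
  have hcard : (Finset.univ.erase j₀).card + 1 = Fintype.card κ := by
    rw [Finset.card_erase_of_mem (Finset.mem_univ _), Finset.card_univ]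
    have : 0 < Fintype.card κ := Fintype.card_pos_iff.mpr ⟨j₀⟩
    omega
  have hF1 : F'.IsHomogeneous 1 := HomW.iff_isHomogeneous.mp (hF'.congr (by omega))
  obtain ⟨A, B, hAB⟩ := exists_eq_line_add_prod (α := α j₀) (β := β j₀)
    (h.transversal j₀).injective (p := F') (Finset.univ.erase i₀) fun i hi a ha => by
      have h1 := hF j₀ i fun e => Finset.ne_of_mem_erase hi (congrArg Prod.snd e)
      rw [hcF, map_add, map_mul, (h.transversal j₀).eval_linePt, zero_mul, zero_add, map_mul] at h1
      rw [eval_smul_of_isHomogeneous hF1, (mul_eq_zero.mp h1).resolve_left, mul_zero]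
      rw [map_prod]
      exact Finset.prod_ne_zero_iff.mpr fun j' hj' =>
        h.eval_ne_zero j₀ j' (Finset.ne_of_mem_erase hj') i
  have hprod : (∏ i ∈ Finset.univ.erase i₀, cutForm (r j₀ i)).IsHomogeneous 2 := by
    have := IsHomogeneous.prod (Finset.univ.erase i₀) (fun i => cutForm (r j₀ i)) (fun _ => 1)
      fun i _ => isHomogeneous_cutForm _
    simpa using this
  obtain ⟨b, b', hb, hb1, hb2⟩ :=
    exists_homW_of_eq_add hF1 (isHomogeneous_line _ _) hprod hAB
  rw [hb2.eq_zero_of_lt (by norm_num), mul_zero, add_zero, hb1.eq_C] at hb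
  refine ⟨c, coeff 0 b, ?_⟩
  rw [hcF, hb, ← Finset.mul_prod_erase Finset.univ _ (Finset.mem_univ j₀)]
  ring

theorem exists_eq_of_cross [Infinite K] [Fintype κ] (h : LineConfig E α β r)
    (hE : E.IsHomogeneous 3) (hE0 : E ≠ 0)
    {p : Fin 3 → MvPolynomial (Fin 3) K} (hp : ∀ i, (p i).IsHomogeneous (Fintype.card κ))
    (hv : ∀ j i l l', eval (linePt (α j) (β j) (r j i)) (p l * X l') =
      eval (linePt (α j) (β j) (r j i)) (p l' * X l)) :
    ∃ (v : Fin 3 → K) (b : MvPolynomial (Fin 3) K) (g : Fin 3 → MvPolynomial (Fin 3) K),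
      HomW b 1 (Fintype.card κ) ∧
      ∀ i, p i = (∏ j, line (α j) (β j)) * C (v i) + X i * b + E * g i := by
  set P := ∏ j, line (α j) (β j) with hPdef
  have hP : P.IsHomogeneous (Fintype.card κ) := isHomogeneous_prod_line α β Finset.univ
  have key : ∀ l l', ∃ c F', p l * X l' - p l' * X l = E * c + P * F' ∧
      HomW F' (Fintype.card κ) (Fintype.card κ + 1) := fun l l' => by
    obtain ⟨c, F', h1, -, h2⟩ := h.exists_homW_eq_prod hE Finset.univ
      (F := p l * X l' - p l' * X l) (d := Fintype.card κ + 1)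
      (((hp l).mul (isHomogeneous_X K l')).sub ((hp l').mul (isHomogeneous_X K l)))
      fun j _ i => by rw [map_sub, hv, sub_self]
    exact ⟨c, F', h1, h2⟩
  obtain ⟨c0, F0, h0, hF0⟩ := key 1 2
  obtain ⟨c1, F1, h1, hF1⟩ := key 2 0
  obtain ⟨c2, F2, h2, hF2⟩ := key 0 1
  have hsum : P * (X 0 * F0 + X 1 * F1 + X 2 * F2) + E * (X 0 * c0 + X 1 * c1 + X 2 * c2) = 0 := by
    linear_combination (-X 0) * h0 - X 1 * h1 - X 2 * h2
  have hl : X 0 * F0 + X 1 * F1 + X 2 * F2 = 0 := by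
    have hd : E ∣ X 0 * F0 + X 1 * F1 + X 2 * F2 := h.dvd_of_dvd_prod_mul Finset.univ
      ⟨-(X 0 * c0 + X 1 * c1 + X 2 * c2), by linear_combination hsum⟩
    refine eq_zero_of_dvd_of_lt (j := 2) ?_ hE hd (by norm_num)
    have hh : ∀ {F : MvPolynomial (Fin 3) K}, HomW F (Fintype.card κ) (Fintype.card κ + 1) →
        F.IsHomogeneous 1 := fun hF => HomW.iff_isHomogeneous.mp (hF.congr (by omega))
    exact (((isHomogeneous_X K 0).mul (hh hF0)).add ((isHomogeneous_X K 1).mul (hh hF1))).add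
      ((isHomogeneous_X K 2).mul (hh hF2))
  rw [hl, mul_zero, zero_add] at hsum
  obtain ⟨v, hv0, hv1, hv2⟩ := exists_cross_eq (c := ![F0, F1, F2]) hl
  obtain ⟨g, hg0, hg1, hg2⟩ := exists_cross_eq (c := ![c0, c1, c2])
    ((mul_eq_zero.mp hsum).resolve_left hE0)
  simp only [Matrix.cons_val] at hv0 hv1 hv2 hg0 hg1 hg2
  obtain ⟨b, hb⟩ := exists_eq_X_mul_of_cross (w := fun i => p i - P * v i - E * g i)
    (by linear_combination h2 + P * hv2 + E * hg2)
    (by linear_combination -h1 - P * hv1 - E * hg1)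
  refine ⟨fun i => coeff 0 (shiftComponent (Fintype.card κ) (Fintype.card κ) (v i)),
    shiftComponent 1 (Fintype.card κ) b, fun i => shiftComponent 3 (Fintype.card κ) (g i),
    homW_shiftComponent _ _ _, fun i => ?_⟩
  have h3 : p i = P * v i + X i * b + E * g i := by linear_combination hb i
  have h4 := homogeneousComponent_eq_self (hp i)
  conv_lhs at h4 => rw [h3]
  rw [map_add, map_add, homogeneousComponent_mul hP, homogeneousComponent_mul hE,
    homogeneousComponent_mul (isHomogeneous_X K i)] at h4
  rw [← h4, ← (homW_shiftComponent (Fintype.card κ) (Fintype.card κ) (v i)).eq_C]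

end LineConfig

end PlaneCubic

namespace PlaneCubic

open MvPolynomial Matrix

variable {K : Type*} [Field K] {n : ℕ}

/-- The restriction of a polynomial to the parametrized line `u + t w`. -/
noncomputable def restrict (p : MvPolynomial (Fin n) K) (u w : Fin n → K) : Polynomial K :=
  aeval (fun i => Polynomial.C (u i) + Polynomial.C (w i) * Polynomial.X) p

theorem eval_restrict (p : MvPolynomial (Fin n) K) (u w : Fin n → K) (t : K) :
    (restrict p u w).eval t = eval (u + t • w) p := by
  have : (Polynomial.aeval t).comp
      (aeval fun i => Polynomial.C (u i) + Polynomial.C (w i) * Polynomial.X) =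
      (aeval (u + t • w) : MvPolynomial (Fin n) K →ₐ[K] K) :=
    MvPolynomial.algHom_ext fun i => by
      simp only [AlgHom.comp_apply, aeval_X, map_add, map_mul, Polynomial.aeval_C,
        Polynomial.aeval_X, Pi.add_apply, Pi.smul_apply, smul_eq_mul, Algebra.algebraMap_self,
        RingHom.id_apply, mul_comm]
  have h := DFunLike.congr_fun this p
  rwa [AlgHom.comp_apply, aeval_eq_eval, Polynomial.coe_aeval_eq_eval] at h

theorem natDegree_restrict_le {p : MvPolynomial (Fin n) K} (hp : p.IsHomogeneous 3)
    (u w : Fin n → K) : (restrict p u w).natDegree ≤ 3 :=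
  MvPolynomial.aeval_natDegree_le (m := 3) (n := 1) p hp.totalDegree_le _ fun i => by
    compute_degree

theorem isPolyFun_coeff_restrict {σ : Type*} (p : MvPolynomial (Fin n) K)
    {u w : (σ → K) → Fin n → K} (hu : ∀ i, IsPolyFun fun x => u x i)
    (hw : ∀ i, IsPolyFun fun x => w x i) (m : ℕ) :
    IsPolyFun fun x => (restrict p (u x) (w x)).coeff m := by
  induction p using MvPolynomial.induction_on generalizing m with
  | C a =>
    simp only [restrict, algHom_C, Polynomial.algebraMap_eq, Polynomial.coeff_C]
    split_ifs
    · exact .const _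
    · exact .const _
  | add p q hp hq =>
    simp only [restrict, map_add, Polynomial.coeff_add] at hp hq ⊢
    exact (hp m).add (hq m)
  | mul_X p i hp =>
    simp only [restrict, map_mul, aeval_X] at hp ⊢
    simp only [mul_add, ← mul_assoc, Polynomial.coeff_add, Polynomial.coeff_mul_C]
    cases m with
    | zero =>
      simp only [Polynomial.coeff_mul_X_zero, add_zero]
      exact (hp 0).mul (hu i)
    | succ m =>
      simp only [Polynomial.coeff_mul_X, Polynomial.coeff_mul_C]
      exact ((hp _).mul (hu i)).add ((hp m).mul (hw i))

theorem restrict_eq_sum {p : MvPolynomial (Fin n) K} (hp : p.IsHomogeneous 3) (u w : Fin n → K) :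
    restrict p u w = Cubic.toPoly ⟨(restrict p u w).coeff 3, (restrict p u w).coeff 2,
      (restrict p u w).coeff 1, (restrict p u w).coeff 0⟩ := by
  conv_lhs => rw [Polynomial.as_sum_range_C_mul_X_pow' (restrict p u w)
    (Nat.lt_succ_of_le (natDegree_restrict_le hp u w))]
  simp only [Finset.sum_range_succ, Finset.sum_range_zero, Cubic.toPoly, pow_zero, pow_one]
  ring

theorem coeff_restrict_swap [Infinite K] {p : MvPolynomial (Fin n) K} (hp : p.IsHomogeneous 3)
    (u w : Fin n → K) : restrict p u w = Cubic.toPoly ⟨(restrict p w u).coeff 0,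
      (restrict p w u).coeff 1, (restrict p w u).coeff 2, (restrict p w u).coeff 3⟩ := by
  refine Polynomial.eq_of_infinite_eval_eq _ _
    (Set.Infinite.mono (fun t (ht : t ∈ ({0} : Set K)ᶜ) => ?_) (Set.finite_singleton 0).infinite_compl)
  have ht : t ≠ 0 := ht
  have h1 : u + t • w = t • (w + t⁻¹ • u) := by
    rw [smul_add, smul_smul, mul_inv_cancel₀ ht, one_smul, add_comm]
  rw [Set.mem_ofPred_eq, eval_restrict, h1, eval_smul_of_isHomogeneous hp, ← eval_restrict]
  conv_lhs => rw [restrict_eq_sum hp w u]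
  simp only [Cubic.toPoly, Polynomial.eval_add, Polynomial.eval_mul, Polynomial.eval_C,
    Polynomial.eval_pow, Polynomial.eval_X]
  field_simp
  ring

theorem coeff_zero_restrict (p : MvPolynomial (Fin n) K) (u w : Fin n → K) :
    (restrict p u w).coeff 0 = eval u p := by
  rw [Polynomial.coeff_zero_eq_eval_zero, eval_restrict, zero_smul, add_zero]

theorem coeff_one_restrict (p : MvPolynomial (Fin n) K) (u w : Fin n → K) :
    (restrict p u w).coeff 1 = ∑ i, w i * eval u (pderiv i p) := by
  induction p using MvPolynomial.induction_on with
  | C a => simp [restrict]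
  | add p q hp hq =>
    simp only [restrict, map_add, Polynomial.coeff_add, mul_add, Finset.sum_add_distrib] at hp hq ⊢
    rw [hp, hq]
  | mul_X p j hp =>
    have h0 := coeff_zero_restrict p u w
    simp only [restrict] at hp h0
    simp only [restrict, map_mul, aeval_X, mul_add, ← mul_assoc, Polynomial.coeff_add,
      Polynomial.coeff_mul_C, Polynomial.coeff_mul_X, hp, h0, pderiv_mul, map_add, eval_X,
      Finset.sum_add_distrib, Finset.sum_mul]
    congr 1
    rw [Finset.sum_eq_single j]
    · simp [mul_comm]
    · intro i _ hij
      simp [pderiv_X_of_ne hij.symm]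
    · simp

/-- A form of degree three restricted to a parametrized line, as a cubic. -/
noncomputable def restrictCubic (p : MvPolynomial (Fin n) K) (u w : Fin n → K) : Cubic K :=
  ⟨(restrict p u w).coeff 3, (restrict p u w).coeff 2, (restrict p u w).coeff 1,
    (restrict p u w).coeff 0⟩

/-- The product of the leading coefficient and the discriminant of a form of degree three
restricted to a parametrized line. -/
noncomputable def lineDisc (p : MvPolynomial (Fin n) K) (u w : Fin n → K) : K :=
  (restrictCubic p u w).a * (restrictCubic p u w).discr

theorem isPolyFun_lineDisc {σ : Type*} (p : MvPolynomial (Fin n) K)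
    {u w : (σ → K) → Fin n → K} (hu : ∀ i, IsPolyFun fun x => u x i)
    (hw : ∀ i, IsPolyFun fun x => w x i) :
    IsPolyFun fun x => lineDisc p (u x) (w x) := by
  have h := isPolyFun_coeff_restrict p hu hw
  unfold lineDisc restrictCubic Cubic.discr
  exact (h 3).mul <| ((((((h 2).pow 2).mul ((h 1).pow 2)).sub
    (((IsPolyFun.const 4).mul (h 3)).mul ((h 1).pow 3))).sub
    (((IsPolyFun.const 4).mul ((h 2).pow 3)).mul (h 0))).sub
    (((IsPolyFun.const 27).mul ((h 3).pow 2)).mul ((h 0).pow 2))).add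
    (((((IsPolyFun.const 18).mul (h 3)).mul (h 2)).mul (h 1)).mul (h 0))

theorem coeff_three_restrict [Infinite K] {p : MvPolynomial (Fin n) K} (hp : p.IsHomogeneous 3)
    (u w : Fin n → K) : (restrict p u w).coeff 3 = eval w p := by
  rw [coeff_restrict_swap hp, Cubic.coeff_eq_a, coeff_zero_restrict]

theorem coeff_two_restrict [Infinite K] {p : MvPolynomial (Fin n) K} (hp : p.IsHomogeneous 3)
    (u w : Fin n → K) : (restrict p u w).coeff 2 = ∑ i, u i * eval w (pderiv i p) := by
  rw [coeff_restrict_swap hp, Cubic.coeff_eq_b, coeff_one_restrict]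

theorem exists_roots_of_lineDisc_ne_zero [IsAlgClosed K] {p : MvPolynomial (Fin n) K}
    (hp : p.IsHomogeneous 3) {u w : Fin n → K} (h : lineDisc p u w ≠ 0) :
    eval w p ≠ 0 ∧ ∃ r : Fin 3 → K, Function.Injective r ∧ ∀ i, eval (u + r i • w) p = 0 := by
  have ha : (restrictCubic p u w).a ≠ 0 := left_ne_zero_of_mul h
  refine ⟨coeff_three_restrict hp u w ▸ ha, ?_⟩
  obtain ⟨x, y, z, h3⟩ := (Cubic.splits_iff_roots_eq_three (φ := RingHom.id K) ha).mp
    (IsAlgClosed.splits _)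
  obtain ⟨hxy, hxz, hyz⟩ := (Cubic.discr_ne_zero_iff_roots_ne ha h3).mp (right_ne_zero_of_mul h)
  have hm : Cubic.map (RingHom.id K) (restrictCubic p u w) = restrictCubic p u w := rfl
  have hroot : ∀ t ∈ ({x, y, z} : Multiset K), eval (u + t • w) p = 0 := fun t ht => by
    rw [← h3, hm, Cubic.mem_roots_iff (Cubic.ne_zero_of_a_ne_zero ha)] at ht
    rw [← eval_restrict, restrict_eq_sum hp]
    simpa [Cubic.toPoly, restrictCubic] using ht
  refine ⟨![x, y, z], ?_, fun i => hroot _ ?_⟩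
  · intro i j hij
    fin_cases i <;> fin_cases j <;> simp_all
  · fin_cases i <;> simp

end PlaneCubic

namespace MvPolynomial

variable {σ K : Type*} [CommRing K]

theorem eq_zero_of_map_X_mul {M : Type*} [AddCommGroup M] [Module K M] {n : ℕ}
    (μ : MvPolynomial σ K →ₗ[K] M)
    (h : ∀ (i : σ) (p : MvPolynomial σ K), p.IsHomogeneous n → μ (X i * p) = 0)
    {p : MvPolynomial σ K} (hp : p.IsHomogeneous (n + 1)) : μ p = 0 := by
  classical
  rw [p.as_sum, map_sum]
  refine Finset.sum_eq_zero fun m hm => ?_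
  have hd : m.degree = n + 1 := by
    have := hp (mem_support_iff.mp hm)
    rw [Finsupp.degree_eq_weight_one]
    exact this
  obtain ⟨i, hi⟩ : ∃ i, m i ≠ 0 := by
    by_contra! h0
    have : m = 0 := Finsupp.ext h0
    simp [this] at hd
  have hm' : Finsupp.single i 1 + (m - Finsupp.single i 1) = m :=
    add_tsub_cancel_of_le (by simpa [Nat.one_le_iff_ne_zero] using hi)
  have he : monomial m (coeff m p) = X i * monomial (m - Finsupp.single i 1) (coeff m p) := by
    rw [X, monomial_mul, one_mul, hm']
  rw [he]
  refine h i _ (isHomogeneous_monomial _ ?_)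
  have := congrArg Finsupp.degree hm'
  rw [map_add, Finsupp.degree_single] at this
  omega

end MvPolynomial

namespace PlaneCubic

open MvPolynomial Matrix

variable {K : Type*} [Field K]

theorem exists_transversal [IsAlgClosed K] {E : MvPolynomial (Fin 3) K} (hE : E.IsHomogeneous 3)
    {α β : K} (h : lineDisc E ![1, 0, α] ![0, 1, β] ≠ 0) : ∃ r, Transversal E α β r := by
  obtain ⟨h0, r, hr, hr'⟩ := exists_roots_of_lineDisc_ne_zero hE h
  refine ⟨r, hr, h0, fun i => ?_⟩
  rw [← hr' i]
  congr 2
  funext j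
  fin_cases j <;> simp [linePt, mul_comm]

theorem exists_good_line [IsAlgClosed K] {E : MvPolynomial (Fin 3) K}
    (hE0 : lineDisc E ![1, 0, 0] ![0, 1, 0] ≠ 0) {n : ℕ} (μ : MvPolynomial (Fin 3) K →ₗ[K] K)
    {p : MvPolynomial (Fin 3) K} (hp : p.IsHomogeneous (n + 1)) (hμ : μ p ≠ 0)
    (T : Finset (Fin 3 → K)) (hT : ∀ t ∈ T, t ≠ 0) :
    ∃ α β, lineDisc E ![1, 0, α] ![0, 1, β] ≠ 0 ∧ (∀ t ∈ T, eval t (line α β) ≠ 0) ∧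
      ∃ q : MvPolynomial (Fin 3) K, q.IsHomogeneous n ∧ μ (line α β * q) ≠ 0 := by
  classical
  have : Infinite K := IsAlgClosed.instInfinite
  obtain ⟨i, q, hq, hi⟩ : ∃ (i : Fin 3) (q : MvPolynomial (Fin 3) K), q.IsHomogeneous n ∧
      μ (X i * q) ≠ 0 := by
    by_contra! h
    exact hμ (eq_zero_of_map_X_mul μ h hp)
  have hlin : ∀ a b c : K, IsPolyFun fun x : Fin 2 → K => a - x 0 * b - x 1 * c := fun a b c =>
    ((IsPolyFun.const a).sub ((IsPolyFun.coord 0).mul (.const b))).sub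
      ((IsPolyFun.coord 1).mul (.const c))
  have hex : ∀ v : Fin 3 → K, v ≠ 0 → ∃ x : Fin 2 → K, v 2 - x 0 * v 0 - x 1 * v 1 ≠ 0 := by
    intro v hv
    by_contra! h
    have h0 := h ![0, 0]
    have h1 := h ![1, 0]
    have h2 := h ![0, 1]
    simp at h0 h1 h2
    rw [h0, zero_sub, neg_eq_zero] at h1 h2
    exact hv (funext fun i => by fin_cases i <;> assumption)
  let φ : Option (Option T) → (Fin 2 → K) → K := fun o => o.elim
    (fun x => lineDisc E ![1, 0, x 0] ![0, 1, x 1]) fun o' => o'.elim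
      (fun x => μ (X 2 * q) - x 0 * μ (X 0 * q) - x 1 * μ (X 1 * q))
      fun t x => t.1 2 - x 0 * t.1 0 - x 1 * t.1 1
  obtain ⟨x, hx⟩ := IsPolyFun.exists_ne_zero (Finset.univ : Finset (Option (Option T))) (φ := φ)
    (by
      rintro (_ | _ | t) -
      · refine isPolyFun_lineDisc E (fun i => ?_) (fun i => ?_)
        · fin_cases i
          · exact .const 1
          · exact .const 0
          · exact .coord 0
        · fin_cases i
          · exact .const 0
          · exact .const 1
          · exact .coord 1
      · exact hlin _ _ _
      · exact hlin _ _ _)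
    (by
      rintro (_ | _ | t) -
      · exact ⟨0, hE0⟩
      · exact hex (fun j => μ (X j * q)) fun h => hi (congrFun h i)
      · exact hex t.1 (hT _ t.2))
  refine ⟨x 0, x 1, hx none (Finset.mem_univ _), fun t ht => ?_, q, hq, ?_⟩
  · rw [eval_line]
    exact hx (some (some ⟨t, ht⟩)) (Finset.mem_univ _)
  · have := hx (some none) (Finset.mem_univ _)
    simp only [line, sub_mul, C_mul', map_sub, smul_mul_assoc, map_smul, smul_eq_mul]
    exact this

theorem eval_line_eq_zero_iff {α β : K} {v : Fin 3 → K} (hv : v 0 = 1) :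
    eval v (line α β) = 0 ↔ v = linePt α β (v 1) := by
  rw [eval_line, hv]
  constructor
  · intro h
    funext i
    fin_cases i
    · simpa [linePt] using hv
    · simp [linePt]
    · simp [linePt]
      linear_combination h
  · intro h
    have := congrFun h 2
    simp [linePt] at this
    rw [this]; ring

theorem exists_lineConfig [IsAlgClosed K] {E : MvPolynomial (Fin 3) K} (hE : E.IsHomogeneous 3)
    (hE0 : lineDisc E ![1, 0, 0] ![0, 1, 0] ≠ 0) {n : ℕ} (μ : MvPolynomial (Fin 3) K →ₗ[K] K)
    {p : MvPolynomial (Fin 3) K} (hp : p.IsHomogeneous n) (hμ : μ p ≠ 0)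
    (T : Finset (Fin 3 → K)) (hT : ∀ t ∈ T, t ≠ 0) :
    ∃ (α β : Fin n → K) (r : Fin n → Fin 3 → K), LineConfig E α β r ∧
      (∀ j, ∀ t ∈ T, eval t (line (α j) (β j)) ≠ 0) ∧ μ (∏ j, line (α j) (β j)) ≠ 0 := by
  classical
  have : Infinite K := IsAlgClosed.instInfinite
  induction n generalizing μ p T with
  | zero =>
    refine ⟨0, 0, 0, ⟨fun j => j.elim0, fun j => j.elim0⟩, fun j => j.elim0, fun h => hμ ?_⟩
    rw [Finset.univ_eq_empty, Finset.prod_empty] at h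
    rw [(HomW.iff_isHomogeneous.mpr hp).eq_C, ← mul_one (C _), C_mul', map_smul, h, smul_zero]
  | succ n ih =>
    obtain ⟨α₀, β₀, hdisc, hT₀, q, hq, hμq⟩ := exists_good_line hE0 μ hp hμ T hT
    obtain ⟨r₀, hr₀⟩ := exists_transversal hE hdisc
    obtain ⟨α, β, r, hL, hLT, hLμ⟩ := ih (μ ∘ₗ LinearMap.mulLeft K (line α₀ β₀)) hq hμq
      (T ∪ Finset.univ.image fun i => linePt α₀ β₀ (r₀ i)) fun t ht => by
        rcases Finset.mem_union.mp ht with ht | ht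
        · exact hT t ht
        · obtain ⟨i, -, rfl⟩ := Finset.mem_image.mp ht
          exact linePt_ne_zero _ _ _
    have hL0 : ∀ j i, eval (linePt α₀ β₀ (r₀ i)) (line (α j) (β j)) ≠ 0 := fun j i =>
      hLT j _ (Finset.mem_union_right _ (Finset.mem_image_of_mem _ (Finset.mem_univ i)))
    refine ⟨Fin.cons α₀ α, Fin.cons β₀ β, Fin.cons r₀ r, ⟨fun j => ?_, fun j j' hj i => ?_⟩,
      fun j t ht => ?_, ?_⟩
    · cases j using Fin.cases with
      | zero => exact hr₀
      | succ j => exact hL.transversal j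
    · cases j using Fin.cases with
      | zero =>
        cases j' using Fin.cases with
        | zero => exact absurd rfl hj
        | succ j' => exact hL0 j' i
      | succ j =>
        cases j' using Fin.cases with
        | zero =>
          simp only [Fin.cons_zero, Fin.cons_succ]
          intro h
          rw [eval_line_eq_zero_iff (by simp [linePt])] at h
          have h0 := (hL.transversal j).eval_linePt i
          rw [h] at h0
          obtain ⟨i', hi'⟩ := hr₀.exists_param_eq hE h0
          rw [hi'] at h
          refine hL0 j i' ?_
          rw [← h, eval_line_linePt]
        | succ j' => exact hL.eval_ne_zero j j' (fun e => hj (e ▸ rfl)) i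
    · cases j using Fin.cases with
      | zero => exact hT₀ t ht
      | succ j => exact hLT j t (Finset.mem_union_left _ ht)
    · rw [Fin.prod_univ_succ]
      exact hLμ

end PlaneCubic

namespace PlaneCubic

open MvPolynomial Matrix

variable {K ι : Type*} [Field K]

theorem exists_eq_mul_add_X_mul {f p : MvPolynomial (Fin 4) K} {d : ℕ}
    (hf : f.IsHomogeneous 3) (hp : p.IsHomogeneous (d + 1)) (h : modFirst K 3 f ∣ modFirst K 3 p) :
    ∃ c q, p = f * c + X 0 * q ∧ q.IsHomogeneous d := by
  obtain ⟨c, hc⟩ := h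
  obtain ⟨q, hq⟩ := exists_of_modFirst_eq_zero (p := p - f * rename Fin.succ c)
    (by rw [map_sub, map_mul, modFirst_rename, hc, sub_self])
  obtain ⟨b, b', hb, -, hb'⟩ := exists_homW_of_eq_add (c := rename Fin.succ c) (c' := q) hp hf
    (isHomogeneous_X K (0 : Fin 4)) (by rw [← hq]; ring)
  exact ⟨b, b', hb, HomW.iff_isHomogeneous.mp (hb'.congr (by omega))⟩

/-- Restrictions to the plane `X 0 = 0` of forms of degree `d` vanishing at the vectors `z s`,
modulo the restriction of `f`. -/
def traceSpace (f : MvPolynomial (Fin 4) K) (d : ℕ) (z : ι → Fin 4 → K) :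
    Submodule K (MvPolynomial (Fin 3) K) where
  carrier := {q | ∃ h : MvPolynomial (Fin 4) K, h.IsHomogeneous d ∧ (∀ s, eval (z s) h = 0) ∧
    modFirst K 3 f ∣ q - modFirst K 3 h}
  zero_mem' := ⟨0, isHomogeneous_zero _ _ _, fun _ => map_zero _, by simp⟩
  add_mem' := by
    rintro p q ⟨h, hh, hz, hd⟩ ⟨h', hh', hz', hd'⟩
    refine ⟨h + h', hh.add hh', fun s => by rw [map_add, hz, hz', add_zero], ?_⟩
    rw [map_add, add_sub_add_comm]
    exact dvd_add hd hd'
  smul_mem' := by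
    rintro c p ⟨h, hh, hz, hd⟩
    refine ⟨C c * h, hh.C_mul c, fun s => by rw [map_mul, hz, mul_zero], ?_⟩
    rw [← C_mul', map_mul, algHom_C, algebraMap_eq, ← mul_sub]
    exact dvd_mul_of_dvd_right hd _

theorem not_dvd_X {n : ℕ} {f : MvPolynomial (Fin n) K} (hf : f.IsHomogeneous 3) (i : Fin n) :
    ¬ f ∣ X i := fun h =>
  X_ne_zero (R := K) i (eq_zero_of_dvd_of_lt (isHomogeneous_X K i) hf h (by norm_num))

section

variable {f : MvPolynomial (Fin 4) K} {z : ι → Fin 4 → K} {e : ℕ}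

theorem EigenRigid.dvd_of_vanishing (hN : EigenRigid f e z) (hf : f.IsHomogeneous 3)
    (hirr : Irreducible f) {p : MvPolynomial (Fin 4) K} (hp : p.IsHomogeneous e)
    (hpz : ∀ s, eval (z s) p = 0) : f ∣ p := by
  obtain ⟨g, hg⟩ := hN (Pi.single 0 p) (fun i => by
    rcases eq_or_ne i 0 with rfl | hi
    · rwa [Pi.single_eq_same]
    · rw [Pi.single_eq_of_ne hi]; exact isHomogeneous_zero _ _ _)
    fun s => ⟨0, fun i => by
      rcases eq_or_ne i 0 with rfl | hi
      · rw [Pi.single_eq_same, hpz, zero_mul]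
      · rw [Pi.single_eq_of_ne hi, map_zero, zero_mul]⟩
  have h1 := hg 1
  rw [Pi.single_eq_of_ne (by decide), zero_sub, dvd_neg] at h1
  have h2 : f ∣ g := (hirr.prime.dvd_or_dvd h1).resolve_left (not_dvd_X hf 1)
  have h0 := hg 0
  rw [Pi.single_eq_same] at h0
  exact (dvd_sub_left (dvd_mul_of_dvd_right h2 _)).mp h0

theorem EigenRigid.dvd_of_dvd_modFirst (hN : EigenRigid f e z) (hf : f.IsHomogeneous 3)
    (hirr : Irreducible f) (hz : ∀ s, eval (z s) f = 0) (hz0 : ∀ s, z s 0 ≠ 0)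
    {p : MvPolynomial (Fin 4) K} (hp : p.IsHomogeneous (e + 1))
    (hpz : ∀ s, eval (z s) p = 0) (h : modFirst K 3 f ∣ modFirst K 3 p) : f ∣ p := by
  obtain ⟨c, q, rfl, hq⟩ := exists_eq_mul_add_X_mul hf hp h
  refine dvd_add (dvd_mul_right _ _) (dvd_mul_of_dvd_right (hN.dvd_of_vanishing hf hirr hq
    fun s => ?_) _)
  have := hpz s
  rw [map_add, map_mul, hz, zero_mul, zero_add, map_mul, eval_X] at this
  exact (mul_eq_zero.mp this).resolve_left (hz0 s)

theorem EigenRigid.dvd_of_X_mul_mem (hN : EigenRigid f e z) (hf : f.IsHomogeneous 3)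
    (hz : ∀ s, eval (z s) f = 0) (hz0 : ∀ s, z s 0 ≠ 0)
    {b : MvPolynomial (Fin 3) K} (hb : b.IsHomogeneous e)
    (h : ∀ i, X i * b ∈ traceSpace f (e + 1) z) : modFirst K 3 f ∣ b := by
  have hbt : (rename Fin.succ b).IsHomogeneous e :=
    HomW.iff_isHomogeneous.mp (HomW.rename_succ (HomW.iff_isHomogeneous.mpr hb))
  have key : ∀ i : Fin 3, ∃ q : MvPolynomial (Fin 4) K, q.IsHomogeneous e ∧
      ∀ s, z s 0 * eval (z s) q + z s i.succ * eval (z s) (rename Fin.succ b) = 0 := fun i => by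
    obtain ⟨p, hp, hpz, hd⟩ := h i
    obtain ⟨c, q, hcq, hq⟩ := exists_eq_mul_add_X_mul (p := p - X i.succ * rename Fin.succ b)
      (d := e) hf (hp.sub (by simpa [add_comm] using (isHomogeneous_X K i.succ).mul hbt)) (by
        rw [map_sub, map_mul, modFirst_X_succ, modFirst_rename, ← dvd_neg, neg_sub]
        exact hd)
    refine ⟨q, hq, fun s => ?_⟩
    have := congrArg (eval (z s)) hcq
    rw [map_sub, hpz, map_add, map_mul, map_mul, map_mul, hz, eval_X, eval_X] at this
    linear_combination -this
  choose q hq hqz using key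
  obtain ⟨g, hg⟩ := hN (Fin.cons (-rename Fin.succ b) q) (fun i => by
    cases i using Fin.cases with
    | zero => exact hbt.neg
    | succ i => exact hq i) fun s => ⟨-(eval (z s) (rename Fin.succ b)) / z s 0, fun i => by
      cases i using Fin.cases with
      | zero => rw [Fin.cons_zero, map_neg, div_mul_cancel₀ _ (hz0 s)]
      | succ i =>
        rw [Fin.cons_succ]
        have := hqz i s
        have h0 := hz0 s
        field_simp
        linear_combination this⟩
  have h0 := map_dvd (modFirst K 3) (hg 0)
  rwa [Fin.cons_zero, map_sub, map_neg, modFirst_rename, map_mul, modFirst_X_zero, zero_mul,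
    sub_zero, dvd_neg] at h0

theorem finrank_homPoly_four {b : ℕ} (hb : 1 ≤ b) :
    Module.finrank K (homPoly K (Fin 4) 3 (b + 1)) + (3 * ((b + 1) * b / 2) + (b + 1)) <
      Module.finrank K (homPoly K (Fin 4) 0 (b + 1)) := by
  have h := three_le_finrank (K := K) hb
  rw [finrank_homVec, Fin.sum_univ_three] at h
  rw [finrank_homPoly, finrank_homPoly]
  obtain ⟨b, rfl⟩ := Nat.exists_eq_add_of_le' hb
  have h2 : (2 : ℕ) ≤ b + 1 + 1 := by omega
  have h1 : (1 : ℕ) ≤ b + 1 + 1 := by omega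
  simp only [Fin.val_zero, Fin.val_one, Fin.val_two, if_pos h1, if_pos h2, zero_le, if_true] at h ⊢
  have f0 : b + 1 + 1 - 0 = b + 1 + 1 := by omega
  have f1 : b + 1 + 1 - 1 = b + 1 := by omega
  have f2 : b + 1 + 1 - 2 = b := by omega
  rw [f0, f1, f2] at h
  have m4 : ∀ k, Nat.multichoose 4 (k + 1) = Nat.multichoose 3 (k + 1) + Nat.multichoose 4 k :=
    Nat.multichoose_succ_succ 3
  rw [f0, m4, m4]
  cases b with
  | zero =>
    rw [if_neg (by norm_num)]
    simp only [Nat.multichoose_zero_right, zero_add] at h ⊢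
    omega
  | succ b =>
    have f3 : b + 1 + 1 + 1 - 3 = b := by omega
    rw [if_pos (by omega), f3, m4]
    omega

theorem exists_form_of_card [Fintype ι] (hf : f.IsHomogeneous 3) {b : ℕ} (hb : 1 ≤ b)
    (hcard : Fintype.card ι = 3 * ((b + 1) * b / 2) + (b + 1)) (z : ι → Fin 4 → K) :
    ∃ G : MvPolynomial (Fin 4) K, G.IsHomogeneous (b + 1) ∧ (∀ s, eval (z s) G = 0) ∧ ¬ f ∣ G := by
  by_contra! hcon
  let ev : homPoly K (Fin 4) 0 (b + 1) →ₗ[K] (ι → K) :=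
    LinearMap.pi fun s => (aeval (z s)).toLinearMap ∘ₗ Submodule.subtype _
  let mu : homPoly K (Fin 4) 3 (b + 1) →ₗ[K] homPoly K (Fin 4) 0 (b + 1) :=
    ((LinearMap.mulLeft K f) ∘ₗ Submodule.subtype _).codRestrict _ fun p =>
      ((HomW.iff_isHomogeneous.mpr hf).mul p.2).congr (by omega)
  have hle : LinearMap.ker ev ≤ LinearMap.range mu := fun p hp => by
    obtain ⟨c, hc, hc'⟩ := exists_homW_of_dvd (HomW.iff_isHomogeneous.mp p.2) hf
      (hcon p.1 (HomW.iff_isHomogeneous.mp p.2) fun s => by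
        have := congrFun (LinearMap.mem_ker.mp hp) s
        simpa [ev, aeval_eq_eval] using this)
    exact ⟨⟨c, hc'⟩, Subtype.ext hc.symm⟩
  have h1 := LinearMap.finrank_range_add_finrank_ker ev
  have h2 := Submodule.finrank_mono hle
  have h3 := LinearMap.finrank_range_le mu
  have h4 := (LinearMap.range ev).finrank_le
  rw [Module.finrank_fintype_fun_eq_card, hcard] at h4
  have h5 := finrank_homPoly_four (K := K) hb
  omega

end

end PlaneCubic

namespace PlaneCubic

open MvPolynomial Matrix

section Openness

variable {K : Type*} [Field K]

theorem exists_ker_le {σ n V : Type*} [Fintype n] [AddCommGroup V] [Module K V]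
    [FiniteDimensional K V] {L : (σ → K) → V →ₗ[K] (n → K)}
    (h : ∀ v j, IsPolyFun fun x => L x v j) (W : Submodule K V) {x₀ : σ → K}
    (h₀ : LinearMap.ker (L x₀) ≤ W) :
    ∃ P : MvPolynomial σ K, eval x₀ P ≠ 0 ∧
      ∀ x, eval x P ≠ 0 → W ≤ LinearMap.ker (L x) → LinearMap.ker (L x) ≤ W := by
  obtain ⟨C, hC⟩ := W.exists_isCompl
  obtain ⟨P, hP₀, hP⟩ := IsPolyFun.exists_of_injective (L := fun x => (L x).domRestrict C)
    (fun v j => h v.1 j) (x₀ := x₀) (by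
      rw [← LinearMap.ker_eq_bot, LinearMap.ker_eq_bot']
      intro c hc
      exact Subtype.ext (Submodule.disjoint_def.mp hC.disjoint c.1 (h₀ hc) c.2))
  refine ⟨P, hP₀, fun x hx hW v hv => ?_⟩
  obtain ⟨w, hw, c, hc, rfl⟩ := Submodule.mem_sup.mp (hC.sup_eq_top.ge (Submodule.mem_top : v ∈ ⊤))
  have h1 : L x c = 0 := by
    have := LinearMap.mem_ker.mp hv
    rwa [map_add, LinearMap.mem_ker.mp (hW hw), zero_add] at this
  have h2 : (⟨c, hc⟩ : C) = 0 := hP x hx (by rw [map_zero]; exact h1)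
  rw [show c = 0 from congrArg Subtype.val h2, add_zero]
  exact hw

end Openness

variable {K ι : Type*} [Field K]

/-- Restrictions to the plane `X 0 = 0` for which evaluation of the triples constructed from a
configuration of lines may fail to be injective along the whole curve. -/
def badSpace (f : MvPolynomial (Fin 4) K) (e : ℕ) (z : ι → Fin 4 → K) :
    Submodule K (MvPolynomial (Fin 3) K) where
  carrier := {P | ∃ b : Fin 3 → MvPolynomial (Fin 3) K, (∀ i, (b i).IsHomogeneous e) ∧
    (∀ i l, (if i = l then P else 0) + X l * b i ∈ traceSpace f (e + 1) z) ∧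
    modFirst K 3 f ∣ P + ∑ i, X i * b i}
  zero_mem' := ⟨0, fun _ => isHomogeneous_zero _ _ _, by simp, by simp⟩
  add_mem' := by
    rintro P P' ⟨b, hb, hD, hd⟩ ⟨b', hb', hD', hd'⟩
    refine ⟨b + b', fun i => (hb i).add (hb' i), fun i l => ?_, ?_⟩
    · convert add_mem (hD i l) (hD' i l) using 1
      rw [Pi.add_apply]
      split_ifs <;> ring
    · convert dvd_add hd hd' using 1
      simp only [Pi.add_apply, mul_add, Finset.sum_add_distrib]
      ring
  smul_mem' := by
    rintro c P ⟨b, hb, hD, hd⟩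
    refine ⟨fun i => C c * b i, fun i => (hb i).C_mul c, fun i l => ?_, ?_⟩
    · convert Submodule.smul_mem _ c (hD i l) using 1
      rw [← C_mul', ← C_mul']
      split_ifs <;> ring
    · rw [← C_mul']
      convert dvd_mul_of_dvd_right hd (C c) using 1
      rw [mul_add, Finset.mul_sum]
      congr 1
      exact Finset.sum_congr rfl fun i _ => by ring

theorem exists_lineConfig_notMem_badSpace [IsAlgClosed K] [Fintype ι]
    {f : MvPolynomial (Fin 4) K} {z : ι → Fin 4 → K} {e : ℕ} (he : 1 ≤ e)
    (hN : EigenRigid f e z) (hf : f.IsHomogeneous 3)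
    (hirr : Irreducible f) (hz : ∀ s, eval (z s) f = 0) (hz0 : ∀ s, z s 0 ≠ 0)
    (hcard : Fintype.card ι = 3 * ((e + 1) * e / 2) + (e + 1))
    (hE0 : lineDisc (modFirst K 3 f) ![1, 0, 0] ![0, 1, 0] ≠ 0) :
    ∃ (α β : Fin (e + 1) → K) (r : Fin (e + 1) → Fin 3 → K), LineConfig (modFirst K 3 f) α β r ∧
      ∏ j, line (α j) (β j) ∉ badSpace f e z := by
  obtain ⟨G, hG, hGz, hGf⟩ := exists_form_of_card hf he hcard z
  have hbad : modFirst K 3 G ∉ badSpace f e z := by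
    rintro ⟨b, hb, hD, hd⟩
    have hmem : modFirst K 3 G ∈ traceSpace f (e + 1) z := ⟨G, hG, hGz, by simp⟩
    have hbE : ∀ i, modFirst K 3 f ∣ b i := fun i =>
      hN.dvd_of_X_mul_mem hf hz hz0 (hb i) fun l => by
        have := hD i l
        split_ifs at this
        · exact (Submodule.add_mem_iff_right _ hmem).mp this
        · rwa [zero_add] at this
    refine hGf (hN.dvd_of_dvd_modFirst hf hirr hz hz0 hG hGz ?_)
    exact (dvd_add_left (Finset.dvd_sum fun i _ => dvd_mul_of_dvd_right (hbE i) _)).mp hd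
  obtain ⟨μ, hμ, hker⟩ := Submodule.exists_le_ker_of_notMem hbad
  have hE : (modFirst K 3 f).IsHomogeneous 3 :=
    HomW.iff_isHomogeneous.mp (HomW.iff_isHomogeneous.mpr hf).modFirst
  obtain ⟨α, β, r, hL, -, hμL⟩ := exists_lineConfig hE hE0 μ
    (HomW.iff_isHomogeneous.mp (HomW.iff_isHomogeneous.mpr hG).modFirst) hμ ∅ (by simp)
  exact ⟨α, β, r, hL, fun h => hμL (hker h)⟩

theorem LineConfig.eval_eq_zero_of_eval_mul [IsAlgClosed K] {E : MvPolynomial (Fin 3) K}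
    {κ : Type*} [Fintype κ] {α β : κ → K} {r : κ → Fin 3 → K} (h : LineConfig E α β r)
    {P : MvPolynomial (Fin 3) K}
    (hP : ∀ q, eval q E = 0 → eval q (P * ∏ j, line (α j) (β j)) = 0)
    {q : Fin 3 → K} (hq : eval q E = 0) : eval q P = 0 := by
  have hmem : P * ∏ j, line (α j) (β j) ∈ (Ideal.span {E}).radical := by
    rw [← vanishingIdeal_zeroLocus_eq_radical (K := K)]
    intro x hx
    rw [aeval_eq_eval]
    exact hP x (by
      have := hx E (Ideal.mem_span_singleton_self E)
      rwa [aeval_eq_eval] at this)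
  obtain ⟨N, hN⟩ := hmem
  rw [Ideal.mem_span_singleton, mul_pow] at hN
  have key : ∀ M, E ∣ P ^ N * (∏ j, line (α j) (β j)) ^ M → E ∣ P ^ N := fun M => by
    induction M with
    | zero => simp
    | succ M ih =>
      intro h'
      refine ih (h.dvd_of_dvd_prod_mul Finset.univ ?_)
      convert h' using 1
      ring
  obtain ⟨c, hc⟩ := key N hN
  have := congrArg (eval q) hc
  rw [map_mul, hq, zero_mul, map_pow] at this
  by_contra hne
  exact pow_ne_zero N hne this

end PlaneCubic

namespace PlaneCubic

open MvPolynomial Matrix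

variable {K ι : Type*} [Field K]

/-- Triples of forms of degree `d` vanishing at the vectors `z s` whose restriction to the plane
`X 0 = 0` takes at every vector of `Y` a value proportional to that vector. -/
def stepSpace (d : ℕ) (z : ι → Fin 4 → K) (Y : Set (Fin 3 → K)) :
    Submodule K (Fin 3 → MvPolynomial (Fin 4) K) where
  carrier := {h | (∀ i, (h i).IsHomogeneous d) ∧ (∀ s i, eval (z s) (h i) = 0) ∧
    ∀ y ∈ Y, ∀ i l, eval y (modFirst K 3 (h i)) * y l = eval y (modFirst K 3 (h l)) * y i}
  zero_mem' := ⟨fun _ => isHomogeneous_zero _ _ _, by simp, by simp⟩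
  add_mem' := by
    rintro h h' ⟨h1, h2, h3⟩ ⟨h1', h2', h3'⟩
    refine ⟨fun i => (h1 i).add (h1' i), fun s i => ?_, fun y hy i l => ?_⟩
    · rw [Pi.add_apply, map_add, h2, h2', add_zero]
    · simp only [Pi.add_apply, map_add]
      linear_combination h3 y hy i l + h3' y hy i l
  smul_mem' := by
    rintro c h ⟨h1, h2, h3⟩
    refine ⟨fun i => ?_, fun s i => ?_, fun y hy i l => ?_⟩
    · rw [Pi.smul_apply, ← C_mul']; exact (h1 i).C_mul c
    · rw [Pi.smul_apply, smul_eval, h2, mul_zero]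
    · simp only [Pi.smul_apply, map_smul, smul_eval]
      linear_combination c * h3 y hy i l

theorem stepSpace_le_homVec (d : ℕ) (z : ι → Fin 4 → K) (Y : Set (Fin 3 → K)) :
    stepSpace d z Y ≤ homVec K (Fin 4) (fun _ : Fin 3 => 0) d :=
  fun _ h i => HomW.iff_isHomogeneous.mpr (h.1 i)

instance (d : ℕ) (z : ι → Fin 4 → K) (Y : Set (Fin 3 → K)) :
    FiniteDimensional K (stepSpace d z Y) :=
  Submodule.finiteDimensional_of_le (stepSpace_le_homVec d z Y)

/-- The leading vectors `v` of triples in a subspace `U` whose restriction to the plane is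
`P v + X b` modulo the restriction of `f`. -/
def leadSpace (f : MvPolynomial (Fin 4) K) (P : MvPolynomial (Fin 3) K) (e : ℕ)
    (U : Submodule K (Fin 3 → MvPolynomial (Fin 4) K)) : Submodule K (Fin 3 → K) where
  carrier := {v | ∃ h ∈ U, ∃ b : MvPolynomial (Fin 3) K, b.IsHomogeneous e ∧
    ∀ i, modFirst K 3 f ∣ P * C (v i) + X i * b - modFirst K 3 (h i)}
  zero_mem' := ⟨0, zero_mem _, 0, isHomogeneous_zero _ _ _, by simp⟩
  add_mem' := by
    rintro v v' ⟨h, hh, b, hb, hd⟩ ⟨h', hh', b', hb', hd'⟩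
    refine ⟨h + h', add_mem hh hh', b + b', hb.add hb', fun i => ?_⟩
    convert dvd_add (hd i) (hd' i) using 1
    simp only [Pi.add_apply, map_add]
    ring
  smul_mem' := by
    rintro c v ⟨h, hh, b, hb, hd⟩
    refine ⟨c • h, Submodule.smul_mem _ c hh, C c * b, hb.C_mul c, fun i => ?_⟩
    convert dvd_mul_of_dvd_right (hd i) (C c) using 1
    simp only [Pi.smul_apply, smul_eq_mul, C_mul, map_smul]
    rw [smul_eq_C_mul]
    ring

theorem eval_eq_of_dvd_sub {σ : Type*} {E p q : MvPolynomial σ K} {x : σ → K}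
    (hx : eval x E = 0) (h : E ∣ p - q) : eval x p = eval x q := by
  obtain ⟨c, hc⟩ := h
  have := congrArg (eval x) hc
  rwa [map_sub, map_mul, hx, zero_mul, sub_eq_zero] at this

variable [IsAlgClosed K] {f : MvPolynomial (Fin 4) K} {z : ι → Fin 4 → K} {e : ℕ}
  {α β : Fin (e + 1) → K} {r : Fin (e + 1) → Fin 3 → K}

theorem LineConfig.exists_eval_linForm_mul_ne_zero {E : MvPolynomial (Fin 3) K}
    (hL : LineConfig E α β r) (he : 1 ≤ e) (hE : E.IsHomogeneous 3) {c : Fin 3 → K} (hc : c ≠ 0) :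
    ∃ q, eval q E = 0 ∧ eval q ((∑ i, C (c i) * X i) * ∏ j, line (α j) (β j)) ≠ 0 := by
  by_contra! hcon
  have h1 : (∑ i, C (c i) * X i : MvPolynomial (Fin 3) K).IsHomogeneous 1 := isHomogeneous_linForm c
  obtain ⟨a, F, haF, ha, hF⟩ := hL.exists_homW_eq_prod hE Finset.univ h1 fun j _ i =>
    hL.eval_eq_zero_of_eval_mul hcon ((hL.transversal j).eval_linePt i)
  rw [ha.eq_zero_of_lt (by omega), hF.eq_zero_of_lt (by simp; omega), mul_zero, mul_zero,
    add_zero] at haF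
  refine hc (funext fun i => ?_)
  have := congrArg (eval (Pi.single i (1 : K))) haF
  simpa [Pi.single_apply] using this

theorem LineConfig.exists_eval_prod_ne_zero {E : MvPolynomial (Fin 3) K}
    (hL : LineConfig E α β r) (he : 1 ≤ e) (hE : E.IsHomogeneous 3) :
    ∃ q, eval q E = 0 ∧ eval q (∏ j, line (α j) (β j)) ≠ 0 := by
  obtain ⟨q, hq, h⟩ := hL.exists_eval_linForm_mul_ne_zero he hE (c := Pi.single 0 1)
    (fun h => one_ne_zero (α := K) (by simpa using congrFun h 0))
  exact ⟨q, hq, fun h0 => h (by rw [map_mul, h0, mul_zero])⟩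

theorem LineConfig.dvd_of_eval_eq_zero {E : MvPolynomial (Fin 3) K}
    (hL : LineConfig E α β r) (he : 1 ≤ e) (hE : E.IsHomogeneous 3) {F : MvPolynomial (Fin 3) K}
    (hF : F.IsHomogeneous (e + 1)) (h : ∀ q, eval q E = 0 → eval q F = 0) : E ∣ F := by
  obtain ⟨c, a, rfl⟩ := hL.exists_eq_prod_mul_C hE (by simpa using hF) 0 0
    fun j i _ => h _ ((hL.transversal j).eval_linePt i)
  obtain ⟨q, hq, hq'⟩ := hL.exists_eval_prod_ne_zero he hE
  have := h q hq
  rw [map_add, map_mul, hq, zero_mul, zero_add, map_mul, eval_C] at this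
  rw [(mul_eq_zero.mp this).resolve_left hq', C_0, mul_zero, add_zero]
  exact dvd_mul_right _ _

theorem exists_lead (hf : f.IsHomogeneous 3) (hE0 : modFirst K 3 f ≠ 0)
    (hL : LineConfig (modFirst K 3 f) α β r) {h : Fin 3 → MvPolynomial (Fin 4) K}
    (hh : h ∈ stepSpace (e + 1) z
      (Set.range fun t : Fin (e + 1) × Fin 3 => linePt (α t.1) (β t.1) (r t.1 t.2))) :
    ∃ (v : Fin 3 → K) (b : MvPolynomial (Fin 3) K), b.IsHomogeneous e ∧
      ∀ i, modFirst K 3 f ∣ (∏ j, line (α j) (β j)) * C (v i) + X i * b - modFirst K 3 (h i) := by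
  have hE : (modFirst K 3 f).IsHomogeneous 3 :=
    HomW.iff_isHomogeneous.mp (HomW.iff_isHomogeneous.mpr hf).modFirst
  obtain ⟨v, b, g, hb, hg⟩ := hL.exists_eq_of_cross hE hE0 (p := fun i => modFirst K 3 (h i))
    (fun i => HomW.iff_isHomogeneous.mp
      (HomW.iff_isHomogeneous.mpr (by simpa using hh.1 i)).modFirst)
    fun j i l l' => by
      simp only [map_mul, eval_X]
      exact hh.2.2 _ ⟨(j, i), rfl⟩ l l'
  refine ⟨v, b, HomW.iff_isHomogeneous.mp (hb.congr (by simp [add_comm])), fun i => ?_⟩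
  rw [hg i, sub_add_cancel_left, dvd_neg]
  exact dvd_mul_right _ _

theorem exists_point_of_notMem_badSpace (he : 1 ≤ e) (hN : EigenRigid f e z)
    (hf : f.IsHomogeneous 3) (hirr : Irreducible f) (hE0 : modFirst K 3 f ≠ 0)
    (hz : ∀ s, eval (z s) f = 0) (hz0 : ∀ s, z s 0 ≠ 0)
    (hL : LineConfig (modFirst K 3 f) α β r) (hbad : ∏ j, line (α j) (β j) ∉ badSpace f e z) :
    ∃ q, eval q (modFirst K 3 f) = 0 ∧ ∀ h ∈ stepSpace (e + 1) z
      (Set.range fun t : Fin (e + 1) × Fin 3 => linePt (α t.1) (β t.1) (r t.1 t.2)),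
      (∀ i, eval q (modFirst K 3 (h i)) = 0) → ∀ i, f ∣ h i := by
  have hE : (modFirst K 3 f).IsHomogeneous 3 :=
    HomW.iff_isHomogeneous.mp (HomW.iff_isHomogeneous.mpr hf).modFirst
  set U := stepSpace (e + 1) z
      (Set.range fun t : Fin (e + 1) × Fin 3 => linePt (α t.1) (β t.1) (r t.1 t.2)) with hU
  set P := ∏ j, line (α j) (β j) with hPdef
  have htr : ∀ h ∈ U, ∀ i, ∀ q, modFirst K 3 f ∣ q - modFirst K 3 (h i) →
      q ∈ traceSpace f (e + 1) z := fun h hh i q hq => ⟨h i, hh.1 i, fun s => hh.2.1 s i, hq⟩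
  suffices H : ∃ q, eval q (modFirst K 3 f) = 0 ∧ eval q P ≠ 0 ∧ ∀ h ∈ U, ∀ (v : Fin 3 → K)
      (b : MvPolynomial (Fin 3) K), b.IsHomogeneous e →
      (∀ i, modFirst K 3 f ∣ P * C (v i) + X i * b - modFirst K 3 (h i)) →
      (∀ i, eval q P * v i + q i * eval q b = 0) → eval q b = 0 by
    obtain ⟨q, hq, hqP, hqb⟩ := H
    refine ⟨q, hq, fun h hh h0 => ?_⟩
    obtain ⟨v, b, hb, hd⟩ := exists_lead hf hE0 hL hh
    have hval : ∀ i, eval q P * v i + q i * eval q b = 0 := fun i => by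
      rw [← h0 i, ← eval_eq_of_dvd_sub hq (hd i)]
      simp [hPdef]
    have hb0 := hqb h hh v b hb hd hval
    have hv : ∀ i, v i = 0 := fun i => by
      have := hval i
      rw [hb0, mul_zero, add_zero] at this
      exact (mul_eq_zero.mp this).resolve_left hqP
    have hd' : ∀ i, modFirst K 3 f ∣ X i * b - modFirst K 3 (h i) := fun i => by
      have := hd i
      rwa [hv, C_0, mul_zero, zero_add] at this
    have hEb := hN.dvd_of_X_mul_mem hf hz hz0 hb fun i => htr h hh i _ (hd' i)
    exact fun i => hN.dvd_of_dvd_modFirst hf hirr hz hz0 (hh.1 i) (fun s => hh.2.1 s i)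
      ((dvd_sub_right (dvd_mul_of_dvd_right hEb _)).mp (hd' i))
  by_cases hlead : leadSpace f P e U = ⊤
  · have hex : ∀ i, (Pi.single i 1 : Fin 3 → K) ∈ leadSpace f P e U := fun i => by
      rw [hlead]; trivial
    choose H hH b hb hd using hex
    have hPh : P.IsHomogeneous (e + 1) := by
      simpa using isHomogeneous_prod_line α β Finset.univ
    have hΦ : ¬ modFirst K 3 f ∣ P + ∑ i, X i * b i := fun hdvd =>
      hbad ⟨b, hb, fun i l => htr (H i) (hH i) l _ (by
        convert hd i l using 2
        rw [Pi.single_apply]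
        simp only [eq_comm (a := l)]
        split_ifs <;> simp), hdvd⟩
    have hΦh : (P + ∑ i, X i * b i).IsHomogeneous (e + 1) :=
      hPh.add (IsHomogeneous.sum _ _ _ fun i _ => by
        simpa [add_comm] using (isHomogeneous_X K i).mul (hb i))
    obtain ⟨q, hq, hqne⟩ : ∃ q, eval q (modFirst K 3 f) = 0 ∧
        eval q ((P + ∑ i, X i * b i) * P) ≠ 0 := by
      by_contra! hcon
      exact hΦ (hL.dvd_of_eval_eq_zero he hE hΦh fun q hq => hL.eval_eq_zero_of_eval_mul hcon hq)
    rw [map_mul, mul_ne_zero_iff] at hqne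
    refine ⟨q, hq, hqne.2, fun h hh v b' hb' hd' hval => ?_⟩
    have hdvd : modFirst K 3 f ∣ b' - ∑ i, C (v i) * b i := by
      refine hN.dvd_of_X_mul_mem hf hz hz0 (hb'.sub (IsHomogeneous.sum _ _ _ fun i _ =>
        (hb i).C_mul _)) fun l => htr (h - ∑ i, v i • H i)
          (sub_mem hh (sum_mem fun i _ => Submodule.smul_mem _ _ (hH i))) l _ ?_
      convert dvd_sub (hd' l) (Finset.dvd_sum (s := Finset.univ)
        fun i _ => dvd_mul_of_dvd_right (hd i l) (C (v i))) using 1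
      simp only [Pi.sub_apply, map_sub, Fin.sum_univ_three, Pi.single_apply]
      fin_cases l <;> simp [smul_eq_C_mul] <;> ring
    have hbq : eval q b' = ∑ i, v i * eval q (b i) := by
      rw [eval_eq_of_dvd_sub hq hdvd]
      simp
    have hkey : eval q b' * eval q (P + ∑ i, X i * b i) = 0 := by
      have h0 := hval 0
      have h1 := hval 1
      have h2 := hval 2
      rw [map_add, map_sum, Fin.sum_univ_three]
      rw [Fin.sum_univ_three] at hbq
      simp only [map_mul, eval_X]
      linear_combination eval q P * hbq + eval q (b 0) * h0 + eval q (b 1) * h1 +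
        eval q (b 2) * h2
    exact (mul_eq_zero.mp hkey).resolve_right hqne.1
  · obtain ⟨φ, hφ0, hφ⟩ := Submodule.exists_le_ker_of_lt_top _ (lt_top_iff_ne_top.mpr hlead)
    have hφv : ∀ v, φ v = ∑ i, φ (Pi.single i 1) * v i := fun v => by
      conv_lhs => rw [← Finset.univ_sum_single v]
      rw [map_sum]
      refine Finset.sum_congr rfl fun i _ => ?_
      rw [mul_comm, ← smul_eq_mul, ← map_smul, ← Pi.single_smul, smul_eq_mul, mul_one]
    obtain ⟨q, hq, hqne⟩ := hL.exists_eval_linForm_mul_ne_zero he hE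
      (c := fun i => φ (Pi.single i 1)) (fun h => hφ0 (LinearMap.ext fun v => by
        rw [hφv, LinearMap.zero_apply]
        exact Finset.sum_eq_zero fun i _ => by rw [congrFun h i, Pi.zero_apply, zero_mul]))
    rw [map_mul, mul_ne_zero_iff, map_sum] at hqne
    simp only [map_mul, eval_C, eval_X] at hqne
    refine ⟨q, hq, hqne.2, fun h hh v b hb hd hval => ?_⟩
    have hv : φ v = 0 := hφ ⟨h, hh, b, hb, hd⟩
    rw [hφv] at hv
    refine (mul_eq_zero.mp ?_).resolve_left hqne.1
    rw [Fin.sum_univ_three] at hv ⊢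
    linear_combination φ (Pi.single 0 1) * hval 0 + φ (Pi.single 1 1) * hval 1 +
      φ (Pi.single 2 1) * hval 2 - eval q P * hv

end PlaneCubic

namespace PlaneCubic

open MvPolynomial Matrix

variable {K : Type*} [Field K]

theorem eval_cons_zero {n : ℕ} (q : Fin n → K) (p : MvPolynomial (Fin (n + 1)) K) :
    eval (Fin.cons 0 q : Fin (n + 1) → K) p = eval q (modFirst K n p) := by
  rw [← aeval_eq_eval, ← aeval_eq_eval]
  refine DFunLike.congr_fun (f := aeval (Fin.cons 0 q : Fin (n + 1) → K))
    (g := (aeval q).comp (modFirst K n)) (MvPolynomial.algHom_ext fun i => ?_) p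
  cases i using Fin.cases with
  | zero => simp [modFirst_X_zero]
  | succ i => simp [modFirst_X_succ]

theorem linearIndependent_pair_of_eval {n : ℕ} {p : MvPolynomial (Fin n) K} {d : ℕ}
    (hp : p.IsHomogeneous d) {x y : Fin n → K} (hx0 : x ≠ 0) (hy0 : y ≠ 0) (hx : eval x p ≠ 0)
    (hy : eval y p = 0) : LinearIndependent K ![x, y] := by
  rw [LinearIndependent.pair_iff' hx0]
  rintro a rfl
  rw [eval_smul_of_isHomogeneous hp] at hy
  have ha : a = 0 := eq_zero_of_pow_eq_zero ((mul_eq_zero.mp hy).resolve_right hx)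
  exact hy0 (by rw [ha, zero_smul])

/-- Tuples of polynomials all of whose entries are divisible by `f`. -/
def divSpace (n : Type*) {σ : Type*} (f : MvPolynomial σ K) :
    Submodule K (n → MvPolynomial σ K) where
  carrier := {h | ∀ i, f ∣ h i}
  zero_mem' := by simp
  add_mem' := fun h h' i => dvd_add (h i) (h' i)
  smul_mem' := fun c h hh i => by
    rw [Pi.smul_apply, ← C_mul']
    exact dvd_mul_of_dvd_right (hh i) _

variable {ι : Type*} {f : MvPolynomial (Fin 4) K} {z : ι → Fin 4 → K} {e d : ℕ}
  {α β : Fin (e + 1) → K} {r : Fin (e + 1) → Fin 3 → K}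

theorem exists_surface_point [IsAlgClosed K] {Y : Set (Fin 3 → K)} (hf : f.IsHomogeneous 3)
    (hirr : Irreducible f) {q : Fin 3 → K} (hq : eval q (modFirst K 3 f) = 0)
    (hqU : ∀ h ∈ stepSpace d z Y, (∀ i, eval q (modFirst K 3 (h i)) = 0) → ∀ i, f ∣ h i)
    {G : MvPolynomial (Fin 4) K} (hG : ¬ f ∣ G) :
    ∃ Q, eval Q f = 0 ∧ Q 0 ≠ 0 ∧ eval Q G ≠ 0 ∧
      ∀ h ∈ stepSpace d (Sum.elim z fun _ : Unit => Q) Y, ∀ i, f ∣ h i := by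
  let L : (Fin 4 → K) → stepSpace d z Y →ₗ[K] (Fin 3 → K) := fun x =>
    LinearMap.pi fun i => (aeval x).toLinearMap ∘ₗ LinearMap.proj i ∘ₗ Submodule.subtype _
  have hL : ∀ x h i, L x h i = eval x (h.1 i) := fun x h i => by
    simp [L, aeval_eq_eval]
  obtain ⟨P, hP₀, hP⟩ := exists_ker_le (L := L) (x₀ := Fin.cons 0 q)
    (fun h i => by simp only [hL]; exact IsPolyFun.evalAt _ fun t => .coord t)
    ((divSpace (Fin 3) f).comap (Submodule.subtype _)) fun h hh =>
      hqU h.1 h.2 fun i => by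
        rw [← eval_cons_zero, ← hL]
        exact congrFun (LinearMap.mem_ker.mp hh) i
  have hfP : ¬ f ∣ P := fun ⟨c, hc⟩ => hP₀ (by
    rw [hc, map_mul, eval_cons_zero, hq, zero_mul])
  obtain ⟨Q, hQf, hQ⟩ := exists_eval_ne_zero_of_irreducible (p := P * X 0 * G) hirr fun h => by
    rcases hirr.prime.dvd_or_dvd h with h | h
    · rcases hirr.prime.dvd_or_dvd h with h | h
      exacts [hfP h, not_dvd_X hf 0 h]
    · exact hG h
  rw [map_mul, map_mul, mul_ne_zero_iff, mul_ne_zero_iff, eval_X] at hQ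
  refine ⟨Q, hQf, hQ.1.2, hQ.2, fun h hh => ?_⟩
  have hU : h ∈ stepSpace d z Y := ⟨hh.1, fun s => hh.2.1 (Sum.inl s), hh.2.2⟩
  refine hP Q hQ.1.1 (fun h' hh' => ?_) (show (⟨h, hU⟩ : stepSpace d z Y) ∈ _ from ?_)
  · refine LinearMap.mem_ker.mpr (funext fun i => ?_)
    obtain ⟨c, hc⟩ : f ∣ h'.1 i := hh' i
    rw [hL, hc, map_mul, hQf, zero_mul, Pi.zero_apply]
  · refine LinearMap.mem_ker.mpr (funext fun i => ?_)
    rw [hL]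
    exact hh.2.1 (Sum.inr ()) i

theorem exists_replacement [IsAlgClosed K] {τ : Type*} [DecidableEq τ] {w : τ → Fin 3 → K} (t₀ : τ)
    (hL : LineConfig (modFirst K 3 f) α β r) (hw : eval (w t₀) (modFirst K 3 f) = 0)
    (hU : ∀ h ∈ stepSpace d z (Set.range w), ∀ i, f ∣ h i) :
    ∃ y, eval y (modFirst K 3 f) = 0 ∧ eval y (∏ j, line (α j) (β j)) ≠ 0 ∧
      ∀ h ∈ stepSpace d z (Set.range (Function.update w t₀ y)), ∀ i, f ∣ h i := by
  let V := stepSpace d z (w '' {t₀}ᶜ)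
  let L : (Fin 3 → K) → V →ₗ[K] (Fin 3 × Fin 3 → K) := fun x =>
    LinearMap.pi fun p => x p.2 • ((aeval x).toLinearMap ∘ₗ (modFirst K 3).toLinearMap ∘ₗ
      LinearMap.proj p.1 ∘ₗ Submodule.subtype _) - x p.1 • ((aeval x).toLinearMap ∘ₗ
      (modFirst K 3).toLinearMap ∘ₗ LinearMap.proj p.2 ∘ₗ Submodule.subtype _)
  have hLe : ∀ x h p, L x h p = x p.2 * eval x (modFirst K 3 (h.1 p.1)) -
      x p.1 * eval x (modFirst K 3 (h.1 p.2)) := fun x h p => by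
    simp [L, aeval_eq_eval]
  have hker : ∀ x (h : V), h ∈ LinearMap.ker (L x) ↔ ∀ i l,
      eval x (modFirst K 3 (h.1 i)) * x l = eval x (modFirst K 3 (h.1 l)) * x i := fun x h => by
    rw [LinearMap.mem_ker, funext_iff, Prod.forall]
    refine forall₂_congr fun i l => ?_
    rw [hLe, Pi.zero_apply, sub_eq_zero, mul_comm (x l), mul_comm (x i)]
  obtain ⟨P, hP₀, hP⟩ := exists_ker_le (L := L) (x₀ := w t₀)
    (fun h p => by
      simp only [hLe]
      exact ((IsPolyFun.coord _).mul (IsPolyFun.evalAt _ fun t => .coord t)).sub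
        ((IsPolyFun.coord _).mul (IsPolyFun.evalAt _ fun t => .coord t)))
    ((divSpace (Fin 3) f).comap (Submodule.subtype _)) fun h hh => by
      refine hU h.1 ⟨h.2.1, h.2.2.1, ?_⟩
      rintro _ ⟨t, rfl⟩
      by_cases ht : t = t₀
      · rw [ht]; exact (hker _ h).mp hh
      · exact h.2.2.2 _ ⟨t, ht, rfl⟩
  obtain ⟨y, hy, hyne⟩ : ∃ y, eval y (modFirst K 3 f) = 0 ∧
      eval y (P * ∏ j, line (α j) (β j)) ≠ 0 := by
    by_contra! hcon
    exact hP₀ (hL.eval_eq_zero_of_eval_mul hcon hw)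
  rw [map_mul, mul_ne_zero_iff] at hyne
  refine ⟨y, hy, hyne.2, fun h hh => ?_⟩
  have hV : h ∈ V := ⟨hh.1, hh.2.1, by
    rintro _ ⟨t, ht, rfl⟩
    have := hh.2.2 _ ⟨t, rfl⟩
    rwa [Function.update_of_ne ht] at this⟩
  refine hP y hyne.1 (fun h' hh' => (hker _ _).mpr fun i l => ?_)
    (show (⟨h, hV⟩ : V) ∈ _ from (hker _ _).mpr ?_)
  · have h0 : ∀ i, eval y (modFirst K 3 (h'.1 i)) = 0 := fun i => by
      obtain ⟨c, hc⟩ : f ∣ h'.1 i := hh' i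
      rw [hc, map_mul, map_mul, hy, zero_mul]
    rw [h0, h0, zero_mul, zero_mul]
  · have := hh.2.2 _ ⟨t₀, rfl⟩
    rwa [Function.update_self] at this

theorem eigenRigid_succ [IsAlgClosed K] (hf : f.IsHomogeneous 3) (hz : ∀ s, eval (z s) f = 0)
    (hz0 : ∀ s, z s 0 ≠ 0) (hL : LineConfig (modFirst K 3 f) α β r)
    {w : Fin (e + 1) × Fin 3 → Fin 3 → K} (t₀ : Fin (e + 1) × Fin 3)
    (hw : ∀ t ≠ t₀, w t = linePt (α t.1) (β t.1) (r t.1 t.2))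
    (hy : eval (w t₀) (modFirst K 3 f) = 0) (hyP : eval (w t₀) (∏ j, line (α j) (β j)) ≠ 0)
    (hU : ∀ h ∈ stepSpace (e + 1) z (Set.range w), ∀ i, f ∣ h i) :
    EigenRigid f (e + 1) (Sum.elim z fun t => Fin.cons 0 (w t)) := by
  have hE : (modFirst K 3 f).IsHomogeneous 3 :=
    HomW.iff_isHomogeneous.mp (HomW.iff_isHomogeneous.mpr hf).modFirst
  intro H hH hev
  have hplane : ∀ t, ∃ c : K, eval (w t) (modFirst K 3 (H 0)) = 0 ∧
      ∀ i : Fin 3, eval (w t) (modFirst K 3 (H i.succ)) = c * w t i := fun t => by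
    obtain ⟨c, hc⟩ := hev (Sum.inr t)
    simp only [Sum.elim_inr, eval_cons_zero] at hc
    exact ⟨c, by simpa using hc 0, fun i => by simpa using hc i.succ⟩
  have hdvd : modFirst K 3 f ∣ modFirst K 3 (H 0) := by
    obtain ⟨c, a, hca⟩ := hL.exists_eq_prod_mul_C hE (F := modFirst K 3 (H 0))
      (by simpa using HomW.iff_isHomogeneous.mp (HomW.iff_isHomogeneous.mpr (hH 0)).modFirst)
      t₀.1 t₀.2 fun j i hji => by
        have := (hplane (j, i)).choose_spec.1
        rwa [hw _ hji] at this
    have h0 := (hplane t₀).choose_spec.1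
    rw [hca, map_add, map_mul, hy, zero_mul, zero_add, map_mul, eval_C] at h0
    rw [hca, (mul_eq_zero.mp h0).resolve_left hyP, C_0, mul_zero, add_zero]
    exact dvd_mul_right _ _
  obtain ⟨c, g, hcg, hg⟩ := exists_eq_mul_add_X_mul hf (hH 0) hdvd
  refine ⟨g, fun i => ?_⟩
  cases i using Fin.cases with
  | zero => rw [hcg, add_sub_cancel_right]; exact dvd_mul_right _ _
  | succ i =>
    refine hU (fun i => H i.succ - X i.succ * g) ⟨fun i => (hH _).sub (by
      simpa [add_comm] using (isHomogeneous_X K i.succ).mul hg), fun s i => ?_, ?_⟩ i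
    · obtain ⟨a, ha⟩ := hev (Sum.inl s)
      simp only [Sum.elim_inl] at ha
      have h0 := ha 0
      rw [hcg, map_add, map_mul, hz, zero_mul, zero_add, map_mul, eval_X, mul_comm] at h0
      rw [map_sub, ha, ← mul_right_cancel₀ (hz0 s) h0, map_mul, eval_X]
      ring
    · rintro _ ⟨t, rfl⟩ i l
      obtain ⟨a, -, ha⟩ := hplane t
      simp only [map_sub, map_mul, ha, modFirst_X_succ, eval_X]
      ring

/-- Existence of a configuration of points on the surface `f = 0`, of the critical cardinality
in degree `e + 1`, which is rigid in degree `e`. -/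
def HasRigidConfig (f : MvPolynomial (Fin 4) K) (e : ℕ) : Prop :=
  ∃ (ι : Type) (_ : Fintype ι) (z : ι → Fin 4 → K),
    Fintype.card ι = 3 * ((e + 1) * e / 2) + (e + 1) ∧ (∀ s, z s ≠ 0) ∧
    (∀ s, eval (z s) f = 0) ∧ (Pairwise fun s t => LinearIndependent K ![z s, z t]) ∧
    EigenRigid f e z

theorem pairwise_sumElim {ι κ V : Type*} [AddCommGroup V] [Module K V] {x : ι → V} {y : κ → V}
    (hx : Pairwise fun s t => LinearIndependent K ![x s, x t])
    (hy : Pairwise fun s t => LinearIndependent K ![y s, y t])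
    (hxy : ∀ s t, LinearIndependent K ![x s, y t]) :
    Pairwise fun s t => LinearIndependent K ![Sum.elim x y s, Sum.elim x y t] := by
  rintro (s | s) (t | t) h
  · exact hx fun e => h (by rw [e])
  · exact hxy s t
  · exact LinearIndependent.pair_symm_iff.mp (hxy t s)
  · exact hy fun e => h (by rw [e])

theorem LineConfig.pairwise_linearIndependent {E : MvPolynomial (Fin 3) K} {κ : Type*}
    {α β : κ → K} {r : κ → Fin 3 → K} (hL : LineConfig E α β r) :
    Pairwise fun s t : κ × Fin 3 => LinearIndependent K
      ![linePt (α s.1) (β s.1) (r s.1 s.2), linePt (α t.1) (β t.1) (r t.1 t.2)] := by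
  rintro ⟨j, i⟩ ⟨j', i'⟩ h
  by_cases hj : j' = j
  · subst hj
    rw [LinearIndependent.pair_iff' (linePt_ne_zero _ _ _)]
    intro c hc
    have h0 := congrFun hc 0
    have h1 := congrFun hc 1
    simp only [linePt, Pi.smul_apply, smul_eq_mul, cons_val_zero, cons_val_one, mul_one] at h0 h1
    rw [h0, one_mul] at h1
    exact h (by rw [(hL.transversal j').injective h1])
  · exact linearIndependent_pair_of_eval (isHomogeneous_line _ _) (linePt_ne_zero _ _ _)
      (linePt_ne_zero _ _ _) (hL.eval_ne_zero j j' hj i) (eval_line_linePt _ _ _)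

theorem LineConfig.pairwise_of_ne {E : MvPolynomial (Fin 3) K} (hL : LineConfig E α β r)
    {w : Fin (e + 1) × Fin 3 → Fin 3 → K} (t₀ : Fin (e + 1) × Fin 3)
    (hw : ∀ t ≠ t₀, w t = linePt (α t.1) (β t.1) (r t.1 t.2))
    (hyP : eval (w t₀) (∏ j, line (α j) (β j)) ≠ 0) :
    (∀ t, w t ≠ 0) ∧ Pairwise fun s t => LinearIndependent K ![w s, w t] := by
  have hPh := isHomogeneous_prod_line α β Finset.univ
  have hpt : ∀ t : Fin (e + 1) × Fin 3,
      eval (linePt (α t.1) (β t.1) (r t.1 t.2)) (∏ j, line (α j) (β j)) = 0 := fun t => by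
    rw [map_prod]
    exact Finset.prod_eq_zero (Finset.mem_univ t.1) (eval_line_linePt _ _ _)
  have hyne : w t₀ ≠ 0 := fun h0 => by
    refine hyP ?_
    have := eval_smul_of_isHomogeneous hPh 0 0
    rwa [zero_smul, Finset.card_fin, zero_pow (Nat.succ_ne_zero e), zero_mul, ← h0] at this
  have hyt : ∀ t : Fin (e + 1) × Fin 3,
      LinearIndependent K ![w t₀, linePt (α t.1) (β t.1) (r t.1 t.2)] := fun t =>
    linearIndependent_pair_of_eval hPh hyne (linePt_ne_zero _ _ _) hyP (hpt t)
  refine ⟨fun t => ?_, fun s t hst => ?_⟩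
  · by_cases ht : t = t₀
    · rwa [ht]
    · rw [hw t ht]; exact linePt_ne_zero _ _ _
  · beta_reduce
    by_cases hs : s = t₀
    · rw [hs, hw t (by rw [← hs]; exact hst.symm)]
      exact hyt t
    · by_cases ht : t = t₀
      · rw [ht, hw s hs]
        exact LinearIndependent.pair_symm_iff.mp (hyt s)
      · rw [hw s hs, hw t ht]
        exact hL.pairwise_linearIndependent hst

theorem hasRigidConfig_succ_of_lineDisc [IsAlgClosed K] {ι : Type} [Fintype ι]
    {z : ι → Fin 4 → K} (he : 1 ≤ e) (hN : EigenRigid f e z) (hf : f.IsHomogeneous 3)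
    (hirr : Irreducible f) (hz : ∀ s, eval (z s) f = 0) (hz0 : ∀ s, z s 0 ≠ 0)
    (hpair : Pairwise fun s t => LinearIndependent K ![z s, z t])
    (hcard : Fintype.card ι = 3 * ((e + 1) * e / 2) + (e + 1))
    (hE0 : lineDisc (modFirst K 3 f) ![1, 0, 0] ![0, 1, 0] ≠ 0) : HasRigidConfig f (e + 1) := by
  obtain ⟨α, β, r, hL, hbad⟩ := exists_lineConfig_notMem_badSpace he hN hf hirr hz hz0 hcard hE0
  have hE0' : modFirst K 3 f ≠ 0 := fun h => by
    have := (hL.transversal 0).eval_ne_zero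
    rw [h, map_zero] at this
    exact this rfl
  obtain ⟨q, hq, hqU⟩ := exists_point_of_notMem_badSpace he hN hf hirr hE0' hz hz0 hL hbad
  obtain ⟨G, hG, hGz, hGf⟩ := exists_form_of_card hf he hcard z
  obtain ⟨Q, hQ, hQ0, hQG, hQU⟩ := exists_surface_point hf hirr hq hqU hGf
  obtain ⟨y, hy, hyP, hyU⟩ := exists_replacement
    (w := fun t : Fin (e + 1) × Fin 3 => linePt (α t.1) (β t.1) (r t.1 t.2)) (0, 0) hL
    ((hL.transversal 0).eval_linePt 0) hQU
  set w := Function.update (fun t : Fin (e + 1) × Fin 3 => linePt (α t.1) (β t.1) (r t.1 t.2))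
    (0, 0) y with hw
  have hw0 : w (0, 0) = y := Function.update_self ..
  have hwne : ∀ t ≠ (0, 0), w t = linePt (α t.1) (β t.1) (r t.1 t.2) := fun t ht =>
    Function.update_of_ne ht ..
  obtain ⟨hwnz, hwpair⟩ := hL.pairwise_of_ne (0, 0) hwne (by rwa [hw0])
  have hwE : ∀ t, eval (w t) (modFirst K 3 f) = 0 := fun t => by
    by_cases ht : t = (0, 0)
    · rwa [ht, hw0]
    · rw [hwne t ht]; exact (hL.transversal t.1).eval_linePt t.2
  have hcons : ∀ x : Fin 3 → K, x ≠ 0 → (Fin.cons 0 x : Fin 4 → K) ≠ 0 := fun x hx h =>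
    hx (funext fun i => by simpa using congrFun h i.succ)
  have hne : ∀ x : Fin 4 → K, x 0 ≠ 0 → x ≠ 0 := fun x hx h => hx (by rw [h, Pi.zero_apply])
  have hzQ : ∀ s, Sum.elim z (fun _ : Unit => Q) s 0 ≠ 0 := by
    rintro (s | s)
    exacts [hz0 s, hQ0]
  have hzQf : ∀ s, eval (Sum.elim z (fun _ : Unit => Q) s) f = 0 := by
    rintro (s | s)
    exacts [hz s, hQ]
  refine ⟨(ι ⊕ Unit) ⊕ (Fin (e + 1) × Fin 3), inferInstance,
    Sum.elim (Sum.elim z fun _ => Q) fun t => Fin.cons 0 (w t), ?_, ?_, ?_, ?_, ?_⟩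
  · rw [Fintype.card_sum, Fintype.card_sum, hcard, Fintype.card_unit, Fintype.card_prod,
      Fintype.card_fin, Fintype.card_fin]
    have h2 : (e + 1 + 1) * (e + 1) = (e + 1) * e + (e + 1) * 2 := by ring
    rw [h2, Nat.add_mul_div_right _ _ (by norm_num)]
    ring
  · rintro (s | t)
    exacts [hne _ (hzQ s), hcons _ (hwnz t)]
  · rintro (s | t)
    · exact hzQf s
    · rw [Sum.elim_inr, eval_cons_zero, hwE]
  · refine pairwise_sumElim (pairwise_sumElim hpair (fun _ _ h => (h rfl).elim) fun s _ => ?_)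
      (fun s t hst => ?_) fun s t => ?_
    · exact LinearIndependent.pair_symm_iff.mp
        (linearIndependent_pair_of_eval hG (hne _ hQ0) (hne _ (hz0 s)) hQG (hGz s))
    · beta_reduce
      rw [LinearIndependent.pair_iff' (hcons _ (hwnz s))]
      intro c hc
      refine (LinearIndependent.pair_iff' (hwnz s)).mp (hwpair hst) c (funext fun i => ?_)
      simpa using congrFun hc i.succ
    · exact linearIndependent_pair_of_eval (isHomogeneous_X K 0) (hne _ (hzQ s))
        (hcons _ (hwnz t)) (by rw [eval_X]; exact hzQ s) (by rw [eval_X, Fin.cons_zero])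
  · exact eigenRigid_succ hf hzQf hzQ hL (0, 0) hwne (by rw [hw0]; exact hy)
      (by rw [hw0]; exact hyP) hyU

end PlaneCubic

namespace PlaneCubic

open MvPolynomial Matrix

variable {K : Type*} [Field K]

theorem restrict_linSub {m n : ℕ} (A : Matrix (Fin m) (Fin n) K) (p : MvPolynomial (Fin m) K)
    (u w : Fin n → K) : restrict (linSub A p) u w = restrict p (A *ᵥ u) (A *ᵥ w) := by
  refine DFunLike.congr_fun (f := (aeval fun i => Polynomial.C (u i) + Polynomial.C (w i) *
    Polynomial.X).comp (linSub A)) (g := aeval fun i => Polynomial.C ((A *ᵥ u) i) +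
      Polynomial.C ((A *ᵥ w) i) * Polynomial.X) (MvPolynomial.algHom_ext fun i => ?_) p
  simp only [AlgHom.comp_apply, linSub_X, map_sum, map_mul, aeval_X, algHom_C,
    Polynomial.algebraMap_eq, mulVec, dotProduct, Finset.sum_mul, ← Finset.sum_add_distrib]
  exact Finset.sum_congr rfl fun j _ => by ring

theorem restrict_modFirst {n : ℕ} (p : MvPolynomial (Fin (n + 1)) K) (u w : Fin n → K) :
    restrict (modFirst K n p) u w =
      restrict p (Fin.cons 0 u : Fin (n + 1) → K) (Fin.cons 0 w : Fin (n + 1) → K) := by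
  refine DFunLike.congr_fun (f := (aeval fun i => Polynomial.C (u i) + Polynomial.C (w i) *
    Polynomial.X).comp (modFirst K n)) (g := aeval fun i =>
      Polynomial.C ((Fin.cons 0 u : Fin (n + 1) → K) i) +
        Polynomial.C ((Fin.cons 0 w : Fin (n + 1) → K) i) * Polynomial.X)
    (MvPolynomial.algHom_ext fun i => ?_) p
  cases i using Fin.cases with
  | zero => simp [modFirst_X_zero]
  | succ i => simp [modFirst_X_succ]

theorem lineDisc_modFirst_linSub (A : Matrix (Fin 4) (Fin 4) K) (f : MvPolynomial (Fin 4) K)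
    (u w : Fin 3 → K) : lineDisc (modFirst K 3 (linSub A f)) u w =
      lineDisc f (A *ᵥ Fin.cons 0 u) (A *ᵥ Fin.cons 0 w) := by
  simp only [lineDisc, restrictCubic, restrict_modFirst, restrict_linSub]

theorem exists_eval_ne_zero [Infinite K] {σ : Type*} {p : MvPolynomial σ K} (hp : p ≠ 0) :
    ∃ x, eval x p ≠ 0 := by
  by_contra! h
  exact hp (MvPolynomial.funext fun x => by rw [h, map_zero])

theorem linForm_ne_zero {n : ℕ} {c : Fin n → K} {i : Fin n} (hc : c i ≠ 0) :
    (∑ j, C (c j) * X j : MvPolynomial (Fin n) K) ≠ 0 := fun h => by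
  have := congrArg (eval (Pi.single i (1 : K))) h
  exact hc (by simpa [Pi.single_apply] using this)

section

variable {f : MvPolynomial (Fin 4) K}

theorem exists_lineDisc_ne_zero [IsAlgClosed K] (hf : f.IsHomogeneous 3) (hirr : Irreducible f)
    (hs : ∀ v : Fin 4 → K, v ≠ 0 → eval v f = 0 → ∃ i, eval v (pderiv i f) ≠ 0) :
    ∃ u w, lineDisc f u w ≠ 0 := by
  have hpd : ∀ i, (pderiv i f).IsHomogeneous 2 := fun i => hf.pderiv
  obtain ⟨i, p, hip⟩ : ∃ i p, eval p (pderiv i f) ≠ 0 := by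
    obtain ⟨v, hv, hv0⟩ := exists_eval_ne_zero_of_irreducible hirr (not_dvd_X hf 0)
    rw [eval_X] at hv0
    obtain ⟨i, hi⟩ := hs v (fun h => hv0 (by rw [h, Pi.zero_apply])) hv
    exact ⟨i, v, hi⟩
  obtain ⟨q, hq, hqp⟩ := exists_eval_ne_zero_of_irreducible
    (p := ∑ j, C (eval p (pderiv j f)) * X j) hirr fun h =>
      linForm_ne_zero (c := fun j => eval p (pderiv j f)) hip
        (eq_zero_of_dvd_of_lt (isHomogeneous_linForm _) hf h (by norm_num))
  simp only [map_sum, map_mul, eval_C, eval_X] at hqp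
  have hq0 : q ≠ 0 := by
    rintro rfl
    simp at hqp
  obtain ⟨l, hl⟩ := hs q hq0 hq
  let c : MvPolynomial (Fin 4) K := ∑ j, C (eval q (pderiv j f)) * X j
  let B : MvPolynomial (Fin 4) K := ∑ j, C (q j) * pderiv j f
  have hc : c ≠ 0 := linForm_ne_zero (c := fun j => eval q (pderiv j f)) hl
  have hB : B ≠ 0 := fun h => hqp (by
    have := congrArg (eval p) h
    simp only [B, map_sum, map_mul, eval_C, map_zero] at this
    rw [← this]
    exact Finset.sum_congr rfl fun j _ => mul_comm _ _)
  have hD : B ^ 2 - 4 * f * c ≠ 0 := fun h => by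
    have hdvd : f ∣ B ^ 2 := ⟨4 * c, by linear_combination h⟩
    exact hB (eq_zero_of_dvd_of_lt (IsHomogeneous.sum _ _ _ fun j _ => (hpd j).C_mul _) hf
      (hirr.prime.dvd_of_dvd_pow hdvd) (by norm_num : 2 < 3))
  obtain ⟨w, hw⟩ := exists_eval_ne_zero (mul_ne_zero (mul_ne_zero hirr.ne_zero hc) hD)
  refine ⟨q, w, fun h => hw ?_⟩
  simp only [lineDisc, restrictCubic, Cubic.discr, coeff_zero_restrict, coeff_one_restrict,
    coeff_two_restrict hf, coeff_three_restrict hf, hq] at h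
  have hBe : eval w B = ∑ i, q i * eval w (pderiv i f) := by simp [B]
  have hce : eval w c = ∑ i, w i * eval q (pderiv i f) := by simp [c, mul_comm]
  rw [← hBe, ← hce] at h
  have h2 : eval w f * eval w c ^ 2 * eval w (B ^ 2 - 4 * f * c) = 0 := by
    simp only [map_sub, map_mul, map_pow, map_ofNat]
    linear_combination h
  rw [map_mul, map_mul]
  rcases mul_eq_zero.mp h2 with h3 | h3
  · rcases mul_eq_zero.mp h3 with h4 | h4
    · rw [h4, zero_mul, zero_mul]
    · rw [eq_zero_of_pow_eq_zero h4, mul_zero, zero_mul]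
  · rw [h3, mul_zero]

theorem irreducible_linSub {A B : Matrix (Fin 4) (Fin 4) K} (h : A * B = 1) :
    Irreducible (linSub A f) ↔ Irreducible f :=
  MulEquiv.irreducible_iff (AlgEquiv.ofAlgHom (linSub A) (linSub B)
    (AlgHom.ext fun q => linSub_cancel (mul_eq_one_comm.mp h) q)
    (AlgHom.ext fun q => linSub_cancel h q))

theorem linearIndependent_mulVec {n : ℕ} {A B : Matrix (Fin n) (Fin n) K} (h : A * B = 1)
    {x y : Fin n → K} (hxy : LinearIndependent K ![x, y]) :
    LinearIndependent K ![B *ᵥ x, B *ᵥ y] := by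
  have := hxy.map' B.mulVecLin (LinearMap.ker_eq_bot.mpr
    (Function.LeftInverse.injective (g := A.mulVecLin) fun v => by
      simp [mulVec_mulVec, h]))
  have h2 : ![B *ᵥ x, B *ᵥ y] = B.mulVecLin ∘ ![x, y] := by
    funext i
    fin_cases i <;> rfl
  rwa [h2]

theorem mulVec_ne_zero {n : ℕ} {A B : Matrix (Fin n) (Fin n) K} (h : A * B = 1)
    {x : Fin n → K} (hx : x ≠ 0) : B *ᵥ x ≠ 0 := fun h0 => hx (by
  rw [← one_mulVec x, ← h, ← mulVec_mulVec, h0, mulVec_zero])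

theorem hasRigidConfig_of_linSub {A B : Matrix (Fin 4) (Fin 4) K} (h : A * B = 1) {e : ℕ}
    (hc : HasRigidConfig (linSub A f) e) : HasRigidConfig f e := by
  obtain ⟨ι, _, z, hcard, hz0, hz, hpair, hN⟩ := hc
  have h' : B * A = 1 := mul_eq_one_comm.mp h
  exact ⟨ι, inferInstance, fun s => A *ᵥ z s, hcard, fun s => mulVec_ne_zero h' (hz0 s),
    fun s => by rw [← eval_linSub, hz],
    fun s t hst => linearIndependent_mulVec h' (hpair hst), eigenRigid_linSub h hN⟩

theorem mul_inv_det_smul_adjugate {n : ℕ} {A : Matrix (Fin n) (Fin n) K} (hA : A.det ≠ 0) :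
    A * (A.det⁻¹ • A.adjugate) = 1 := by
  rw [mul_smul_comm, mul_adjugate, smul_smul, inv_mul_cancel₀ hA, one_smul]

theorem HasRigidConfig.succ [IsAlgClosed K] (hf : f.IsHomogeneous 3) (hirr : Irreducible f)
    (hs : ∀ v : Fin 4 → K, v ≠ 0 → eval v f = 0 → ∃ i, eval v (pderiv i f) ≠ 0) {e : ℕ}
    (he : 1 ≤ e) (hc : HasRigidConfig f e) : HasRigidConfig f (e + 1) := by
  obtain ⟨ι, _, z, hcard, hz0, hz, hpair, hN⟩ := hc
  let u : Fin 4 → K := Fin.cons 0 ![1, 0, 0]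
  let w : Fin 4 → K := Fin.cons 0 ![0, 1, 0]
  obtain ⟨A, hA, hAf, hAz⟩ : ∃ A : Matrix (Fin 4) (Fin 4) K, A.det ≠ 0 ∧
      lineDisc f (A *ᵥ u) (A *ᵥ w) ≠ 0 ∧ ∀ s, (A.adjugate *ᵥ z s) 0 ≠ 0 := by
    let M : (Fin 4 × Fin 4 → K) → Matrix (Fin 4) (Fin 4) K := fun x => of fun i j => x (i, j)
    have hM : ∀ i j, IsPolyFun fun x => M x i j := fun i j => IsPolyFun.coord (i, j)
    have hsurj : ∀ A, M (fun q => A q.1 q.2) = A := fun A => rfl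
    obtain ⟨x, hx⟩ := IsPolyFun.exists_ne_zero (Finset.univ : Finset (ι ⊕ Bool))
      (φ := Sum.elim (fun s x => ((M x).adjugate *ᵥ z s) 0)
        (fun b x => if b then (M x).det else lineDisc f (M x *ᵥ u) (M x *ᵥ w)))
      (by
        rintro (s | b) -
        · exact IsPolyFun.mulVec (v := fun _ => z s) (IsPolyFun.adjugate hM)
            (fun j => IsPolyFun.const _) _
        · cases b
          · exact isPolyFun_lineDisc f
              (fun i => IsPolyFun.mulVec (v := fun _ => u) hM (fun j => IsPolyFun.const _) i)
              fun i => IsPolyFun.mulVec (v := fun _ => w) hM (fun j => IsPolyFun.const _) i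
          · exact IsPolyFun.det hM)
      (by
        rintro (s | b) -
        · obtain ⟨A, hA, hAz⟩ := exists_matrix (κ := Unit) (u := fun _ => z s)
            (w := fun _ => Pi.single 0 1) (LinearIndependent.of_subsingleton () (hz0 s))
            (LinearIndependent.of_subsingleton () (by simp))
          refine ⟨fun q => A q.1 q.2, ?_⟩
          rw [Sum.elim_inl, hsurj, ← hAz (), mulVec_mulVec, adjugate_mul, smul_mulVec, one_mulVec]
          simpa using hA
        · cases b
          · obtain ⟨u', w', h⟩ := exists_lineDisc_ne_zero hf hirr hs
            refine ⟨fun q => ![0, u' q.1, w' q.1, 0] q.2, ?_⟩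
            have h1 : M (fun q => ![0, u' q.1, w' q.1, 0] q.2) *ᵥ u = u' := by
              funext i
              simp [M, u, mulVec, dotProduct, Fin.sum_univ_four]
            have h2 : M (fun q => ![0, u' q.1, w' q.1, 0] q.2) *ᵥ w = w' := by
              funext i
              simp [M, w, mulVec, dotProduct, Fin.sum_univ_four]
            change lineDisc f (M (fun q => ![0, u' q.1, w' q.1, 0] q.2) *ᵥ u)
              (M (fun q => ![0, u' q.1, w' q.1, 0] q.2) *ᵥ w) ≠ 0
            rwa [h1, h2]
          · exact ⟨fun q => (1 : Matrix (Fin 4) (Fin 4) K) q.1 q.2, by simp [hsurj]⟩)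
    refine ⟨M x, by simpa using hx (Sum.inr true) (Finset.mem_univ _),
      by simpa using hx (Sum.inr false) (Finset.mem_univ _), fun s => ?_⟩
    simpa using hx (Sum.inl s) (Finset.mem_univ _)
  have hAB := mul_inv_det_smul_adjugate hA
  refine hasRigidConfig_of_linSub hAB (hasRigidConfig_succ_of_lineDisc he
    ((eigenRigid_linSub_iff hAB).mpr hN) (isHomogeneous_linSub A hf)
    ((irreducible_linSub hAB).mpr hirr) (fun s => ?_) (fun s => ?_)
    (fun s t hst => linearIndependent_mulVec hAB (hpair hst)) hcard ?_)
  · rw [eval_linSub, mulVec_mulVec, hAB, one_mulVec, hz]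
  · rw [smul_mulVec, Pi.smul_apply, smul_eq_mul]
    exact mul_ne_zero (inv_ne_zero hA) (hAz s)
  · rwa [lineDisc_modFirst_linSub]

theorem eigenRigid_one_of_coords {p : Fin 4 → K} (hp : ∀ i, p i ≠ 0) :
    EigenRigid f 1 (Sum.elim (fun i : Fin 4 => (Pi.single i 1 : Fin 4 → K)) fun _ : Unit => p) := by
  intro h hh hev
  have hlin : ∀ i, ∃ a : Fin 4 → K, h i = ∑ j, C (a j) * X j := fun i => by
    have hm : h i ∈ homogeneousSubmodule (Fin 4) K 1 := hh i
    rw [homogeneousSubmodule_one_eq_span_X, Submodule.mem_span_range_iff_exists_fun] at hm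
    obtain ⟨a, ha⟩ := hm
    exact ⟨a, by rw [← ha]; simp only [smul_eq_C_mul]⟩
  choose a ha using hlin
  have hdiag : ∀ i j, i ≠ j → a i j = 0 := fun i j hij => by
    obtain ⟨c, hc⟩ := hev (Sum.inl j)
    have := hc i
    simpa [ha, Pi.single_apply, hij] using this
  have hh' : ∀ i, h i = C (a i i) * X i := fun i => by
    rw [ha, Finset.sum_eq_single i (fun j _ hj => by rw [hdiag i j hj.symm, C_0, zero_mul])
      (by simp)]
  obtain ⟨c, hc⟩ := hev (Sum.inr ())
  refine ⟨C c, fun i => ?_⟩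
  have := hc i
  rw [hh' i, Sum.elim_inr, map_mul, eval_C, eval_X] at this
  rw [hh' i, mul_right_cancel₀ (hp i) this, mul_comm, sub_self]
  exact dvd_zero _

theorem exists_linearIndependent_zeros [IsAlgClosed K] (hf : f.IsHomogeneous 3)
    (hirr : Irreducible f) : ∃ u : Fin 4 → Fin 4 → K, LinearIndependent K u ∧
      ∀ i, eval (u i) f = 0 := by
  have hspan : Submodule.span K {v : Fin 4 → K | eval v f = 0} = ⊤ := by
    by_contra hne
    obtain ⟨φ, hφ0, hφ⟩ := Submodule.exists_le_ker_of_lt_top _ (lt_top_iff_ne_top.mpr hne)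
    have hφv : ∀ v, φ v = ∑ i, φ (Pi.single i 1) * v i := fun v => by
      conv_lhs => rw [← Finset.univ_sum_single v]
      rw [map_sum]
      refine Finset.sum_congr rfl fun i _ => ?_
      rw [mul_comm, ← smul_eq_mul, ← map_smul, ← Pi.single_smul, smul_eq_mul, mul_one]
    obtain ⟨i, hi⟩ : ∃ i, φ (Pi.single i 1) ≠ 0 := by
      by_contra! h
      exact hφ0 (LinearMap.ext fun v => by rw [hφv]; simp [h])
    obtain ⟨v, hv, hv'⟩ := exists_eval_ne_zero_of_irreducible
      (p := ∑ j, C (φ (Pi.single j 1)) * X j) hirr fun h =>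
        linForm_ne_zero (c := fun j => φ (Pi.single j 1)) hi
          (eq_zero_of_dvd_of_lt (isHomogeneous_linForm _) hf h (by norm_num))
    refine hv' ?_
    simp only [map_sum, map_mul, eval_C, eval_X]
    rw [← hφv]
    exact hφ (Submodule.subset_span hv)
  obtain ⟨u, hu, -, hli⟩ :=
    Submodule.exists_fun_fin_finrank_span_eq K {v : Fin 4 → K | eval v f = 0}
  have hr : Module.finrank K (Submodule.span K {v : Fin 4 → K | eval v f = 0}) = 4 := by
    rw [hspan, finrank_top, Module.finrank_fin_fun]
  exact ⟨u ∘ finCongr hr.symm, hli.comp _ (finCongr hr.symm).injective, fun i => hu _⟩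

theorem hasRigidConfig_one [IsAlgClosed K] (hf : f.IsHomogeneous 3) (hirr : Irreducible f) :
    HasRigidConfig f 1 := by
  obtain ⟨u, hu, hu0⟩ := exists_linearIndependent_zeros hf hirr
  obtain ⟨A, hA, hAu⟩ := exists_matrix hu (w := fun i => (Pi.single i 1 : Fin 4 → K))
    (Pi.linearIndependent_single_one (Fin 4) K)
  have hAB := mul_inv_det_smul_adjugate hA
  refine hasRigidConfig_of_linSub hAB ?_
  have hf' := isHomogeneous_linSub A hf
  have hirr' := (irreducible_linSub (f := f) hAB).mpr hirr
  obtain ⟨p, hp, hpX⟩ := exists_eval_ne_zero_of_irreducible (p := ∏ i : Fin 4, X i) hirr'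
    fun h => by
      obtain ⟨i, -, hi⟩ := (hirr'.prime.dvd_finsetProd_iff _).mp h
      exact not_dvd_X hf' i hi
  rw [map_prod, Finset.prod_ne_zero_iff] at hpX
  simp only [eval_X] at hpX
  have hp0 : ∀ i, p i ≠ 0 := fun i => hpX i (Finset.mem_univ _)
  have hpne : p ≠ 0 := fun h => hp0 0 (by rw [h, Pi.zero_apply])
  have hsne : ∀ i : Fin 4, (Pi.single i 1 : Fin 4 → K) ≠ 0 := fun i => by simp
  refine ⟨Fin 4 ⊕ Unit, inferInstance, _, by simp, ?_, ?_, ?_, eigenRigid_one_of_coords hp0⟩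
  · rintro (i | _)
    exacts [hsne i, hpne]
  · rintro (i | _)
    · rw [Sum.elim_inl, eval_linSub, hAu, hu0]
    · exact hp
  · refine pairwise_sumElim (fun i j hij => ?_) (fun _ _ h => (h rfl).elim) fun i _ => ?_
    · exact linearIndependent_pair_of_eval (isHomogeneous_X K i) (hsne i) (hsne j)
        (by simp) (by rw [eval_X, Pi.single_eq_of_ne hij])
    · obtain ⟨j, hj⟩ := exists_ne i
      exact LinearIndependent.pair_symm_iff.mp (linearIndependent_pair_of_eval
        (isHomogeneous_X K j) hpne (hsne i) (by rw [eval_X]; exact hp0 j)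
        (by rw [eval_X, Pi.single_eq_of_ne hj]))

theorem hasRigidConfig [IsAlgClosed K] (hf : f.IsHomogeneous 3) (hirr : Irreducible f)
    (hs : ∀ v : Fin 4 → K, v ≠ 0 → eval v f = 0 → ∃ i, eval v (pderiv i f) ≠ 0) {e : ℕ}
    (he : 1 ≤ e) : HasRigidConfig f e := by
  induction e, he using Nat.le_induction with
  | base => exact hasRigidConfig_one hf hirr
  | succ e he ih => exact ih.succ hf hirr hs he

end

end PlaneCubic

namespace PlaneCubic

open MvPolynomial Matrix

variable {K : Type*} [Field K]

theorem EigenRigid.comp_equiv {ι κ : Type*} {n : ℕ} {f : MvPolynomial (Fin n) K} {d : ℕ}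
    {z : ι → Fin n → K} (hN : EigenRigid f d z) (φ : κ ≃ ι) :
    EigenRigid f d fun s => z (φ s) := fun h hh hev => hN h hh fun s => by
  simpa using hev (φ.symm s)

/-- Tuples of polynomials congruent modulo `f` to a multiple of the tuple of variables. -/
def radialSpace {n : ℕ} (f : MvPolynomial (Fin n) K) :
    Submodule K (Fin n → MvPolynomial (Fin n) K) where
  carrier := {h | ∃ g, ∀ i, f ∣ h i - X i * g}
  zero_mem' := ⟨0, by simp⟩
  add_mem' := by
    rintro h h' ⟨g, hg⟩ ⟨g', hg'⟩
    refine ⟨g + g', fun i => ?_⟩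
    have := dvd_add (hg i) (hg' i)
    rwa [show h i - X i * g + (h' i - X i * g') = (h + h') i - X i * (g + g') by
      rw [Pi.add_apply]; ring] at this
  smul_mem' := by
    rintro c h ⟨g, hg⟩
    refine ⟨C c * g, fun i => ?_⟩
    have := (hg i).mul_left (C c)
    rwa [show C c * (h i - X i * g) = (c • h) i - X i * (C c * g) by
      rw [Pi.smul_apply, ← C_mul']; ring] at this

theorem exists_eigenvalue_iff {n : ℕ} {y v : Fin n → K} (hy : y ≠ 0) :
    (∃ c, ∀ i, v i = c * y i) ↔ ∀ i j, v i * y j = v j * y i := by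
  constructor
  · rintro ⟨c, hc⟩ i j
    rw [hc, hc]
    ring
  · intro h
    obtain ⟨j, hj⟩ := Function.ne_iff.mp hy
    rw [Pi.zero_apply] at hj
    exact ⟨v j / y j, fun i => by rw [div_mul_eq_mul_div, eq_div_iff hj, h i j]⟩

/-- Rigidity of points on the hypersurface `f` is an open condition. -/
theorem EigenRigid.exists_poly {τ : Type*} [Fintype τ] {n : ℕ} {f : MvPolynomial (Fin n) K} {d : ℕ}
    {z : τ → Fin n → K} (hz0 : ∀ s, z s ≠ 0) (hN : EigenRigid f d z) :
    ∃ P : MvPolynomial (τ × Fin n) K, eval (fun q => z q.1 q.2) P ≠ 0 ∧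
      ∀ y : τ → Fin n → K, (∀ s, y s ≠ 0) → (∀ s, eval (y s) f = 0) →
        eval (fun q => y q.1 q.2) P ≠ 0 → EigenRigid f d y := by
  let V := homVec K (Fin n) (fun _ : Fin n => 0) d
  let L : (τ × Fin n → K) → V →ₗ[K] (τ × Fin n × Fin n → K) := fun x =>
    LinearMap.pi fun p => x (p.1, p.2.2) • ((aeval fun i => x (p.1, i)).toLinearMap ∘ₗ
      LinearMap.proj p.2.1 ∘ₗ Submodule.subtype _) - x (p.1, p.2.1) •
      ((aeval fun i => x (p.1, i)).toLinearMap ∘ₗ LinearMap.proj p.2.2 ∘ₗ Submodule.subtype _)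
  have hLe : ∀ x h p, L x h p = x (p.1, p.2.2) * eval (fun i => x (p.1, i)) (h.1 p.2.1) -
      x (p.1, p.2.1) * eval (fun i => x (p.1, i)) (h.1 p.2.2) := fun x h p => by
    simp [L, aeval_eq_eval]
  have hker : ∀ (y : τ → Fin n → K) (h : V), h ∈ LinearMap.ker (L fun q => y q.1 q.2) ↔
      ∀ s i j, eval (y s) (h.1 i) * y s j = eval (y s) (h.1 j) * y s i := fun y h => by
    rw [LinearMap.mem_ker, funext_iff, Prod.forall]
    refine forall_congr' fun s => ?_
    rw [Prod.forall]
    refine forall₂_congr fun i j => ?_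
    rw [hLe (fun q : τ × Fin n => y q.1 q.2) h (s, i, j), Pi.zero_apply,
      sub_eq_zero, mul_comm (y s j), mul_comm (y s i)]
  obtain ⟨P, hP₀, hP⟩ := exists_ker_le (L := L) (x₀ := fun q => z q.1 q.2)
    (fun h p => by
      simp only [hLe]
      exact ((IsPolyFun.coord _).mul (IsPolyFun.evalAt _ fun t => .coord _)).sub
        ((IsPolyFun.coord _).mul (IsPolyFun.evalAt _ fun t => .coord _)))
    ((radialSpace f).comap (Submodule.subtype _)) fun h hh =>
      hN h.1 (fun i => HomW.iff_isHomogeneous.mp (h.2 i)) fun s =>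
        (exists_eigenvalue_iff (v := fun i => eval (z s) (h.1 i)) (hz0 s)).mpr
          ((hker z h).mp hh s)
  refine ⟨P, hP₀, fun y hy0 hyf hyP h hh hev => ?_⟩
  have hhV : h ∈ V := fun i => HomW.iff_isHomogeneous.mpr (hh i)
  refine hP _ hyP (fun h' hh' => (hker y h').mpr fun s i j => ?_)
    (show (⟨h, hhV⟩ : V) ∈ _ from (hker y _).mpr fun s =>
      (exists_eigenvalue_iff (v := fun i => eval (y s) (h i)) (hy0 s)).mp (hev s))
  obtain ⟨g, hg⟩ : ∃ g, ∀ i, f ∣ h'.1 i - X i * g := hh'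
  have key : ∀ i, eval (y s) (h'.1 i) = y s i * eval (y s) g := fun i => by
    obtain ⟨c, hc⟩ := hg i
    have := congrArg (eval (y s)) hc
    rwa [map_mul, hyf, zero_mul, map_sub, map_mul, eval_X, sub_eq_zero] at this
  rw [key, key]
  ring

end PlaneCubic

open MvPolynomial PlaneCubic in
theorem vanishesAt_mk {k : Type} [Field k] {f : R4 k} {d : ℕ} (hf : f.IsHomogeneous d)
    {v : Fin 4 → k} (hv : v ≠ 0) (h : eval v f = 0) :
    VanishesAt k f (Projectivization.mk k v hv) := fun w hw hwv => by
  obtain ⟨c, rfl⟩ := (Projectivization.mk_eq_mk_iff' k w v hw hv).mp hwv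
  rw [eval_smul_of_isHomogeneous hf, h, mul_zero]

open PlaneCubic

/-- For `a ≥ 3`, a general set `Z` of `m(a) = (3/2)a(a-1) + a` points on a
smooth cubic surface `X ⊂ ℙ³` has graded minimal free resolution
`0 → R(-a-3)^(a-1) → R(-a-1)^(3a) → R(-a)^(2a+1) ⊕ R(-3) → I_Z → 0`. -/
theorem mrc_cubic_resolution_m (k : Type) [Field k] [IsAlgClosed k]
    (S : SmoothCubicSurface k) (a : ℕ) (ha : 3 ≤ a) :
    GeneralPointsSatisfy k S (3 * (a * (a - 1) / 2) + a) (fun Z =>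
      HasMinFreeRes3 k ⊥ (pointsIdeal k (Set.range Z))
        (Fin.append (fun _ : Fin (2 * a + 1) => a) (fun _ : Fin (1) => 3))
        (fun _ : Fin (3 * a) => a + 1)
        (fun _ : Fin (a - 1) => a + 3)) := by
  have : Infinite k := IsAlgClosed.instInfinite
  obtain ⟨ι, _, z, hcard, hz0, hz, hpair, hN⟩ :=
    hasRigidConfig S.homog S.irred S.smooth (e := a - 1) (by omega)
  rw [Nat.sub_add_cancel (by omega : 1 ≤ a)] at hcard
  let φ := (Fintype.equivFinOfCardEq hcard).symm
  obtain ⟨P, hP₀, hP⟩ := (hN.comp_equiv φ).exists_poly fun s => hz0 (φ s)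
  unfold GeneralPointsSatisfy
  refine ⟨P, ⟨fun s => Projectivization.mk k (z (φ s)) (hz0 _), ⟨fun s t hst => ?_, fun s =>
    vanishesAt_mk S.homog _ (hz _)⟩, fun s => z (φ s), fun s => ⟨hz0 _, rfl⟩, hP₀⟩, ?_⟩
  · by_contra hne
    obtain ⟨c, hc⟩ := (Projectivization.mk_eq_mk_iff' k _ _ (hz0 _) (hz0 _)).mp hst
    exact (LinearIndependent.pair_iff' (hz0 (φ t))).mp
      (hpair fun h => hne (φ.injective h).symm) c hc
  · rintro Z ⟨-, hZ⟩ ⟨v, hv, hvP⟩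
    have hv0 : ∀ s, v s ≠ 0 := fun s => (hv s).choose
    have hvf : ∀ s, MvPolynomial.eval (v s) S.f = 0 := fun s => hZ s _ (hv0 s) (hv s).choose_spec
    rw [pointsIdeal_range hv]
    exact hasMinFreeRes3_of_eigenRigid S.homog S.irred.ne_zero hv0 hvf ha (by simp)
      (hP v hv0 hvf hvP)
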